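/- Let (s, [·,·], ⟨·,·⟩) be a solsoliton with Ric = cI + D, c < 0, with nilradical n and a = n^⊥. Define a new bracket [·,·]' on s by [A, A']' = 0 for A, A' ∈ a, [A, X]' = S(ad A)X for A ∈ a, X ∈ n, and [X, Y]' = [X, Y] for X, Y ∈ n. Then: [·,·]' is a Lie bracket on s; (n, ⟨·,·⟩|_{n×n}) is a nilsoliton with Ric₁ = cI + D₁; the operators S(ad A)|_n for A ∈ a form an abelian Lie algebra ã of ⟨·,·⟩-symmetric derivations of (n, ⟨·,·⟩|_{n×n}); ⟨A, A⟩ = -(1/c)·tr((S(ad A)|_n)²) for every A ∈ a; and (s, [·,·]', ⟨·,·⟩) coincides with the metric solvable Lie algebra obtained from the nilsoliton (n, ⟨·,·⟩|_{n×n}) and the abelian algebra ã via the standard construction, hence is again a solsoliton with the same constant c. -/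

import Mathlib

noncomputable section

open scoped RealInnerProductSpace

/-! ### Lie-algebraic notions for a bracket given as a bundled bilinear map -/

section Alg

variable {E : Type*} [AddCommGroup E] [Module ℝ E]

/-- `μ` is a Lie bracket: alternating and satisfying the (Leibniz form of the) Jacobi identity. -/
def IsLieBracket (μ : E →ₗ[ℝ] E →ₗ[ℝ] E) : Prop :=
  (∀ X, μ X X = 0) ∧ ∀ X Y Z, μ X (μ Y Z) = μ (μ X Y) Z + μ Y (μ X Z)

/-- `D` is a derivation of the algebra `(E, μ)`. -/
def IsDeriv (μ : E →ₗ[ℝ] E →ₗ[ℝ] E) (D : E →ₗ[ℝ] E) : Prop :=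
  ∀ X Y, D (μ X Y) = μ (D X) Y + μ X (D Y)

/-- The subspace spanned by brackets of elements of `p` and `q`. -/
def bracketSpan (μ : E →ₗ[ℝ] E →ₗ[ℝ] E) (p q : Submodule ℝ E) : Submodule ℝ E :=
  Submodule.span ℝ {z | ∃ x ∈ p, ∃ y ∈ q, μ x y = z}

/-- Derived series of `(E, μ)`. -/
def derSeries (μ : E →ₗ[ℝ] E →ₗ[ℝ] E) : ℕ → Submodule ℝ E
  | 0 => ⊤
  | k + 1 => bracketSpan μ (derSeries μ k) (derSeries μ k)

/-- `(E, μ)` is a solvable Lie algebra. -/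
def IsSolvableB (μ : E →ₗ[ℝ] E →ₗ[ℝ] E) : Prop := ∃ k, derSeries μ k = ⊥

/-- Lower central series of the subalgebra `p` of `(E, μ)`. -/
def lcsOn (μ : E →ₗ[ℝ] E →ₗ[ℝ] E) (p : Submodule ℝ E) : ℕ → Submodule ℝ E
  | 0 => p
  | k + 1 => bracketSpan μ p (lcsOn μ p k)

/-- The subalgebra `p` of `(E, μ)` is a nilpotent Lie algebra. -/
def IsNilpotentOn (μ : E →ₗ[ℝ] E →ₗ[ℝ] E) (p : Submodule ℝ E) : Prop := ∃ k, lcsOn μ p k = ⊥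

/-- `p` is an ideal of `(E, μ)`. -/
def IsIdeal (μ : E →ₗ[ℝ] E →ₗ[ℝ] E) (p : Submodule ℝ E) : Prop := ∀ X : E, ∀ Y ∈ p, μ X Y ∈ p

/-- `p` is the nilradical (maximal nilpotent ideal) of `(E, μ)`. -/
def IsNilradical (μ : E →ₗ[ℝ] E →ₗ[ℝ] E) (p : Submodule ℝ E) : Prop :=
  IsIdeal μ p ∧ IsNilpotentOn μ p ∧ ∀ q, IsIdeal μ q → IsNilpotentOn μ q → q ≤ p

/-- The natural action `π(f)μ` of `f ∈ End(E)` on bilinear maps: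
`(π(f)μ)(X,Y) = f(μ(X,Y)) - μ(fX,Y) - μ(X,fY)`. -/
def piAct (f : E →ₗ[ℝ] E) (μ : E →ₗ[ℝ] E →ₗ[ℝ] E) : E →ₗ[ℝ] E →ₗ[ℝ] E :=
  (LinearMap.llcomp ℝ E E E f) ∘ₗ μ - μ ∘ₗ f - (LinearMap.lcomp ℝ E f) ∘ₗ μ

/-- The center of `(E, μ)`. -/
def centerB (μ : E →ₗ[ℝ] E →ₗ[ℝ] E) : Submodule ℝ E where
  carrier := {X | μ X = 0}
  add_mem' := by intro a b ha hb; simp only [Set.mem_setOf_eq, map_add] at *; rw [ha, hb, add_zero]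
  zero_mem' := by simp only [Set.mem_setOf_eq, map_zero]
  smul_mem' := by intro c a ha; simp only [Set.mem_setOf_eq, map_smul] at *; rw [ha, smul_zero]

end Alg

/-! ### Metric notions -/

section MetricDefs

variable {E : Type*} [NormedAddCommGroup E] [InnerProductSpace ℝ E] [FiniteDimensional ℝ E]

/-- The transpose of an operator with respect to the inner product. -/
def transp (f : E →ₗ[ℝ] E) : E →ₗ[ℝ] E := LinearMap.adjoint f

/-- The symmetric part `S(f) = (f + fᵗ)/2` of an operator. -/
def symPart (f : E →ₗ[ℝ] E) : E →ₗ[ℝ] E := (1 / 2 : ℝ) • (f + transp f)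

variable (E) in
/-- A fixed orthonormal basis of `E`. -/
def stdONB : OrthonormalBasis (Fin (Module.finrank ℝ E)) ℝ E := stdOrthonormalBasis ℝ E

/-- The operator `R` appearing in the formula for the Ricci operator of a metric Lie algebra:
`⟨R X, X⟩ = -(1/2) Σ ⟨[X,Xᵢ],Xⱼ⟩² + (1/4) Σ ⟨[Xᵢ,Xⱼ],X⟩²` for any orthonormal basis `{Xᵢ}`. -/
def Rop (μ : E →ₗ[ℝ] E →ₗ[ℝ] E) : E →ₗ[ℝ] E :=
  (-(1 / 2 : ℝ)) • ∑ i, (transp (μ (stdONB E i))) ∘ₗ (μ (stdONB E i))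
    + (1 / 4 : ℝ) • ∑ i, (μ (stdONB E i)) ∘ₗ (transp (μ (stdONB E i)))

/-- The symmetric operator `B` defined by the Killing form: `⟨B X, X⟩ = tr((ad X)²)`. -/
def Bop (μ : E →ₗ[ℝ] E →ₗ[ℝ] E) : E →ₗ[ℝ] E :=
  ∑ i, (((LinearMap.trace ℝ E) ∘ₗ (LinearMap.lcomp ℝ E (μ (stdONB E i))) ∘ₗ μ).smulRight
    (stdONB E i))

/-- The mean curvature vector `H`, characterized by `⟨H, X⟩ = tr (ad X)`. -/
def meanCurv (μ : E →ₗ[ℝ] E →ₗ[ℝ] E) : E :=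
  ∑ i, (LinearMap.trace ℝ E (μ (stdONB E i))) • (stdONB E i : E)

/-- The Ricci operator `Ric = R - (1/2) B - S(ad H)` of a metric Lie algebra. -/
def Ric (μ : E →ₗ[ℝ] E →ₗ[ℝ] E) : E →ₗ[ℝ] E :=
  Rop μ - (1 / 2 : ℝ) • Bop μ - symPart (μ (meanCurv μ))

/-- `(E, μ, ⟨⬝,⬝⟩)` is a solsoliton: `Ric = c I + D` for some `c ∈ ℝ` and derivation `D`. -/
def IsSolsoliton (μ : E →ₗ[ℝ] E →ₗ[ℝ] E) : Prop :=
  ∃ (c : ℝ) (D : E →ₗ[ℝ] E), IsDeriv μ D ∧ Ric μ = c • LinearMap.id + D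

/-- The natural inner product on bilinear maps, `⟨μ,ν⟩ = Σ ⟨μ(Xᵢ,Xⱼ), ν(Xᵢ,Xⱼ)⟩`. -/
def binner (μ ν : E →ₗ[ℝ] E →ₗ[ℝ] E) : ℝ :=
  ∑ i, ∑ j, ⟪μ (stdONB E i) (stdONB E j), ν (stdONB E i) (stdONB E j)⟫

/-- Orthogonal projection onto a subspace, as an endomorphism of `E`. -/
def projL (p : Submodule ℝ E) : E →ₗ[ℝ] E :=
  p.subtype ∘ₗ (Submodule.orthogonalProjection p).toLinearMap

/-- An orthonormal basis of the subspace `p`, as a family of vectors of `E`. -/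
def onbOf (p : Submodule ℝ E) : Fin (Module.finrank ℝ ↥p) → E :=
  fun i => ((stdOrthonormalBasis ℝ ↥p) i : E)

/-- The restriction `ad X |_p` of `ad X` to the subspace `p`, as an endomorphism of `E`
(it kills `pᗮ`). -/
def adOn (μ : E →ₗ[ℝ] E →ₗ[ℝ] E) (p : Submodule ℝ E) (X : E) : E →ₗ[ℝ] E :=
  (μ X) ∘ₗ projL p

/-- The Ricci operator of the restricted metric Lie algebra `(p, μ|ₚ, ⟨⬝,⬝⟩|ₚ)`, for `p` a
bracket-closed subspace, realized as an endomorphism of `E` killing `pᗮ`.  (For `p` nilpotent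
this is the full Ricci operator of `p`.) -/
def RopOn (μ : E →ₗ[ℝ] E →ₗ[ℝ] E) (p : Submodule ℝ E) : E →ₗ[ℝ] E :=
  (-(1 / 2 : ℝ)) • ∑ i, (transp (adOn μ p (onbOf p i))) ∘ₗ (adOn μ p (onbOf p i))
    + (1 / 4 : ℝ) • ∑ i, (adOn μ p (onbOf p i)) ∘ₗ (transp (adOn μ p (onbOf p i)))

/-- The metric nilpotent Lie algebra `(p, μ|ₚ, ⟨⬝,⬝⟩|ₚ)` is a nilsoliton with Ricci operator
`c I + D₁`, where `D₁` is (induced by) a derivation of `p`. -/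
def IsNilsolitonOn (μ : E →ₗ[ℝ] E →ₗ[ℝ] E) (p : Submodule ℝ E) (c : ℝ) (D₁ : E →ₗ[ℝ] E) :
    Prop :=
  (∀ X ∈ p, D₁ X ∈ p) ∧ (∀ X ∈ p, ∀ Y ∈ p, D₁ (μ X Y) = μ (D₁ X) Y + μ X (D₁ Y)) ∧
    ∀ X ∈ p, RopOn μ p X = c • X + D₁ X

end MetricDefs

section ModifiedBracket

variable {E : Type*} [NormedAddCommGroup E] [InnerProductSpace ℝ E] [FiniteDimensional ℝ E]

/-- The adjoint (transpose) operation, as a linear endomorphism of `End(E)`. -/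
def adjL : (E →ₗ[ℝ] E) →ₗ[ℝ] (E →ₗ[ℝ] E) where
  toFun f := LinearMap.adjoint f
  map_add' f g := map_add _ f g
  map_smul' r f := by simp

/-- The linear map `X ↦ S(ad (P_a X))`, where `a = nᗮ`. -/
def symAct (μ : E →ₗ[ℝ] E →ₗ[ℝ] E) (n : Submodule ℝ E) : E →ₗ[ℝ] (E →ₗ[ℝ] E) :=
  ((1 / 2 : ℝ) • (LinearMap.id + adjL)) ∘ₗ μ ∘ₗ projL nᗮ

/-- The modified bracket `[⬝,⬝]'` of a solvmanifold: `[A,A']' = 0`, `[A,X]' = S(ad A) X`,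
`[X,Y]' = [X,Y]` for `A, A' ∈ a = nᗮ` and `X, Y ∈ n`. -/
def modBracket (μ : E →ₗ[ℝ] E →ₗ[ℝ] E) (n : Submodule ℝ E) : E →ₗ[ℝ] E →ₗ[ℝ] E :=
  (LinearMap.lcomp ℝ E (projL n)) ∘ₗ μ ∘ₗ projL n
    + (LinearMap.lcomp ℝ E (projL n)) ∘ₗ symAct μ n
    - (symAct μ n).flip ∘ₗ projL n

end ModifiedBracket

/-! ### Weighted filtrations compatible with an algebra structure -/

section Filtration

variable {K V ι : Type*} [Field K] [AddCommGroup V] [Module K V]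

/-- The filtration of `V` by the weights `w` of the basis `f`. -/
def fil (f : Module.Basis ι K V) (w : ι → ℝ) (a : ℝ) : Submodule K V where
  carrier := {x | ∀ i, f.repr x i ≠ 0 → a ≤ w i}
  add_mem' := by
    intro x y hx hy i hi
    by_cases h : f.repr x i = 0
    · exact hy i (fun h' => hi (by simp [h, h']))
    · exact hx i h
  zero_mem' := by intro i hi; simp at hi
  smul_mem' := by
    intro r x hx i hi
    exact hx i (fun h => hi (by simp [h]))

/-- The strict version of `fil`. -/
def filLT (f : Module.Basis ι K V) (w : ι → ℝ) (a : ℝ) : Submodule K V where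
  carrier := {x | ∀ i, f.repr x i ≠ 0 → a < w i}
  add_mem' := by
    intro x y hx hy i hi
    by_cases h : f.repr x i = 0
    · exact hy i (fun h' => hi (by simp [h, h']))
    · exact hx i h
  zero_mem' := by intro i hi; simp at hi
  smul_mem' := by
    intro r x hx i hi
    exact hx i (fun h => hi (by simp [h]))

/-- The weights `w` of the basis `f` are superadditive for the product `lam`. -/
def Compat (lam : V →ₗ[K] V →ₗ[K] V) (f : Module.Basis ι K V) (w : ι → ℝ) : Prop :=
  ∀ i j k, f.repr (lam (f i) (f j)) k ≠ 0 → w i + w j ≤ w k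

theorem mem_fil {f : Module.Basis ι K V} {w : ι → ℝ} {a : ℝ} {x : V} :
    x ∈ fil f w a ↔ ∀ i, f.repr x i ≠ 0 → a ≤ w i := Iff.rfl

theorem fil_mono (f : Module.Basis ι K V) (w : ι → ℝ) {a b : ℝ} (h : a ≤ b) :
    fil f w b ≤ fil f w a := fun _ hx i hi => h.trans (hx i hi)

theorem basis_mem_fil (f : Module.Basis ι K V) (w : ι → ℝ) {a : ℝ} {i : ι} (h : a ≤ w i) :
    f i ∈ fil f w a := by
  classical
  intro j hj
  rw [f.repr_self, Finsupp.single_apply] at hj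
  split_ifs at hj with hij
  · exact hij ▸ h
  · exact absurd rfl hj

variable [Fintype ι]

theorem fil_le_of_basis {f : Module.Basis ι K V} {w : ι → ℝ} {a : ℝ} {p : Submodule K V}
    (h : ∀ i, a ≤ w i → f i ∈ p) : fil f w a ≤ p := by
  intro x hx
  rw [← f.sum_repr x]
  refine Submodule.sum_mem _ fun i _ => ?_
  by_cases hi : f.repr x i = 0
  · simp [hi]
  · exact p.smul_mem _ (h i (hx i hi))

theorem fil_le_fil {f g : Module.Basis ι K V} {w u : ι → ℝ}
    (h : ∀ i, g i ∈ fil f w (u i)) (a : ℝ) : fil g u a ≤ fil f w a :=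
  fil_le_of_basis fun i hi => fil_mono f w hi (h i)

theorem compat_iff {lam : V →ₗ[K] V →ₗ[K] V} {f : Module.Basis ι K V} {w : ι → ℝ} :
    Compat lam f w ↔
      ∀ a b, ∀ x ∈ fil f w a, ∀ y ∈ fil f w b, lam x y ∈ fil f w (a + b) := by
  constructor
  · intro h a b x hx y hy
    have key : fil f w a ≤ (fil f w (a + b)).comap (lam.flip y) := by
      refine fil_le_of_basis fun i hi => ?_
      have : fil f w b ≤ (fil f w (a + b)).comap (lam (f i)) := by
        refine fil_le_of_basis fun j hj => ?_
        intro k hk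
        exact (add_le_add hi hj).trans (h i j k hk)
      exact this hy
    exact key hx
  · intro h i j k hk
    exact h _ _ _ (basis_mem_fil f w le_rfl) _ (basis_mem_fil f w le_rfl) k hk

theorem Compat.of_fil_eq {lam : V →ₗ[K] V →ₗ[K] V} {f g : Module.Basis ι K V} {w u : ι → ℝ}
    (h : Compat lam f w) (hfg : fil g u = fil f w) : Compat lam g u := by
  rw [compat_iff] at h ⊢
  rwa [hfg]

theorem exists_exchange [DecidableEq ι] (f : Module.Basis ι K V) (w : ι → ℝ) {i₀ : ι} {y : V}
    (hy : y ∈ fil f w (w i₀)) (h0 : f.repr y i₀ ≠ 0) :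
    ∃ g : Module.Basis ι K V, (∀ i, g i = if i = i₀ then y else f i) ∧ fil g w = fil f w := by
  let φ : V →ₗ[K] V := LinearMap.id + (f.coord i₀).smulRight (y - f i₀)
  have hφ : Function.Injective φ := by
    rw [← LinearMap.ker_eq_bot, LinearMap.ker_eq_bot']
    intro x hx
    have h1 : f.repr (φ x) i₀ = f.repr x i₀ * f.repr y i₀ := by
      simp [φ]; ring
    rw [hx] at h1
    have h2 : f.repr x i₀ = 0 := by
      simpa [h0, eq_comm] using h1
    have : φ x = x := by simp [φ, h2]
    rw [← this, hx]
  have := f.finiteDimensional_of_finite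
  let g := f.map (LinearEquiv.ofInjectiveEndo φ hφ)
  have hg : ∀ i, g i = if i = i₀ then y else f i := by
    intro i
    have : g i = φ (f i) := by simp [g]
    rw [this]
    by_cases h : i = i₀
    · subst h; simp [φ]
    · simp [φ, h]
  refine ⟨g, hg, ?_⟩
  funext a
  refine le_antisymm (fil_le_fil (fun i => ?_) a) (fil_le_fil (fun i => ?_) a)
  · rw [hg]
    split_ifs with h
    · exact h ▸ hy
    · exact basis_mem_fil f w le_rfl
  · by_cases h : i = i₀
    · subst h
      have h1 : f.repr y i • f i = y - ∑ j ∈ Finset.univ.erase i, f.repr y j • f j := by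
        rw [eq_sub_iff_add_eq, Finset.add_sum_erase _ (fun j => f.repr y j • f j)
          (Finset.mem_univ i), f.sum_repr]
      have h2 : f i = (f.repr y i)⁻¹ • (y - ∑ j ∈ Finset.univ.erase i, f.repr y j • f j) := by
        rw [← h1, smul_smul, inv_mul_cancel₀ h0, one_smul]
      rw [h2]
      refine Submodule.smul_mem _ _ (Submodule.sub_mem _ ?_ (Submodule.sum_mem _ fun j hj => ?_))
      · have : y = g i := by rw [hg]; simp
        rw [this]
        exact basis_mem_fil g w le_rfl
      · by_cases hj0 : f.repr y j = 0
        · simp [hj0]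
        · refine Submodule.smul_mem _ _ ?_
          have : f j = g j := by rw [hg, if_neg (Finset.ne_of_mem_erase hj)]
          rw [this]
          exact basis_mem_fil g w (hy j hj0)
    · have : f i = g i := by rw [hg, if_neg h]
      rw [this]
      exact basis_mem_fil g w le_rfl

theorem exists_joint_basis [Nonempty ι] (f₁ f₂ : Module.Basis ι K V) (w₁ w₂ : ι → ℝ) :
    ∃ (g : Module.Basis ι K V) (u : ι → ℝ), fil g w₁ = fil f₁ w₁ ∧ fil g u = fil f₂ w₂ := by
  classical
  let S : Set (ι → ι) := {φ | ∃ g : Module.Basis ι K V, fil g w₁ = fil f₁ w₁ ∧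
    ∀ i, g i ∈ fil f₂ w₂ (w₂ (φ i))}
  have hS : S.Nonempty := by
    obtain ⟨k, hk⟩ := Finite.exists_min w₂
    exact ⟨fun _ => k, f₁, rfl, fun i j _ => hk j⟩
  obtain ⟨φ, ⟨g, hg1, hg2⟩, hmax⟩ :=
    Set.exists_max_image S (fun φ => ∑ i, w₂ (φ i)) (Set.toFinite S) hS
  refine ⟨g, fun i => w₂ (φ i), hg1, ?_⟩
  funext a
  refine le_antisymm (fil_le_fil hg2 a) ?_
  intro x hx i hi
  by_contra hlt
  push Not at hlt
  obtain ⟨i₁, hi₁, hmin₁⟩ := Finset.exists_min_image (Finset.univ.filter fun j => g.repr x j ≠ 0)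
    (fun j => w₂ (φ j)) ⟨i, by simpa using hi⟩
  set b := w₂ (φ i₁) with hb
  have hba : b < a := (hmin₁ i (by simpa using hi)).trans_lt hlt
  let A : Finset ι := Finset.univ.filter fun j => w₂ (φ j) = b
  let y : V := ∑ j ∈ A, g.repr x j • g j
  have hyrepr : ∀ j, g.repr y j = if w₂ (φ j) = b then g.repr x j else 0 := by
    intro j
    have h1 : g.repr y j = ∑ l ∈ A, g.repr x l * (if l = j then 1 else 0) := by
      simp only [y, map_sum, map_smul, Finsupp.coe_finsetSum, Finset.sum_apply,
        Finsupp.smul_apply, g.repr_self, Finsupp.single_apply, smul_eq_mul]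
    rw [h1]
    simp [A]
  have hysub : y ∈ filLT f₂ w₂ b := by
    have : y = x - ∑ j ∈ Finset.univ.filter (fun j => ¬ w₂ (φ j) = b), g.repr x j • g j := by
      rw [eq_sub_iff_add_eq, Finset.sum_filter_add_sum_filter_not, g.sum_repr]
    rw [this]
    refine Submodule.sub_mem _ (fun k hk => hba.trans_le (hx k hk))
      (Submodule.sum_mem _ fun j hj => ?_)
    by_cases hj0 : g.repr x j = 0
    · simp [hj0]
    · refine Submodule.smul_mem _ _ fun k hk => lt_of_lt_of_le ?_ (hg2 j k hk)
      exact lt_of_le_of_ne (hmin₁ j (by simpa using hj0))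
        (fun h => (Finset.mem_filter.1 hj).2 h.symm)
  have hi₁' : g.repr x i₁ ≠ 0 := (Finset.mem_filter.1 hi₁).2
  have hy0 : y ≠ 0 := by
    intro h
    have := hyrepr i₁
    rw [h, if_pos hb.symm] at this
    exact hi₁' (by simpa using this.symm)
  obtain ⟨k₀, hk₀⟩ : ∃ k, f₂.repr y k ≠ 0 := by
    by_contra! h
    exact hy0 (f₂.repr.map_eq_zero_iff.1 (Finsupp.ext h))
  obtain ⟨k, hk, hkmin⟩ := Finset.exists_min_image
    (Finset.univ.filter fun j => f₂.repr y j ≠ 0) w₂ ⟨k₀, by simpa using hk₀⟩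
  obtain ⟨i₀, hi₀, hi₀min⟩ := Finset.exists_min_image
    (Finset.univ.filter fun j => g.repr y j ≠ 0) w₁ ⟨i₁, by simp [hyrepr, hi₁', hb.symm]⟩
  have hi₀' : g.repr y i₀ ≠ 0 := (Finset.mem_filter.1 hi₀).2
  have hib : w₂ (φ i₀) = b := by
    by_contra h
    exact hi₀' (by rw [hyrepr, if_neg h])
  obtain ⟨g', hg'1, hg'2⟩ := exists_exchange g w₁ (i₀ := i₀) (y := y)
    (fun j hj => hi₀min j (by simpa using hj)) hi₀'
  have hmem : Function.update φ i₀ k ∈ S := by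
    refine ⟨g', hg'2.trans hg1, fun j => ?_⟩
    rw [hg'1]
    by_cases h : j = i₀
    · subst h
      simp only [if_true, Function.update_self]
      exact fun l hl => hkmin l (by simpa using hl)
    · simpa [h] using hg2 j
  have hlt' : ∑ j, w₂ (φ j) < ∑ j, w₂ (Function.update φ i₀ k j) := by
    refine Finset.sum_lt_sum (fun j _ => ?_) ⟨i₀, Finset.mem_univ _, ?_⟩
    · by_cases h : j = i₀
      · subst h
        simp only [Function.update_self]
        exact hib.le.trans (hysub k (Finset.mem_filter.1 hk).2).le
      · simp [h]
    · simp only [Function.update_self]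
      exact hib.trans_lt (hysub k (Finset.mem_filter.1 hk).2)
  exact absurd (hmax _ hmem) (not_le.2 hlt')

theorem exists_perm_le {f g : Module.Basis ι K V} {w u : ι → ℝ}
    (h : ∀ i, f i ∈ fil g u (w i)) : ∃ σ : Equiv.Perm ι, ∀ i, w i ≤ u (σ i) := by
  classical
  have hdet : (g.toMatrix f).det ≠ 0 := by
    have := g.isUnit_det f
    rw [Module.Basis.det_apply] at this
    exact this.ne_zero
  rw [Matrix.det_apply] at hdet
  obtain ⟨σ, -, hσ⟩ := Finset.exists_ne_zero_of_sum_ne_zero hdet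
  refine ⟨σ, fun i => h i _ fun h0 => hσ ?_⟩
  have : ∏ i, g.toMatrix f (σ i) i = 0 :=
    Finset.prod_eq_zero (Finset.mem_univ i) (by rw [Module.Basis.toMatrix_apply, h0])
  rw [this, smul_zero]

theorem exists_perm_eq {f g : Module.Basis ι K V} {w u : ι → ℝ} (h : fil f w = fil g u) :
    ∃ σ : Equiv.Perm ι, ∀ i, w i = u (σ i) := by
  obtain ⟨σ, hσ⟩ := exists_perm_le (f := f) (g := g) (w := w) (u := u)
    (fun i => h ▸ basis_mem_fil f w le_rfl)
  obtain ⟨τ, hτ⟩ := exists_perm_le (f := g) (g := f) (w := u) (u := w)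
    (fun i => h ▸ basis_mem_fil g u le_rfl)
  have h1 : ∑ i, u (σ i) ≤ ∑ i, w i := by
    rw [Equiv.sum_comp σ u, ← Equiv.sum_comp τ w]
    exact Finset.sum_le_sum fun i _ => hτ i
  refine ⟨σ, fun i => ?_⟩
  have h2 : ∑ i, w i = ∑ i, u (σ i) := le_antisymm (Finset.sum_le_sum fun i _ => hσ i) h1
  exact (Finset.sum_eq_sum_iff_of_le fun i _ => hσ i).1 h2 i (Finset.mem_univ i)

/-- The compatible pair `(f, w)` is at minimal distance from the constant weight `1`. -/
structure IsMinCompat (lam : V →ₗ[K] V →ₗ[K] V) (f : Module.Basis ι K V) (w : ι → ℝ) : Prop where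
  compat : Compat lam f w
  le : ∀ (g : Module.Basis ι K V) (u : ι → ℝ), Compat lam g u →
    ∑ i, (w i - 1) ^ 2 ≤ ∑ i, (u i - 1) ^ 2

theorem exists_isMinCompat (lam : V →ₗ[K] V →ₗ[K] V) (f₀ : Module.Basis ι K V) :
    ∃ (f : Module.Basis ι K V) (w : ι → ℝ), IsMinCompat lam f w := by
  classical
  let C : Set (ι × ι × ι) → Set (EuclideanSpace ℝ ι) := fun T =>
    {w | ∀ t ∈ T, w t.1 + w t.2.1 ≤ w t.2.2}
  let supp : Module.Basis ι K V → Set (ι × ι × ι) := fun f =>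
    {t | f.repr (lam (f t.1) (f t.2.1)) t.2.2 ≠ 0}
  let W : Set (EuclideanSpace ℝ ι) := ⋃ T ∈ Set.range supp, C T
  have hC : ∀ T, IsClosed (C T) := by
    intro T
    simp only [C, Set.ofPred_forall]
    refine isClosed_iInter fun t => isClosed_iInter fun _ => ?_
    exact isClosed_le (by fun_prop) (by fun_prop)
  have hW : IsClosed W := (Set.toFinite (Set.range supp)).isClosed_biUnion fun T _ => hC T
  have hne : W.Nonempty := ⟨0, by
    simp only [W, Set.mem_iUnion]
    exact ⟨supp f₀, ⟨f₀, rfl⟩, fun t _ => by simp⟩⟩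
  obtain ⟨w, hwW, hw⟩ := hW.exists_infDist_eq_dist hne (WithLp.toLp 2 fun _ => (1 : ℝ))
  simp only [W, Set.mem_iUnion] at hwW
  obtain ⟨T, ⟨f, rfl⟩, hT⟩ := hwW
  refine ⟨f, w, fun i j k h => hT (i, j, k) h, fun g u hu => ?_⟩
  have hmem : WithLp.toLp 2 u ∈ W := by
    simp only [W, Set.mem_iUnion]
    exact ⟨supp g, ⟨g, rfl⟩, fun t ht => hu _ _ _ ht⟩
  have h1 := Metric.infDist_le_dist_of_mem (x := WithLp.toLp 2 fun _ => (1 : ℝ)) hmem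
  rw [hw, EuclideanSpace.dist_eq, EuclideanSpace.dist_eq] at h1
  have h2 := (Real.sqrt_le_sqrt_iff (by positivity)).1 h1
  simpa [Real.dist_eq, sq_abs, sub_sq_comm] using h2

/-- First variation: moving a minimal weight in a compatible direction does not decrease the
distance to `1`. -/
theorem IsMinCompat.variation {lam : V →ₗ[K] V →ₗ[K] V} {f g : Module.Basis ι K V} {w v : ι → ℝ}
    (h : IsMinCompat lam f w) {ε₀ : ℝ} (hε : 0 < ε₀)
    (hc : ∀ ε, 0 ≤ ε → ε ≤ ε₀ → Compat lam g (fun i => w i + ε * v i)) :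
    0 ≤ ∑ i, (w i - 1) * v i := by
  by_contra! hneg
  set A := ∑ i, (w i - 1) * v i with hA
  set Q := ∑ i, v i ^ 2 with hQ
  have hQ0 : 0 ≤ Q := Finset.sum_nonneg fun i _ => sq_nonneg _
  let ε := min ε₀ (-A / (Q + 1))
  have he0 : 0 < ε := lt_min hε (div_pos (by linarith) (by linarith))
  have h1 := h.le g _ (hc ε he0.le (min_le_left _ _))
  have h2 : ∑ i, (w i + ε * v i - 1) ^ 2 = ∑ i, (w i - 1) ^ 2 + 2 * ε * A + ε ^ 2 * Q := by
    rw [hA, hQ, Finset.mul_sum, Finset.mul_sum, ← Finset.sum_add_distrib, ← Finset.sum_add_distrib]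
    exact Finset.sum_congr rfl fun i _ => by ring
  rw [h2] at h1
  have h3 : ε * (Q + 1) ≤ -A := (le_div_iff₀ (by linarith)).1 (min_le_right _ _)
  nlinarith

theorem IsMinCompat.sum_sq {lam : V →ₗ[K] V →ₗ[K] V} {f : Module.Basis ι K V} {w : ι → ℝ}
    (h : IsMinCompat lam f w) : ∑ i, w i ^ 2 = ∑ i, w i := by
  have h1 := h.variation (g := f) (v := w) one_pos fun ε h0 _ i j k hk => by
    nlinarith [h.compat i j k hk]
  have h2 := h.variation (g := f) (v := fun i => - w i) one_pos fun ε h0 h1 i j k hk => by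
    nlinarith [h.compat i j k hk]
  have e1 : ∑ i, (w i - 1) * w i = ∑ i, w i ^ 2 - ∑ i, w i := by
    rw [← Finset.sum_sub_distrib]
    exact Finset.sum_congr rfl fun i _ => by ring
  have e2 : ∑ i, (w i - 1) * - w i = -(∑ i, w i ^ 2 - ∑ i, w i) := by
    rw [← e1, ← Finset.sum_neg_distrib]
    exact Finset.sum_congr rfl fun i _ => by ring
  linarith

theorem IsMinCompat.fil_eq {lam : V →ₗ[K] V →ₗ[K] V} {f g : Module.Basis ι K V} {w u : ι → ℝ}
    (hf : IsMinCompat lam f w) (hg : IsMinCompat lam g u) : fil g u = fil f w := by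
  rcases isEmpty_or_nonempty ι with he | he
  · funext a
    refine le_antisymm (fun x _ i => he.elim i) (fun x _ i => he.elim i)
  obtain ⟨e, v, h1, h2⟩ := exists_joint_basis f g w u
  obtain ⟨σ, hσ⟩ := exists_perm_eq h2
  have hv : ∑ i, (v i - 1) ^ 2 = ∑ i, (u i - 1) ^ 2 := by
    rw [← Equiv.sum_comp σ fun i => (u i - 1) ^ 2]
    exact Finset.sum_congr rfl fun i _ => by rw [hσ i]
  have hc1 := hf.compat.of_fil_eq h1
  have hc2 := hg.compat.of_fil_eq h2
  have hm := hf.le e (fun i => (w i + v i) / 2) fun i j k hk => by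
    have := hc1 i j k hk
    have := hc2 i j k hk
    linarith
  have huw := hg.le f w hf.compat
  have hsum : ∑ i, (w i - v i) ^ 2 ≤ 0 := by
    have : ∑ i, (w i - v i) ^ 2 = 2 * ∑ i, (w i - 1) ^ 2 + 2 * ∑ i, (v i - 1) ^ 2
        - 4 * ∑ i, ((w i + v i) / 2 - 1) ^ 2 := by
      simp only [Finset.mul_sum, ← Finset.sum_add_distrib, ← Finset.sum_sub_distrib]
      exact Finset.sum_congr rfl fun i _ => by ring
    rw [this, hv]
    linarith
  have hwv : w = v := by
    funext i
    have := (Finset.sum_eq_zero_iff_of_nonneg fun i _ => sq_nonneg (w i - v i)).1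
      (le_antisymm hsum (Finset.sum_nonneg fun i _ => sq_nonneg _)) i (Finset.mem_univ i)
    nlinarith
  rw [← h2, ← hwv, h1]

theorem IsMinCompat.map_mem {lam : V →ₗ[K] V →ₗ[K] V} {f : Module.Basis ι K V} {w : ι → ℝ}
    (h : IsMinCompat lam f w) (g : V ≃ₗ[K] V) (hg : ∀ x y, g (lam x y) = lam (g x) (g y))
    {a : ℝ} {x : V} (hx : x ∈ fil f w a) : g x ∈ fil f w a := by
  have h1 : Compat lam (f.map g) w := by
    intro i j k hk
    refine h.compat i j k ?_
    simpa [← hg] using hk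
  have h2 := h.fil_eq ⟨h1, h.le⟩
  rw [← h2]
  intro i hi
  exact hx i (by simpa using hi)

end Filtration

/-! ### Minimal filtrations over the complex numbers -/

section FilRank

variable {K V ι : Type*} [Field K] [AddCommGroup V] [Module K V] [Fintype ι]

theorem finrank_fil (f : Module.Basis ι K V) (w : ι → ℝ) (a : ℝ) :
    Module.finrank K (fil f w a) = Nat.card {i // a ≤ w i} := by
  classical
  have h : fil f w a = Submodule.span K
      (Set.range (f ∘ (Subtype.val : {i // a ≤ w i} → ι))) := by
    refine le_antisymm (fil_le_of_basis fun i hi => Submodule.subset_span ⟨⟨i, hi⟩, rfl⟩)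
      (Submodule.span_le.2 ?_)
    rintro _ ⟨i, rfl⟩
    exact basis_mem_fil f w i.2
  rw [h, finrank_span_eq_card (f.linearIndependent.comp _ Subtype.val_injective),
    Nat.card_eq_fintype_card]

theorem fil_eq_of_basis_mem {f g : Module.Basis ι K V} {w : ι → ℝ}
    (h : ∀ i, g i ∈ fil f w (w i)) : fil g w = fil f w := by
  have := f.finiteDimensional_of_finite
  funext a
  exact Submodule.eq_of_le_of_finrank_eq (fil_le_fil h a) (by rw [finrank_fil, finrank_fil])

theorem sum_weight_eq_zero {w : ι → ℝ} {y : ι → K} (φ : ℝ → K)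
    (h : ∀ a, ∑ i with a ≤ w i, y i = 0) : ∑ i, φ (w i) * y i = 0 := by
  classical
  have h1 : ∀ a, ∑ i with a < w i, y i = 0 := by
    intro a
    by_cases hne : (Finset.univ.filter fun i => a < w i).Nonempty
    · obtain ⟨k, hk, hmin⟩ := Finset.exists_min_image _ w hne
      rw [← h (w k)]
      refine Finset.sum_congr (Finset.ext fun i => ?_) fun _ _ => rfl
      simp only [Finset.mem_filter, Finset.mem_univ, true_and]
      exact ⟨fun hi => hmin i (by simpa using hi),
        fun hi => lt_of_lt_of_le (by simpa using hk) hi⟩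
    · rw [Finset.not_nonempty_iff_eq_empty.1 hne, Finset.sum_empty]
  have h2 : ∀ a, ∑ i with w i = a, y i = 0 := by
    intro a
    have hs := Finset.sum_filter_add_sum_filter_not (Finset.univ.filter fun i => a ≤ w i)
      (fun i => w i = a) y
    rw [h a, Finset.filter_filter, Finset.filter_filter] at hs
    have e1 : (Finset.univ.filter fun i => a ≤ w i ∧ w i = a) =
        Finset.univ.filter fun i => w i = a := by
      ext i; simp only [Finset.mem_filter, Finset.mem_univ, true_and]
      exact ⟨fun hi => hi.2, fun hi => ⟨hi.ge, hi⟩⟩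
    have e2 : (Finset.univ.filter fun i => a ≤ w i ∧ ¬ w i = a) =
        Finset.univ.filter fun i => a < w i := by
      ext i; simp only [Finset.mem_filter, Finset.mem_univ, true_and]
      exact ⟨fun hi => lt_of_le_of_ne hi.1 (Ne.symm hi.2), fun hi => ⟨hi.le, hi.ne'⟩⟩
    rw [e1, e2, h1 a, add_zero] at hs
    exact hs
  rw [← Finset.sum_fiberwise_of_maps_to (g := w) (t := Finset.univ.image w)
    (fun i _ => Finset.mem_image_of_mem _ (Finset.mem_univ i))]
  refine Finset.sum_eq_zero fun a _ => ?_
  have : ∀ i ∈ Finset.univ.filter (fun i => w i = a), φ (w i) * y i = φ a * y i := by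
    intro i hi
    rw [(Finset.mem_filter.1 hi).2]
  rw [Finset.sum_congr rfl this, ← Finset.mul_sum, h2, mul_zero]

/-- The coordinate projection onto `fil f w a`. -/
def filProj (f : Module.Basis ι K V) (w : ι → ℝ) (a : ℝ) : V →ₗ[K] V :=
  ∑ i with a ≤ w i, (f.coord i).smulRight (f i)

theorem filProj_basis (f : Module.Basis ι K V) (w : ι → ℝ) (a : ℝ) (i : ι) :
    filProj f w a (f i) = if a ≤ w i then f i else 0 := by
  classical
  have h : ∀ j, (f.coord j).smulRight (f j) (f i) = if i = j then f i else 0 := by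
    intro j
    rw [LinearMap.smulRight_apply, Module.Basis.coord_apply, f.repr_self, Finsupp.single_apply]
    split_ifs with hij
    · rw [one_smul, hij]
    · rw [zero_smul]
  rw [filProj, LinearMap.sum_apply]
  simp only [h, Finset.sum_ite_eq, Finset.mem_filter, Finset.mem_univ, true_and]

theorem filProj_mem (f : Module.Basis ι K V) (w : ι → ℝ) (a : ℝ) (x : V) :
    filProj f w a x ∈ fil f w a := by
  simp only [filProj, LinearMap.sum_apply, LinearMap.smulRight_apply]
  exact Submodule.sum_mem _ fun i hi => Submodule.smul_mem _ _
    (basis_mem_fil f w (Finset.mem_filter.1 hi).2)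

theorem filProj_of_mem {f : Module.Basis ι K V} {w : ι → ℝ} {a : ℝ} {x : V}
    (hx : x ∈ fil f w a) : filProj f w a x = x := by
  have : fil f w a ≤ LinearMap.eqLocus (filProj f w a) LinearMap.id :=
    fil_le_of_basis fun i hi => by
      simp [LinearMap.mem_eqLocus, filProj_basis, hi]
  exact this hx

theorem trace_comp_filProj (f : Module.Basis ι K V) (w : ι → ℝ) (a : ℝ) (T : V →ₗ[K] V) :
    LinearMap.trace K V (T ∘ₗ filProj f w a) = ∑ i with a ≤ w i, f.repr (T (f i)) i := by
  classical
  rw [LinearMap.trace_eq_matrix_trace K f, Matrix.trace, Finset.sum_filter]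
  refine Finset.sum_congr rfl fun i _ => ?_
  rw [Matrix.diag_apply, LinearMap.toMatrix_apply, LinearMap.comp_apply, filProj_basis]
  split_ifs <;> simp

theorem trace_comp_filProj_eq {f g : Module.Basis ι K V} {w : ι → ℝ} (h : fil g w = fil f w)
    {a : ℝ} {T : V →ₗ[K] V} (hT : ∀ x ∈ fil f w a, T x ∈ fil f w a) :
    LinearMap.trace K V (T ∘ₗ filProj g w a) = LinearMap.trace K V (T ∘ₗ filProj f w a) := by
  have := f.finiteDimensional_of_finite
  have hg : ∀ x, filProj g w a x ∈ fil f w a := fun x => h ▸ filProj_mem g w a x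
  have h1 : T ∘ₗ filProj g w a = filProj f w a ∘ₗ (T ∘ₗ filProj g w a) := by
    ext x
    exact (filProj_of_mem (hT _ (hg x))).symm
  have h2 : filProj g w a ∘ₗ filProj f w a = filProj f w a := by
    ext x
    have : filProj f w a x ∈ fil g w a := h ▸ filProj_mem f w a x
    exact filProj_of_mem this
  rw [h1, LinearMap.trace_comp_comm', LinearMap.comp_assoc, h2]

end FilRank

section Exp

variable {V : Type*} [NormedAddCommGroup V] [NormedSpace ℂ V] [FiniteDimensional ℂ V]

theorem exp_derivation_hom {lam : V →ₗ[ℂ] V →ₗ[ℂ] V} {δ : V →ₗ[ℂ] V}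
    (hδ : ∀ x y, δ (lam x y) = lam (δ x) y + lam x (δ y)) (s : ℂ) (x y : V) :
    NormedSpace.exp (s • δ.toContinuousLinearMap) (lam x y) =
      lam (NormedSpace.exp (s • δ.toContinuousLinearMap) x)
        (NormedSpace.exp (s • δ.toContinuousLinearMap) y) := by
  have := FiniteDimensional.complete ℂ V
  let +nondep : NormedAlgebra ℚ (V →L[ℂ] V) := .restrictScalars ℚ ℂ _
  set T := δ.toContinuousLinearMap with hT
  let Λ : V →L[ℂ] V →L[ℂ] V :=
    LinearMap.toContinuousLinearMap
      ((LinearMap.toContinuousLinearMap : (V →ₗ[ℂ] V) ≃ₗ[ℂ] (V →L[ℂ] V)).toLinearMap ∘ₗ lam)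
  have hΛ : ∀ x y, Λ x y = lam x y := fun x y => rfl
  have hexp : ∀ (v : V) (t : ℂ), HasDerivAt (fun u : ℂ => NormedSpace.exp (u • T) v)
      (T (NormedSpace.exp (t • T) v)) t := by
    intro v t
    have := (hasDerivAt_exp_smul_const' T t).clm_apply (hasDerivAt_const t v)
    simpa using this
  have hneg : ∀ t : ℂ, HasDerivAt (fun u : ℂ => NormedSpace.exp (u • (-T)))
      (NormedSpace.exp (t • (-T)) * (-T)) t := fun t => hasDerivAt_exp_smul_const (-T) t
  let g : ℂ → V := fun t =>
    NormedSpace.exp (t • (-T)) (Λ (NormedSpace.exp (t • T) x) (NormedSpace.exp (t • T) y))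
  have hg : ∀ t, HasDerivAt g 0 t := by
    intro t
    have h1 : HasDerivAt (fun t => Λ (NormedSpace.exp (t • T) x) (NormedSpace.exp (t • T) y))
        (Λ (T (NormedSpace.exp (t • T) x)) (NormedSpace.exp (t • T) y) +
          Λ (NormedSpace.exp (t • T) x) (T (NormedSpace.exp (t • T) y))) t :=
      (Λ.hasFDerivAt.comp_hasDerivAt t (hexp x t)).clm_apply (hexp y t)
    have h2 := (hneg t).clm_apply h1
    convert h2 using 1
    simp only [mul_apply_eq_comp, _root_.neg_apply, hΛ, map_neg]
    have h3 : T (lam (NormedSpace.exp (t • T) x) (NormedSpace.exp (t • T) y)) =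
        lam (T (NormedSpace.exp (t • T) x)) (NormedSpace.exp (t • T) y) +
        lam (NormedSpace.exp (t • T) x) (T (NormedSpace.exp (t • T) y)) := hδ _ _
    rw [h3, neg_add_cancel]
  have hconst := is_const_of_deriv_eq_zero (fun t => (hg t).differentiableAt)
    (fun t => (hg t).deriv) s 0
  have hinv : NormedSpace.exp (s • T) * NormedSpace.exp (s • (-T)) = 1 := by
    rw [← NormedSpace.exp_add_of_commute, smul_neg, add_neg_cancel, NormedSpace.exp_zero]
    rw [smul_neg]
    exact (Commute.refl _).neg_right
  have h0 : g 0 = lam x y := by simp [g, hΛ]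
  rw [h0] at hconst
  have h4 : NormedSpace.exp (s • T) (g s) = lam (NormedSpace.exp (s • T) x)
      (NormedSpace.exp (s • T) y) := by
    change (NormedSpace.exp (s • T) * NormedSpace.exp (s • (-T))) _ = _
    rw [hinv]
    rfl
  rw [← h4, hconst]

theorem derivation_mem_of_exp_mem {T : V →L[ℂ] V} {U : Submodule ℂ V} {x : V}
    (h : ∀ s : ℂ, NormedSpace.exp (s • T) x ∈ U) : T x ∈ U := by
  have := FiniteDimensional.complete ℂ V
  have h0 : HasDerivAt (fun u : ℂ => NormedSpace.exp (u • T) x) (T x) 0 := by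
    have := (hasDerivAt_exp_smul_const' T (0 : ℂ)).clm_apply (hasDerivAt_const (0 : ℂ) x)
    simpa using this
  have h1 := hasDerivAt_iff_tendsto_slope.1 h0
  refine (Submodule.closed_of_finiteDimensional U).mem_of_tendsto h1
    (Filter.Eventually.of_forall fun s => ?_)
  rw [slope_def_module]
  exact U.smul_mem _ (U.sub_mem (h s) (h 0))

variable {ι : Type*} [Fintype ι]

theorem IsMinCompat.derivation_mem {lam : V →ₗ[ℂ] V →ₗ[ℂ] V} {f : Module.Basis ι ℂ V}
    {w : ι → ℝ} (h : IsMinCompat lam f w) {δ : V →ₗ[ℂ] V}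
    (hδ : ∀ x y, δ (lam x y) = lam (δ x) y + lam x (δ y)) {a : ℝ} {x : V}
    (hx : x ∈ fil f w a) : δ x ∈ fil f w a := by
  have := FiniteDimensional.complete ℂ V
  let +nondep : NormedAlgebra ℚ (V →L[ℂ] V) := .restrictScalars ℚ ℂ _
  refine derivation_mem_of_exp_mem (T := δ.toContinuousLinearMap) fun s => ?_
  set T := δ.toContinuousLinearMap
  have h1 : NormedSpace.exp (s • T) * NormedSpace.exp ((-s) • T) = 1 := by
    rw [← NormedSpace.exp_add_of_commute, neg_smul, add_neg_cancel, NormedSpace.exp_zero]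
    rw [neg_smul]
    exact (Commute.refl _).neg_right
  have h2 : NormedSpace.exp ((-s) • T) * NormedSpace.exp (s • T) = 1 := by
    rw [← NormedSpace.exp_add_of_commute, neg_smul, neg_add_cancel, NormedSpace.exp_zero]
    rw [neg_smul]
    exact (Commute.refl _).neg_left
  let e : V ≃ₗ[ℂ] V := LinearEquiv.ofLinearMap (NormedSpace.exp (s • T) : V →L[ℂ] V).toLinearMap
    (NormedSpace.exp ((-s) • T) : V →L[ℂ] V).toLinearMap
    (LinearMap.ext fun v => DFunLike.congr_fun h1 v)
    (LinearMap.ext fun v => DFunLike.congr_fun h2 v)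
  exact h.map_mem e (fun x y => exp_derivation_hom hδ s x y) hx

theorem IsMinCompat.weight_nonneg {lam : V →ₗ[ℂ] V →ₗ[ℂ] V} {f : Module.Basis ι ℂ V}
    {w : ι → ℝ} (h : IsMinCompat lam f w) (halt : ∀ x y, lam x y = - lam y x)
    (hjac : ∀ x y z, lam x (lam y z) = lam (lam x y) z + lam y (lam x z)) (i : ι) :
    0 ≤ w i := by
  by_contra! hi
  have had : ∀ x a y, y ∈ fil f w a → lam x y ∈ fil f w a := fun x a y hy =>
    h.derivation_mem (hjac x) hy
  have hc : Compat lam f (fun j => max (w j) 0) := by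
    intro p q k hk
    have h1 := h.compat p q k hk
    have h2 := had (f p) _ _ (basis_mem_fil f w (le_refl (w q))) k hk
    have h3 : w p ≤ w k := by
      refine had (f q) _ _ (basis_mem_fil f w (le_refl (w p))) k ?_
      rw [halt, map_neg, Finsupp.neg_apply]
      exact neg_ne_zero.2 hk
    change max (w p) 0 + max (w q) 0 ≤ max (w k) 0
    rcases max_cases (w p) 0 with ⟨e1, e2⟩ | ⟨e1, e2⟩ <;>
    rcases max_cases (w q) 0 with ⟨e3, e4⟩ | ⟨e3, e4⟩ <;>
    rcases max_cases (w k) 0 with ⟨e5, e6⟩ | ⟨e5, e6⟩ <;> rw [e1, e3, e5] <;> linarith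
  have h1 := h.le f _ hc
  refine absurd h1 (not_le.2 (Finset.sum_lt_sum (fun j _ => ?_) ⟨i, Finset.mem_univ _, ?_⟩))
  · rcases max_cases (w j) 0 with ⟨e1, e2⟩ | ⟨e1, e2⟩ <;> rw [e1]
    nlinarith
  · rw [max_eq_right hi.le]
    nlinarith

theorem IsMinCompat.killing_eq_zero {lam : V →ₗ[ℂ] V →ₗ[ℂ] V} {f : Module.Basis ι ℂ V}
    {w : ι → ℝ} (h : IsMinCompat lam f w)
    (hjac : ∀ x y z, lam x (lam y z) = lam (lam x y) z + lam y (lam x z)) {a : ℝ} (ha : 0 < a)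
    {x : V} (hx : x ∈ fil f w a) (y : V) : LinearMap.trace ℂ V (lam x ∘ₗ lam y) = 0 := by
  classical
  rw [LinearMap.trace_eq_matrix_trace ℂ f, Matrix.trace]
  refine Finset.sum_eq_zero fun i _ => ?_
  rw [Matrix.diag_apply, LinearMap.toMatrix_apply, LinearMap.comp_apply]
  by_contra hne
  have h1 := h.derivation_mem (hjac y) (basis_mem_fil f w (le_refl (w i)))
  have := (compat_iff.1 h.compat) _ _ _ hx _ h1 i hne
  linarith

end Exp

section Eigen

variable {V ι : Type*} [AddCommGroup V] [Module ℂ V] [FiniteDimensional ℂ V] [Fintype ι]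

theorem exists_eigen_basis (f : Module.Basis ι ℂ V) (w : ι → ℝ) (δ : V →ₗ[ℂ] V)
    (hδ : ∀ a, ∀ x ∈ fil f w a, δ x ∈ fil f w a) :
    ∃ (g : Module.Basis ι ℂ V) (z : ι → ℂ), fil g w = fil f w ∧
      ∀ i, g i ∈ Module.End.maxGenEigenspace δ (z i) := by
  classical
  let S : Set (Set ι) := {A | ∃ g : Module.Basis ι ℂ V, fil g w = fil f w ∧
    ∀ i ∈ A, ∃ z, g i ∈ Module.End.maxGenEigenspace δ z}
  obtain ⟨A, hA⟩ := (Set.toFinite S).exists_maximal ⟨∅, f, rfl, by simp⟩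
  obtain ⟨g, hg1, hg2⟩ := hA.prop
  suffices hall : ∀ i, i ∈ A by
    choose z hz using fun i => hg2 i (hall i)
    exact ⟨g, z, hg1, hz⟩
  intro i
  by_contra hi
  have hinv : ∀ x ∈ fil g w (w i), δ x ∈ fil g w (w i) := by
    rw [hg1]; exact hδ _
  have hdec := Submodule.eq_iSup_inf_genEigenspace (p := fil g w (w i)) (f := δ) ⊤ hinv
    (Module.End.iSup_maxGenEigenspace_eq_top δ)
  obtain ⟨z, y, hy, hy0⟩ : ∃ z, ∃ y ∈ fil g w (w i) ⊓ Module.End.genEigenspace δ z ⊤,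
      g.repr y i ≠ 0 := by
    by_contra! hcon
    have hle : fil g w (w i) ≤ LinearMap.ker (g.coord i) := by
      rw [hdec]
      exact iSup_le fun z y hy => by simpa using hcon z y hy
    have := hle (basis_mem_fil g w (le_refl (w i)))
    simp at this
  obtain ⟨g', hg'1, hg'2⟩ := exists_exchange g w hy.1 hy0
  have hmem : insert i A ∈ S := by
    refine ⟨g', hg'2.trans hg1, fun j hj => ?_⟩
    rw [hg'1]
    split_ifs with hji
    · exact ⟨z, hy.2⟩
    · exact hg2 j (hj.resolve_left hji)
  exact hi (hA.le_of_ge hmem (Set.subset_insert i A) (Set.mem_insert i A))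

omit [FiniteDimensional ℂ V] in
theorem eigen_basis_repr {g : Module.Basis ι ℂ V} {z : ι → ℂ} {δ : V →ₗ[ℂ] V}
    (hg : ∀ i, g i ∈ Module.End.maxGenEigenspace δ (z i)) {x : V} {a : ℂ}
    (hx : x ∈ Module.End.maxGenEigenspace δ a) {k : ι} (hk : g.repr x k ≠ 0) : z k = a := by
  classical
  by_contra hne
  let y := ∑ j with z j ≠ a, g.repr x j • g j
  have hy1 : y ∈ ⨆ b, ⨆ (_ : b ≠ a), Module.End.maxGenEigenspace δ b :=
    Submodule.sum_mem _ fun j hj => Submodule.smul_mem _ _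
      (Submodule.mem_iSup_of_mem (z j) (Submodule.mem_iSup_of_mem (Finset.mem_filter.1 hj).2
        (hg j)))
  have hy2 : y ∈ Module.End.maxGenEigenspace δ a := by
    have : y = x - ∑ j with z j = a, g.repr x j • g j := by
      rw [eq_sub_iff_add_eq, add_comm, Finset.sum_filter_add_sum_filter_not, g.sum_repr]
    rw [this]
    refine Submodule.sub_mem _ hx (Submodule.sum_mem _ fun j hj => Submodule.smul_mem _ _ ?_)
    have := hg j
    rwa [(Finset.mem_filter.1 hj).2] at this
  have hy0 : y = 0 := by
    have := (Module.End.independent_maxGenEigenspace δ a).le_bot ⟨hy2, hy1⟩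
    simpa using this
  have h1 : g.repr y k = ∑ j with z j ≠ a, g.repr x j * (if j = k then 1 else 0) := by
    simp only [y, map_sum, map_smul, Finsupp.coe_finsetSum, Finset.sum_apply,
      Finsupp.smul_apply, g.repr_self, Finsupp.single_apply, smul_eq_mul]
  rw [hy0] at h1
  apply hk
  simpa [hne] using h1.symm

omit [FiniteDimensional ℂ V] in
theorem derivation_genEigen {lam : V →ₗ[ℂ] V →ₗ[ℂ] V} {δ : V →ₗ[ℂ] V}
    (hδ : ∀ x y, δ (lam x y) = lam (δ x) y + lam x (δ y)) {a b : ℂ} {x y : V}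
    (hx : x ∈ Module.End.maxGenEigenspace δ a) (hy : y ∈ Module.End.maxGenEigenspace δ b) :
    lam x y ∈ Module.End.maxGenEigenspace δ (a + b) := by
  rw [Module.End.mem_maxGenEigenspace] at hx hy ⊢
  obtain ⟨k, hk⟩ := hx
  obtain ⟨l, hl⟩ := hy
  have key : ∀ n k l : ℕ, k + l = n → ∀ x y,
      ((δ - a • (1 : Module.End ℂ V)) ^ k) x = 0 → ((δ - b • (1 : Module.End ℂ V)) ^ l) y = 0 →
      ((δ - (a + b) • (1 : Module.End ℂ V)) ^ n) (lam x y) = 0 := by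
    intro n
    induction n with
    | zero =>
      intro k l hkl x y hx hy
      obtain ⟨rfl, rfl⟩ : k = 0 ∧ l = 0 := by omega
      have : x = 0 := by simpa using hx
      simp [this]
    | succ n ih =>
      intro k l hkl x y hx hy
      rcases k with _ | k
      · have : x = 0 := by simpa using hx
        simp [this]
      rcases l with _ | l
      · have : y = 0 := by simpa using hy
        simp [this]
      have h1 : (δ - (a + b) • (1 : Module.End ℂ V)) (lam x y) =
          lam ((δ - a • (1 : Module.End ℂ V)) x) y +
          lam x ((δ - b • (1 : Module.End ℂ V)) y) := by
        simp only [LinearMap.sub_apply, LinearMap.smul_apply, Module.End.one_apply, hδ, map_sub,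
          map_smul]
        module
      rw [pow_succ, Module.End.mul_apply, h1, map_add]
      rw [ih k (l + 1) (by omega) _ _ (by rwa [pow_succ, Module.End.mul_apply] at hx) hy,
        ih (k + 1) l (by omega) _ _ hx (by rwa [pow_succ, Module.End.mul_apply] at hy), add_zero]
  exact ⟨k + l, key _ k l rfl x y hk hl⟩

omit [FiniteDimensional ℂ V] in
theorem eigen_trace {g : Module.Basis ι ℂ V} {z : ι → ℂ} {w : ι → ℝ} {δ : V →ₗ[ℂ] V}
    (hg : ∀ i, g i ∈ Module.End.maxGenEigenspace δ (z i)) {a : ℝ}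
    (hδ : ∀ x ∈ fil g w a, δ x ∈ fil g w a) :
    ∑ i with a ≤ w i, (g.repr (δ (g i)) i - z i) = 0 := by
  classical
  let T : V →ₗ[ℂ] V := ∑ i, (g.coord i).smulRight (z i • g i)
  have hTg : ∀ i, T (g i) = z i • g i := by
    intro i
    simp [T, Finsupp.single_apply, ite_smul]
  have hT : ∀ b, ∀ x ∈ Module.End.maxGenEigenspace δ b, T x = b • x := by
    intro b x hx
    nth_rewrite 1 [← g.sum_repr x]
    nth_rewrite 2 [← g.sum_repr x]
    rw [map_sum, Finset.smul_sum]
    refine Finset.sum_congr rfl fun k _ => ?_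
    by_cases hk : g.repr x k = 0
    · simp [hk]
    · rw [map_smul, hTg, eigen_basis_repr hg hx hk, smul_comm]
  set N := δ - T with hN
  have hNx : ∀ b, ∀ n : ℕ, ∀ x ∈ Module.End.maxGenEigenspace δ b,
      (N ^ n) x = ((δ - b • (1 : Module.End ℂ V)) ^ n) x := by
    intro b n
    induction n with
    | zero => intro x _; simp
    | succ n ih =>
      intro x hx
      rw [pow_succ, pow_succ, Module.End.mul_apply, Module.End.mul_apply]
      have h1 : N x = (δ - b • (1 : Module.End ℂ V)) x := by
        simp [hN, hT b x hx]
      rw [h1, ih]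
      simp only [LinearMap.sub_apply, LinearMap.smul_apply, Module.End.one_apply]
      refine Submodule.sub_mem _ ?_ (Submodule.smul_mem _ _ hx)
      exact Module.End.mapsTo_maxGenEigenspace_of_comm (Commute.refl δ) b hx
  have hnil : IsNilpotent N := by
    choose n hn using fun i => (Module.End.mem_maxGenEigenspace δ (z i) (g i)).1 (hg i)
    refine ⟨∑ i, n i, g.ext fun i => ?_⟩
    have hle : n i ≤ ∑ i, n i := Finset.single_le_sum (f := n) (fun _ _ => Nat.zero_le _)
      (Finset.mem_univ i)
    rw [hNx (z i) _ _ (hg i)]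
    obtain ⟨m, hm⟩ := Nat.exists_eq_add_of_le' hle
    rw [hm, pow_add, Module.End.mul_apply, hn, map_zero, LinearMap.zero_apply]
  have hTinv : ∀ x ∈ fil g w a, T x ∈ fil g w a := fun x hx => by
    have : fil g w a ≤ (fil g w a).comap T := fil_le_of_basis fun i hi => by
      rw [Submodule.mem_comap, hTg]
      exact Submodule.smul_mem _ _ (basis_mem_fil g w hi)
    exact this hx
  have hNinv : ∀ x ∈ fil g w a, N x ∈ fil g w a := fun x hx =>
    Submodule.sub_mem _ (hδ x hx) (hTinv x hx)
  have hpow : ∀ n : ℕ, ((N * filProj g w a) ^ (n + 1)) = N ^ (n + 1) * filProj g w a := by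
    intro n
    induction n with
    | zero => simp
    | succ n ih =>
      rw [pow_succ, ih, pow_succ N (n + 1)]
      ext x
      simp only [Module.End.mul_apply]
      rw [filProj_of_mem (hNinv _ (filProj_mem g w a x))]
  have htr : LinearMap.trace ℂ V (N ∘ₗ filProj g w a) = 0 := by
    refine (LinearMap.isNilpotent_trace_of_isNilpotent ?_).eq_zero
    obtain ⟨n, hn⟩ := hnil
    refine ⟨n + 1, ?_⟩
    change (N * filProj g w a) ^ (n + 1) = 0
    rw [hpow, pow_succ, hn, zero_mul, zero_mul]
  rw [trace_comp_filProj] at htr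
  rw [← htr]
  refine Finset.sum_congr rfl fun i _ => ?_
  simp [hN, hTg]

end Eigen

section Main

variable {V : Type*} [NormedAddCommGroup V] [NormedSpace ℂ V] [FiniteDimensional ℂ V]
  {ι : Type*} [Fintype ι]

/-- For a minimal filtration, the weighted trace of a derivation equals its trace. -/
theorem IsMinCompat.trace_derivation {lam : V →ₗ[ℂ] V →ₗ[ℂ] V} {f : Module.Basis ι ℂ V}
    {w : ι → ℝ} (h : IsMinCompat lam f w) {δ : V →ₗ[ℂ] V}
    (hδ : ∀ x y, δ (lam x y) = lam (δ x) y + lam x (δ y)) :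
    ∑ i, (w i - 1) * (f.repr (δ (f i)) i).re = 0 := by
  have hinv : ∀ a, ∀ x ∈ fil f w a, δ x ∈ fil f w a := fun a x hx => h.derivation_mem hδ hx
  obtain ⟨g, z, hg1, hg2⟩ := exists_eigen_basis f w δ hinv
  have hc := h.compat.of_fil_eq hg1
  have hcz : ∀ i j k, g.repr (lam (g i) (g j)) k ≠ 0 → z k = z i + z j := fun i j k hk =>
    eigen_basis_repr hg2 (derivation_genEigen hδ (hg2 i) (hg2 j)) hk
  have h1 := h.variation (g := g) (v := fun i => (z i).re) one_pos fun ε h0 _ i j k hk => by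
    have h2 := hc i j k hk
    have h3 : (z k).re = (z i).re + (z j).re := by rw [hcz i j k hk, Complex.add_re]
    simp only [h3]; linarith
  have h2 := h.variation (g := g) (v := fun i => -(z i).re) one_pos fun ε h0 _ i j k hk => by
    have h2 := hc i j k hk
    have h3 : (z k).re = (z i).re + (z j).re := by rw [hcz i j k hk, Complex.add_re]
    simp only [h3]; linarith
  have h3 : ∑ i, (w i - 1) * (z i).re = 0 := by
    refine le_antisymm ?_ h1
    simp only [mul_neg, Finset.sum_neg_distrib] at h2
    linarith
  have h4 : ∀ a, ∑ i with a ≤ w i, (f.repr (δ (f i)) i - z i) = 0 := by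
    intro a
    have e1 := eigen_trace (w := w) hg2 (a := a) (by rw [hg1]; exact hinv a)
    have e2 := trace_comp_filProj_eq hg1 (hinv a)
    rw [trace_comp_filProj, trace_comp_filProj] at e2
    rw [Finset.sum_sub_distrib] at e1 ⊢
    rw [← e2, e1]
  have h5 := congrArg Complex.re (sum_weight_eq_zero (fun t => ((t - 1 : ℝ) : ℂ)) h4)
  rw [Complex.re_sum] at h5
  simp only [Complex.re_ofReal_mul, Complex.sub_re, mul_sub, Finset.sum_sub_distrib,
    Complex.zero_re] at h5
  linarith

end Main

section ONB

variable {V : Type*} [NormedAddCommGroup V] [InnerProductSpace ℂ V] [FiniteDimensional ℂ V]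

/-- A minimal filtration is realized by weights on an orthonormal basis. -/
theorem exists_orthonormal_isMinCompat {m : ℕ} (lam : V →ₗ[ℂ] V →ₗ[ℂ] V)
    (b : Module.Basis (Fin m) ℂ V) :
    ∃ (e : OrthonormalBasis (Fin m) ℂ V) (w : Fin m → ℝ), IsMinCompat lam e.toBasis w := by
  obtain ⟨f, w, hf⟩ := exists_isMinCompat lam b
  let σ : Equiv.Perm (Fin m) := Tuple.sort (fun i => - w i)
  have hσ : Antitone (w ∘ σ) := fun i j hij => by
    have := Tuple.monotone_sort (fun i => - w i) hij
    simpa using this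
  let f' := f.reindex σ.symm
  have hfil : fil f' (w ∘ σ) = fil f w := by
    funext a
    ext x
    simp only [mem_fil, f', Module.Basis.repr_reindex_apply, Equiv.symm_symm, Function.comp]
    exact ⟨fun h i hi => by simpa using h (σ.symm i) (by simpa using hi), fun h i hi => h _ hi⟩
  have hcard : Module.finrank ℂ V = Fintype.card (Fin m) := Module.finrank_eq_card_basis b
  let e := InnerProductSpace.gramSchmidtOrthonormalBasis hcard f'
  have he : fil f' (w ∘ σ) = fil e.toBasis (w ∘ σ) := by
    refine fil_eq_of_basis_mem fun i k hk => hσ ?_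
    by_contra! hlt
    refine hk ?_
    have := InnerProductSpace.gramSchmidtOrthonormalBasis_inv_triangular' hcard f' hlt
    simpa [e] using this
  refine ⟨e, w ∘ σ, hf.compat.of_fil_eq (he.symm.trans hfil), fun g u hu => ?_⟩
  have := hf.le g u hu
  rwa [← Equiv.sum_comp σ] at this

end ONB

/-! ### The complex rigidity theorem -/

section Rigid

variable {V : Type*} [NormedAddCommGroup V] [InnerProductSpace ℂ V] [FiniteDimensional ℂ V]
  {m : ℕ}

theorem sum_norm_sq_map_eq {ι κ : Type*} [Fintype ι] [Fintype κ] (b : OrthonormalBasis ι ℂ V)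
    (e : OrthonormalBasis κ ℂ V) (f : V →ₗ[ℂ] V) :
    ∑ a, ‖f (b a)‖ ^ 2 = ∑ j, ∑ k, ‖inner ℂ (e k) (f (e j))‖ ^ 2 := by
  simp only [← e.sum_sq_norm_inner_right (f (b _)), ← LinearMap.adjoint_inner_left]
  rw [Finset.sum_comm]
  simp only [b.sum_sq_norm_inner_left]
  rw [Finset.sum_comm]
  simp only [e.sum_sq_norm_inner_left]

theorem re_inner_moment {lam : V →ₗ[ℂ] V →ₗ[ℂ] V} (b e : OrthonormalBasis (Fin m) ℂ V)
    (i : Fin m) :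
    (inner ℂ (e i) (((-(1 / 2) : ℂ) • ∑ a, LinearMap.adjoint (lam (b a)) ∘ₗ lam (b a)
      + (1 / 4 : ℂ) • ∑ a, lam (b a) ∘ₗ LinearMap.adjoint (lam (b a))) (e i))).re =
    -(1 / 2) * ∑ j, ∑ k, ‖inner ℂ (e k) (lam (e j) (e i))‖ ^ 2 +
      (1 / 4) * ∑ j, ∑ k, ‖inner ℂ (e i) (lam (e j) (e k))‖ ^ 2 := by
  have h1 : ∀ x, inner ℂ x ((∑ a, LinearMap.adjoint (lam (b a)) ∘ₗ lam (b a)) x) =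
      ((∑ a, ‖lam (b a) x‖ ^ 2 : ℝ) : ℂ) := by
    intro x
    simp only [LinearMap.sum_apply, LinearMap.comp_apply, inner_sum,
      LinearMap.adjoint_inner_right, inner_self_eq_norm_sq_to_K]
    push_cast; rfl
  have h2 : ∀ x, inner ℂ x ((∑ a, lam (b a) ∘ₗ LinearMap.adjoint (lam (b a))) x) =
      ((∑ a, ‖LinearMap.adjoint (lam (b a)) x‖ ^ 2 : ℝ) : ℂ) := by
    intro x
    simp only [LinearMap.sum_apply, LinearMap.comp_apply, inner_sum,
      ← LinearMap.adjoint_inner_left, inner_self_eq_norm_sq_to_K]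
    push_cast; rfl
  have h3 : ∑ a, ‖lam (b a) (e i)‖ ^ 2 = ∑ j, ∑ k, ‖inner ℂ (e k) (lam (e j) (e i))‖ ^ 2 :=
    sum_norm_sq_map_eq b e (lam.flip (e i))
  have h4 : ∑ a, ‖LinearMap.adjoint (lam (b a)) (e i)‖ ^ 2 =
      ∑ j, ∑ k, ‖inner ℂ (e i) (lam (e j) (e k))‖ ^ 2 := by
    simp only [← e.sum_sq_norm_inner_left (LinearMap.adjoint (lam (b _)) (e i)),
      LinearMap.adjoint_inner_left]
    rw [Finset.sum_comm]
    conv_rhs => rw [Finset.sum_comm]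
    refine Finset.sum_congr rfl fun k _ => ?_
    have : ∀ x, inner ℂ (e i) (lam x (e k)) =
      inner ℂ (LinearMap.adjoint (lam.flip (e k)) (e i)) x := fun x => by
        rw [LinearMap.adjoint_inner_left]; rfl
    simp only [this, b.sum_sq_norm_inner_left, e.sum_sq_norm_inner_left]
  rw [LinearMap.add_apply, inner_add_right, LinearMap.smul_apply, LinearMap.smul_apply,
    inner_smul_right, inner_smul_right, h1, h2, h3, h4]
  have c1 : (-(1 / 2) : ℂ) = ((-(1 / 2) : ℝ) : ℂ) := by push_cast; rfl
  have c2 : (1 / 4 : ℂ) = ((1 / 4 : ℝ) : ℂ) := by push_cast; rfl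
  rw [c1, c2, Complex.add_re, Complex.re_ofReal_mul, Complex.re_ofReal_mul, Complex.ofReal_re,
    Complex.ofReal_re]

theorem derivation_of_moment {lam : V →ₗ[ℂ] V →ₗ[ℂ] V} (b : OrthonormalBasis (Fin m) ℂ V)
    (halt : ∀ x y, lam x y = - lam y x)
    (hjac : ∀ x y z, lam x (lam y z) = lam (lam x y) z + lam y (lam x z))
    {δ F B : V →ₗ[ℂ] V} (hδ : ∀ x y, δ (lam x y) = lam (δ x) y + lam x (δ y))
    (hF : F = (1 / 2 : ℂ) • (δ + LinearMap.adjoint δ))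
    (hB : ∀ x, B x = ∑ i, LinearMap.trace ℂ V (lam x ∘ₗ lam (b i)) • b i)
    {c : ℝ} (hc : c < 0)
    (hR : (-(1 / 2) : ℂ) • ∑ a, LinearMap.adjoint (lam (b a)) ∘ₗ lam (b a)
      + (1 / 4 : ℂ) • ∑ a, lam (b a) ∘ₗ LinearMap.adjoint (lam (b a)) =
      (c : ℂ) • LinearMap.id + F + (1 / 2 : ℂ) • B)
    (htr : (LinearMap.trace ℂ V (F ∘ₗ F)).re + c * (LinearMap.trace ℂ V F).re = 0) (x y : V) :
    F (lam x y) = lam (F x) y + lam x (F y) := by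
  obtain ⟨e, w, h⟩ := exists_orthonormal_isMinCompat lam b.toBasis
  have hw := h.weight_nonneg halt hjac
  have hBe : ∀ i, w i * (inner ℂ (e i) (B (e i))).re = 0 := by
    intro i
    rcases (hw i).eq_or_lt with h0 | h0
    · rw [← h0, zero_mul]
    · have : B (e i) = 0 := by
        rw [hB]
        refine Finset.sum_eq_zero fun j _ => ?_
        rw [h.killing_eq_zero hjac h0, zero_smul]
        simpa using basis_mem_fil e.toBasis w (le_refl (w i))
      rw [this, inner_zero_right, Complex.zero_re, mul_zero]
  set d : Fin m → ℝ := fun i => (inner ℂ (e i) (F (e i))).re with hd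
  set C : Fin m → Fin m → Fin m → ℝ := fun i j k => ‖inner ℂ (e k) (lam (e i) (e j))‖ ^ 2 with hC
  have hCs : ∀ i j k, C i j k = C j i k := fun i j k => by
    simp only [hC]
    rw [halt, inner_neg_right, norm_neg]
  have hC0 : ∀ i j k, 0 ≤ C i j k := fun i j k => sq_nonneg _
  have hdδ : ∀ i, d i = (inner ℂ (e i) (δ (e i))).re := by
    intro i
    simp only [hd, hF, LinearMap.smul_apply, LinearMap.add_apply, inner_smul_right,
      inner_add_right, LinearMap.adjoint_inner_right]
    have c1 : (1 / 2 : ℂ) = ((1 / 2 : ℝ) : ℂ) := by push_cast; rfl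
    rw [c1, Complex.re_ofReal_mul, Complex.add_re,
      ← inner_conj_symm (δ (e i)) (e i), Complex.conj_re]
    ring
  have htrF : (LinearMap.trace ℂ V F).re = ∑ i, d i := by
    rw [LinearMap.trace_eq_sum_inner F e, Complex.re_sum]
  have hFsym : ∀ x y, inner ℂ (F x) y = inner ℂ x (F y) := by
    intro x y
    rw [hF]
    simp only [LinearMap.smul_apply, LinearMap.add_apply, inner_smul_left, inner_smul_right,
      inner_add_left, inner_add_right, LinearMap.adjoint_inner_left,
      LinearMap.adjoint_inner_right]
    have c1 : (1 / 2 : ℂ) = ((1 / 2 : ℝ) : ℂ) := by push_cast; rfl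
    rw [c1, Complex.conj_ofReal]
    ring
  have htrFF : (LinearMap.trace ℂ V (F ∘ₗ F)).re = ∑ i, ‖F (e i)‖ ^ 2 := by
    rw [LinearMap.trace_eq_sum_inner _ e, Complex.re_sum]
    refine Finset.sum_congr rfl fun i _ => ?_
    rw [LinearMap.comp_apply, ← hFsym, inner_self_eq_norm_sq_to_K]
    norm_cast
  have hwd : ∑ i, w i * d i = ∑ i, d i := by
    have := h.trace_derivation hδ
    simp only [OrthonormalBasis.coe_toBasis, OrthonormalBasis.coe_toBasis_repr_apply,
      OrthonormalBasis.repr_apply_apply, ← hdδ, sub_mul, one_mul, Finset.sum_sub_distrib] at this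
    linarith
  have hww := h.sum_sq
  have hRi : ∀ i, -(1 / 2) * ∑ j, ∑ k, C j i k + (1 / 4) * ∑ j, ∑ k, C j k i =
      c + d i + (1 / 2) * (inner ℂ (e i) (B (e i))).re := by
    intro i
    rw [← re_inner_moment b e i, hR]
    simp only [LinearMap.add_apply, LinearMap.smul_apply, LinearMap.id_apply, inner_add_right,
      inner_smul_right, Complex.add_re]
    have c1 : (1 / 2 : ℂ) = ((1 / 2 : ℝ) : ℂ) := by push_cast; rfl
    rw [c1, Complex.re_ofReal_mul, Complex.re_ofReal_mul, inner_self_eq_norm_sq_to_K,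
      e.norm_eq_one]
    simp [hd]
  have hsum : (1 / 4) * ∑ i, ∑ j, ∑ k, (w k - w i - w j) * C i j k =
      c * ∑ i, w i + ∑ i, d i := by
    have e1 : ∑ i, w i * (-(1 / 2) * ∑ j, ∑ k, C j i k + (1 / 4) * ∑ j, ∑ k, C j k i) =
        c * ∑ i, w i + ∑ i, d i := by
      simp only [hRi, mul_add, Finset.sum_add_distrib, hwd]
      have : ∀ i, w i * (1 / 2 * (inner ℂ (e i) (B (e i))).re) = 0 := fun i => by
        rw [mul_left_comm, hBe, mul_zero]
      simp only [this, Finset.sum_const_zero, add_zero, Finset.mul_sum]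
      simp only [mul_comm]
    rw [← e1]
    have s1 : ∑ i, ∑ j, ∑ k, w k * C i j k = ∑ i, w i * ∑ j, ∑ k, C j k i := by
      simp only [Finset.mul_sum]
      calc ∑ i, ∑ j, ∑ k, w k * C i j k = ∑ i, ∑ k, ∑ j, w k * C i j k :=
            Finset.sum_congr rfl fun i _ => Finset.sum_comm
        _ = ∑ k, ∑ i, ∑ j, w k * C i j k := Finset.sum_comm
    have s2 : ∑ i, ∑ j, ∑ k, w j * C i j k = ∑ i, w i * ∑ j, ∑ k, C j i k := by
      simp only [Finset.mul_sum]
      rw [Finset.sum_comm]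
    have s3 : ∑ i, ∑ j, ∑ k, w i * C i j k = ∑ i, w i * ∑ j, ∑ k, C j i k := by
      simp only [Finset.mul_sum]
      refine Finset.sum_congr rfl fun i _ => Finset.sum_congr rfl fun j _ =>
        Finset.sum_congr rfl fun k _ => ?_
      rw [hCs]
    simp only [sub_mul, Finset.sum_sub_distrib, s1, s2, s3, mul_add, Finset.sum_add_distrib]
    simp only [mul_left_comm (w _) (-(1 / 2 : ℝ)), mul_left_comm (w _) (1 / 4 : ℝ),
      ← Finset.mul_sum]
    ring
  have hterm : ∀ i j k, 0 ≤ (w k - w i - w j) * C i j k := by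
    intro i j k
    by_cases h0 : inner ℂ (e k) (lam (e i) (e j)) = 0
    · simp [hC, h0]
    · refine mul_nonneg ?_ (hC0 i j k)
      have := h.compat i j k (by
        simpa [OrthonormalBasis.repr_apply_apply] using h0)
      linarith
  have hS0 : 0 ≤ ∑ i, ∑ j, ∑ k, (w k - w i - w j) * C i j k :=
    Finset.sum_nonneg fun i _ => Finset.sum_nonneg fun j _ => Finset.sum_nonneg fun k _ =>
      hterm i j k
  have hsq : ∑ i, ‖F (e i) + ((c * w i : ℝ) : ℂ) • e i‖ ^ 2 =
      c * (c * ∑ i, w i + ∑ i, d i) := by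
    have : ∀ i, ‖F (e i) + ((c * w i : ℝ) : ℂ) • e i‖ ^ 2 =
        ‖F (e i)‖ ^ 2 + 2 * c * (w i * d i) + c ^ 2 * w i ^ 2 := by
      intro i
      rw [@norm_add_sq ℂ, inner_smul_right, norm_smul, e.norm_eq_one,
        ← inner_conj_symm (F (e i)) (e i), RCLike.re_eq_complex_re, Complex.re_ofReal_mul,
        Complex.conj_re, Complex.norm_real, Real.norm_eq_abs, mul_one, sq_abs]
      simp only [hd]
      ring
    simp only [this, Finset.sum_add_distrib, ← Finset.mul_sum, ← htrFF, hwd, hww]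
    rw [htrF] at htr
    linear_combination htr
  have hz : c * ∑ i, w i + ∑ i, d i = 0 := by
    have : 0 ≤ c * (c * ∑ i, w i + ∑ i, d i) := by
      rw [← hsq]; exact Finset.sum_nonneg fun i _ => sq_nonneg _
    have h2 : 0 ≤ c * ∑ i, w i + ∑ i, d i := by rw [← hsum]; positivity
    nlinarith
  have hFe : ∀ i, F (e i) = (-(c * w i : ℝ) : ℂ) • e i := by
    intro i
    rw [hz, mul_zero] at hsq
    have := (Finset.sum_eq_zero_iff_of_nonneg fun i _ => sq_nonneg _).1 hsq i (Finset.mem_univ i)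
    have := norm_eq_zero.1 (pow_eq_zero_iff two_ne_zero |>.1 this)
    rw [neg_smul]
    exact eq_neg_of_add_eq_zero_left this
  have hCw : ∀ i j k, inner ℂ (e k) (lam (e i) (e j)) ≠ 0 → w k = w i + w j := by
    intro i j k hne
    rw [hz] at hsum
    have h0 : ∑ i, ∑ j, ∑ k, (w k - w i - w j) * C i j k = 0 := by linarith
    have h1 := (Finset.sum_eq_zero_iff_of_nonneg fun i _ => Finset.sum_nonneg fun j _ =>
      Finset.sum_nonneg fun k _ => hterm i j k).1 h0 i (Finset.mem_univ i)
    have h2 := (Finset.sum_eq_zero_iff_of_nonneg fun j _ =>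
      Finset.sum_nonneg fun k _ => hterm i j k).1 h1 j (Finset.mem_univ j)
    have h3 := (Finset.sum_eq_zero_iff_of_nonneg fun k _ => hterm i j k).1 h2 k
      (Finset.mem_univ k)
    rcases mul_eq_zero.1 h3 with h4 | h4
    · linarith
    · exact absurd (norm_eq_zero.1 (pow_eq_zero_iff two_ne_zero |>.1 h4)) hne
  have hbasis : ∀ i j, F (lam (e i) (e j)) = lam (F (e i)) (e j) + lam (e i) (F (e j)) := by
    intro i j
    rw [hFe, hFe, map_smul, map_smul, LinearMap.smul_apply, ← add_smul]
    rw [← e.sum_repr' (lam (e i) (e j)), map_sum, Finset.smul_sum]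
    refine Finset.sum_congr rfl fun k _ => ?_
    rw [map_smul, hFe]
    by_cases h0 : inner ℂ (e k) (lam (e i) (e j)) = 0
    · rw [h0, zero_smul, zero_smul, smul_zero]
    · rw [hCw i j k h0, smul_comm]
      congr 1
      push_cast
      ring
  let T : V →ₗ[ℂ] V →ₗ[ℂ] V := LinearMap.llcomp ℂ V V V F ∘ₗ lam - lam ∘ₗ F
    - LinearMap.lcomp ℂ V F ∘ₗ lam
  have hT : T = 0 := by
    refine e.toBasis.ext fun i => e.toBasis.ext fun j => ?_
    simp only [T, OrthonormalBasis.coe_toBasis, LinearMap.sub_apply, LinearMap.comp_apply,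
      LinearMap.llcomp_apply, LinearMap.lcomp_apply, hbasis, LinearMap.zero_apply]
    abel
  have := DFunLike.congr_fun (DFunLike.congr_fun hT x) y
  simp only [T, LinearMap.sub_apply, LinearMap.comp_apply,
      LinearMap.llcomp_apply, LinearMap.lcomp_apply, LinearMap.zero_apply] at this
  rw [sub_sub, sub_eq_zero] at this
  exact this

end Rigid

/-! ### Complexification -/

section Complexify

variable {E : Type*} [NormedAddCommGroup E] [InnerProductSpace ℝ E] [FiniteDimensional ℝ E]

variable (E) in
/-- The complexification of `E`, in the coordinates of the standard orthonormal basis. -/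
abbrev Cx : Type := EuclideanSpace ℂ (Fin (Module.finrank ℝ E))

variable (E) in
/-- The standard orthonormal basis of the complexification. -/
def cxONB : OrthonormalBasis (Fin (Module.finrank ℝ E)) ℂ (Cx E) :=
  EuclideanSpace.basisFun _ ℂ

/-- The embedding of `E` in its complexification. -/
def cxVec : E →ₗ[ℝ] Cx E where
  toFun x := ∑ i, ((⟪stdONB E i, x⟫ : ℝ) : ℂ) • cxONB E i
  map_add' x y := by
    simp only [inner_add_right, Complex.ofReal_add, add_smul, Finset.sum_add_distrib]
  map_smul' r x := by
    simp only [inner_smul_right, Complex.ofReal_mul, mul_smul, ← Finset.smul_sum, RingHom.id_apply,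
      Complex.coe_smul]

theorem cxVec_stdONB (i : Fin (Module.finrank ℝ E)) : cxVec (stdONB E i) = cxONB E i := by
  classical
  simp only [cxVec, LinearMap.coe_mk, AddHom.coe_mk]
  rw [Finset.sum_eq_single i]
  · simp
  · intro j _ hj
    rw [(stdONB E).inner_eq_zero hj, Complex.ofReal_zero, zero_smul]
  · simp

theorem inner_cxVec (x y : E) : inner ℂ (cxVec x) (cxVec y) = ((⟪x, y⟫ : ℝ) : ℂ) := by
  classical
  simp only [cxVec, LinearMap.coe_mk, AddHom.coe_mk]
  rw [(cxONB E).orthonormal.inner_sum, ← (stdONB E).sum_inner_mul_inner x y]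
  push_cast
  refine Finset.sum_congr rfl fun i _ => ?_
  rw [Complex.conj_ofReal, real_inner_comm]

theorem cxVec_injective : Function.Injective (cxVec : E →ₗ[ℝ] Cx E) := by
  rw [← LinearMap.ker_eq_bot, LinearMap.ker_eq_bot']
  intro x hx
  have := inner_cxVec x x
  rw [hx, inner_zero_left] at this
  exact inner_self_eq_zero.1 (by exact_mod_cast this.symm)

theorem cx_ext {W : Type*} [AddCommGroup W] [Module ℂ W] {S T : Cx E →ₗ[ℂ] W}
    (h : ∀ x : E, S (cxVec x) = T (cxVec x)) : S = T :=
  (cxONB E).toBasis.ext fun i => by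
    rw [OrthonormalBasis.coe_toBasis, ← cxVec_stdONB]; exact h _

/-- The complexification of a real linear map. -/
def cxMap {W : Type*} [AddCommGroup W] [Module ℂ W] (f : E →ₗ[ℝ] W) : Cx E →ₗ[ℂ] W :=
  (cxONB E).toBasis.constr ℂ fun i => f (stdONB E i)

theorem cxMap_cxVec {W : Type*} [AddCommGroup W] [Module ℂ W] (f : E →ₗ[ℝ] W) (x : E) :
    cxMap f (cxVec x) = f x := by
  have h : ((cxMap f).restrictScalars ℝ) ∘ₗ cxVec = f :=
    (stdONB E).toBasis.ext fun i => by
      rw [OrthonormalBasis.coe_toBasis, LinearMap.comp_apply, cxVec_stdONB,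
        LinearMap.restrictScalars_apply, cxMap, ← (cxONB E).coe_toBasis, Module.Basis.constr_basis]
  exact DFunLike.congr_fun h x

/-- The complexification of a real operator. -/
def cxEnd : (E →ₗ[ℝ] E) →ₗ[ℝ] (Cx E →ₗ[ℂ] Cx E) where
  toFun T := cxMap (cxVec ∘ₗ T)
  map_add' S T := cx_ext fun x => by simp [cxMap_cxVec]
  map_smul' r T := cx_ext fun x => by simp [cxMap_cxVec]

@[simp] theorem cxEnd_cxVec (T : E →ₗ[ℝ] E) (x : E) : cxEnd T (cxVec x) = cxVec (T x) :=
  cxMap_cxVec _ x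

theorem cxEnd_comp (S T : E →ₗ[ℝ] E) : cxEnd (S ∘ₗ T) = cxEnd S ∘ₗ cxEnd T :=
  cx_ext fun x => by simp

theorem cxEnd_id : cxEnd (LinearMap.id : E →ₗ[ℝ] E) = LinearMap.id :=
  cx_ext fun x => by simp

theorem cxEnd_adjoint (T : E →ₗ[ℝ] E) :
    cxEnd (LinearMap.adjoint T) = LinearMap.adjoint (cxEnd T) := by
  rw [LinearMap.eq_adjoint_iff_basis (cxONB E).toBasis (cxONB E).toBasis]
  intro i j
  simp only [OrthonormalBasis.coe_toBasis, ← cxVec_stdONB, cxEnd_cxVec, inner_cxVec,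
    LinearMap.adjoint_inner_left]

theorem trace_cxEnd (T : E →ₗ[ℝ] E) :
    LinearMap.trace ℂ _ (cxEnd T) = ((LinearMap.trace ℝ E T : ℝ) : ℂ) := by
  rw [LinearMap.trace_eq_sum_inner _ (cxONB E), LinearMap.trace_eq_sum_inner _ (stdONB E)]
  push_cast
  refine Finset.sum_congr rfl fun i _ => ?_
  rw [← cxVec_stdONB, cxEnd_cxVec, inner_cxVec]

/-- The complexification of a bilinear map. -/
def cxBr (μ : E →ₗ[ℝ] E →ₗ[ℝ] E) : Cx E →ₗ[ℂ] Cx E →ₗ[ℂ] Cx E := cxMap (cxEnd ∘ₗ μ)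

@[simp] theorem cxBr_cxVec (μ : E →ₗ[ℝ] E →ₗ[ℝ] E) (x : E) : cxBr μ (cxVec x) = cxEnd (μ x) :=
  cxMap_cxVec _ x

theorem cxBr_derivation_iff {μ : E →ₗ[ℝ] E →ₗ[ℝ] E} {δ : E →ₗ[ℝ] E} :
    (∀ x y, cxEnd δ (cxBr μ x y) = cxBr μ (cxEnd δ x) y + cxBr μ x (cxEnd δ y)) ↔
      IsDeriv μ δ := by
  constructor
  · intro h x y
    have := h (cxVec x) (cxVec y)
    simp only [cxBr_cxVec, cxEnd_cxVec, ← map_add] at this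
    exact cxVec_injective this
  · intro h
    have : LinearMap.llcomp ℂ _ _ _ (cxEnd δ) ∘ₗ cxBr μ =
        cxBr μ ∘ₗ cxEnd δ + LinearMap.lcomp ℂ _ (cxEnd δ) ∘ₗ cxBr μ :=
      cx_ext fun x => cx_ext fun y => by
        simp [h x y]
    intro x y
    exact DFunLike.congr_fun (DFunLike.congr_fun this x) y

theorem isDeriv_symPart_of_Rop {μ : E →ₗ[ℝ] E →ₗ[ℝ] E} (hμ : IsLieBracket μ) {δ : E →ₗ[ℝ] E}
    (hδ : IsDeriv μ δ) {c : ℝ} (hc : c < 0)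
    (hR : Rop μ = c • LinearMap.id + symPart δ + (1 / 2 : ℝ) • Bop μ)
    (htr : LinearMap.trace ℝ E (symPart δ ∘ₗ symPart δ)
      + c * LinearMap.trace ℝ E (symPart δ) = 0) :
    IsDeriv μ (symPart δ) := by
  have hskew : ∀ x y, μ x y = - μ y x := fun x y => by
    have h := hμ.1 (x + y)
    simp only [map_add, LinearMap.add_apply, hμ.1, zero_add, add_zero] at h
    exact eq_neg_of_add_eq_zero_right h
  rw [← cxBr_derivation_iff]
  have smulC : ∀ (r : ℝ) (T : E →ₗ[ℝ] E), cxEnd (r • T) = (r : ℂ) • cxEnd T := fun r T => by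
    rw [map_smul, Complex.coe_smul]
  refine derivation_of_moment (cxONB E) (δ := cxEnd δ) (B := cxEnd (Bop μ)) (c := c) ?_ ?_
    (cxBr_derivation_iff.2 hδ) ?_ ?_ hc ?_ ?_
  · have : cxBr μ = - (cxBr μ).flip := cx_ext fun x => cx_ext fun y => by
      simp [hskew x y]
    intro x y
    exact DFunLike.congr_fun (DFunLike.congr_fun this x) y
  · have h1 : ∀ x : E, ∀ y z, cxBr μ (cxVec x) (cxBr μ y z) =
        cxBr μ (cxBr μ (cxVec x) y) z + cxBr μ y (cxBr μ (cxVec x) z) := by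
      intro x
      rw [cxBr_cxVec]
      exact cxBr_derivation_iff.2 (hμ.2 x)
    intro x y z
    have : ((cxBr μ).flip (cxBr μ y z)) = ((cxBr μ).flip z) ∘ₗ (cxBr μ).flip y +
        cxBr μ y ∘ₗ (cxBr μ).flip z := cx_ext fun x => by
      simpa using h1 x y z
    exact DFunLike.congr_fun this x
  · rw [symPart, smulC, map_add, transp, cxEnd_adjoint]
    push_cast; rfl
  · have : cxEnd (Bop μ) = ∑ i, ((LinearMap.trace ℂ (Cx E) ∘ₗ
        LinearMap.lcomp ℂ (Cx E) (cxBr μ (cxONB E i)) ∘ₗ cxBr μ).smulRight (cxONB E i)) := by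
      refine cx_ext fun x => ?_
      simp only [cxEnd_cxVec, Bop, LinearMap.sum_apply, map_sum, LinearMap.smulRight_apply,
        map_smul, LinearMap.comp_apply, LinearMap.lcomp_apply', cxBr_cxVec, ← cxVec_stdONB,
        ← cxEnd_comp, trace_cxEnd, Complex.coe_smul]
    intro x
    rw [this]
    simp only [LinearMap.sum_apply, LinearMap.smulRight_apply, LinearMap.comp_apply,
      LinearMap.lcomp_apply']
  · have := congrArg cxEnd hR
    rw [Rop] at this
    simp only [map_add, map_sum, smulC, cxEnd_comp, transp, cxEnd_adjoint, cxEnd_id] at this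
    simp only [← cxVec_stdONB, cxBr_cxVec]
    push_cast at this
    exact this
  · rw [← cxEnd_comp, trace_cxEnd, trace_cxEnd, Complex.ofReal_re, Complex.ofReal_re, htr]

end Complexify

/-! ### Algebraic identities -/

section Algebra

variable {E : Type*} [AddCommGroup E] [Module ℝ E] {μ : E →ₗ[ℝ] E →ₗ[ℝ] E}

theorem IsLieBracket.skew (hμ : IsLieBracket μ) (x y : E) : μ x y = - μ y x := by
  have h := hμ.1 (x + y)
  simp only [map_add, LinearMap.add_apply, hμ.1, zero_add, add_zero] at h
  exact eq_neg_of_add_eq_zero_right h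

theorem IsLieBracket.isDeriv (hμ : IsLieBracket μ) (x : E) : IsDeriv μ (μ x) := hμ.2 x

theorem IsDeriv.add {G G' : E →ₗ[ℝ] E} (h : IsDeriv μ G) (h' : IsDeriv μ G') :
    IsDeriv μ (G + G') := fun x y => by
  simp only [LinearMap.add_apply, h x y, h' x y, map_add]
  abel

theorem IsDeriv.smul {G : E →ₗ[ℝ] E} (h : IsDeriv μ G) (r : ℝ) : IsDeriv μ (r • G) :=
  fun x y => by simp only [LinearMap.smul_apply, h x y, map_smul, smul_add]

theorem IsDeriv.comp_br {G : E →ₗ[ℝ] E} (h : IsDeriv μ G) (x : E) :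
    G ∘ₗ μ x = μ (G x) + μ x ∘ₗ G := LinearMap.ext fun y => h x y

theorem IsDeriv.commutator {G G' : E →ₗ[ℝ] E} (h : IsDeriv μ G) (h' : IsDeriv μ G') :
    IsDeriv μ (G ∘ₗ G' - G' ∘ₗ G) := fun x y => by
  simp only [LinearMap.sub_apply, LinearMap.comp_apply, h' x y, h x y, map_add, h (G' _),
    h _ (G' _), h' (G _), h' _ (G _), map_sub]
  abel

theorem piAct_apply (f : E →ₗ[ℝ] E) (μ : E →ₗ[ℝ] E →ₗ[ℝ] E) (x y : E) :
    piAct f μ x y = f (μ x y) - μ (f x) y - μ x (f y) := by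
  simp [piAct]

theorem isDeriv_iff_piAct {G : E →ₗ[ℝ] E} : IsDeriv μ G ↔ piAct G μ = 0 := by
  constructor
  · intro h
    ext x y
    rw [piAct_apply, h x y, LinearMap.zero_apply, LinearMap.zero_apply]
    abel
  · intro h x y
    have := piAct_apply G μ x y
    rw [h, LinearMap.zero_apply, LinearMap.zero_apply, sub_sub, eq_comm, sub_eq_zero] at this
    exact this

theorem piAct_commutator (f g : E →ₗ[ℝ] E) (μ : E →ₗ[ℝ] E →ₗ[ℝ] E) :
    piAct (f ∘ₗ g - g ∘ₗ f) μ = piAct f (piAct g μ) - piAct g (piAct f μ) := by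
  ext x y
  simp only [piAct_apply, LinearMap.sub_apply, LinearMap.comp_apply, map_sub]
  abel

end Algebra

/-! ### Transposes and traces -/

section Metric

variable {E : Type*} [NormedAddCommGroup E] [InnerProductSpace ℝ E] [FiniteDimensional ℝ E]

theorem transp_inner_left (f : E →ₗ[ℝ] E) (x y : E) : ⟪transp f x, y⟫ = ⟪x, f y⟫ :=
  LinearMap.adjoint_inner_left f y x

theorem transp_inner_right (f : E →ₗ[ℝ] E) (x y : E) : ⟪x, transp f y⟫ = ⟪f x, y⟫ :=
  LinearMap.adjoint_inner_right f x y

@[simp] theorem transp_transp (f : E →ₗ[ℝ] E) : transp (transp f) = f :=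
  LinearMap.adjoint_adjoint f

theorem transp_comp (f g : E →ₗ[ℝ] E) : transp (f ∘ₗ g) = transp g ∘ₗ transp f :=
  LinearMap.adjoint_comp f g

theorem transp_add (f g : E →ₗ[ℝ] E) : transp (f + g) = transp f + transp g :=
  map_add LinearMap.adjoint f g

theorem transp_sub (f g : E →ₗ[ℝ] E) : transp (f - g) = transp f - transp g :=
  map_sub LinearMap.adjoint f g

theorem transp_smul (r : ℝ) (f : E →ₗ[ℝ] E) : transp (r • f) = r • transp f := by
  simp [transp]

theorem transp_eq_self_iff {f : E →ₗ[ℝ] E} : transp f = f ↔ f.IsSymmetric := by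
  rw [LinearMap.isSymmetric_iff_isSelfAdjoint]; rfl

theorem trace_transp (f : E →ₗ[ℝ] E) :
    LinearMap.trace ℝ E (transp f) = LinearMap.trace ℝ E f := by
  rw [LinearMap.trace_eq_sum_inner _ (stdONB E), LinearMap.trace_eq_sum_inner _ (stdONB E)]
  refine Finset.sum_congr rfl fun i _ => ?_
  rw [transp_inner_right, real_inner_comm]

theorem transp_symPart (f : E →ₗ[ℝ] E) : transp (symPart f) = symPart f := by
  rw [symPart, transp_smul, transp_add, transp_transp, add_comm]

theorem symPart_isSymmetric (f : E →ₗ[ℝ] E) : (symPart f).IsSymmetric :=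
  transp_eq_self_iff.1 (transp_symPart f)

theorem trace_symPart (f : E →ₗ[ℝ] E) :
    LinearMap.trace ℝ E (symPart f) = LinearMap.trace ℝ E f := by
  rw [symPart, map_smul, map_add, trace_transp, smul_eq_mul]; ring

theorem sum_inner_eq_trace {ι : Type*} [Fintype ι] (b : OrthonormalBasis ι ℝ E)
    (f g : E →ₗ[ℝ] E) :
    ∑ i, ⟪f (b i), g (b i)⟫ = LinearMap.trace ℝ E (transp g ∘ₗ f) := by
  rw [LinearMap.trace_eq_sum_inner _ b]
  refine Finset.sum_congr rfl fun i _ => ?_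
  rw [LinearMap.comp_apply, transp_inner_right, real_inner_comm]

theorem trace_transp_comp_self_nonneg (f : E →ₗ[ℝ] E) :
    0 ≤ LinearMap.trace ℝ E (transp f ∘ₗ f) := by
  rw [← sum_inner_eq_trace (stdONB E)]
  exact Finset.sum_nonneg fun i _ => real_inner_self_nonneg

theorem eq_zero_of_trace_transp_comp_self {f : E →ₗ[ℝ] E}
    (h : LinearMap.trace ℝ E (transp f ∘ₗ f) = 0) : f = 0 := by
  rw [← sum_inner_eq_trace (stdONB E),
    Finset.sum_eq_zero_iff_of_nonneg fun i _ => real_inner_self_nonneg] at h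
  exact (stdONB E).toBasis.ext fun i => by
    simpa using h i (Finset.mem_univ i)

theorem symPart_eq_self {f : E →ₗ[ℝ] E} (h : f.IsSymmetric) : symPart f = f := by
  rw [symPart, transp_eq_self_iff.2 h, ← two_smul ℝ, smul_smul]; norm_num

theorem symPart_add (f g : E →ₗ[ℝ] E) : symPart (f + g) = symPart f + symPart g := by
  simp only [symPart, transp_add, ← smul_add]; congr 1; abel

/-! ### The moment map -/

variable {μ : E →ₗ[ℝ] E →ₗ[ℝ] E}

theorem sum_inner_comp (f g G : E →ₗ[ℝ] E) :
    ∑ i, ⟪f (G (stdONB E i)), g (stdONB E i)⟫ =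
      ∑ i, ⟪f (stdONB E i), g (transp G (stdONB E i))⟫ := by
  have h1 := sum_inner_eq_trace (stdONB E) (f ∘ₗ G) g
  have h2 := sum_inner_eq_trace (stdONB E) f (g ∘ₗ transp G)
  simp only [LinearMap.comp_apply] at h1 h2
  rw [h1, h2, transp_comp, transp_transp, LinearMap.comp_assoc, LinearMap.trace_comp_comm',
    LinearMap.comp_assoc, LinearMap.trace_comp_comm', LinearMap.comp_assoc,
    LinearMap.trace_comp_comm', LinearMap.comp_assoc]

theorem binner_piAct_left (G : E →ₗ[ℝ] E) (α β : E →ₗ[ℝ] E →ₗ[ℝ] E) :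
    binner (piAct G α) β = binner α (piAct (transp G) β) := by
  simp only [binner, piAct_apply, inner_sub_left, inner_sub_right, Finset.sum_sub_distrib,
    transp_inner_right]
  congr 1
  · congr 1
    rw [Finset.sum_comm]
    conv_rhs => rw [Finset.sum_comm]
    exact Finset.sum_congr rfl fun j _ =>
      sum_inner_comp (α.flip (stdONB E j)) (β.flip (stdONB E j)) G
  · exact Finset.sum_congr rfl fun i _ => sum_inner_comp (α (stdONB E i)) (β (stdONB E i)) G

theorem eq_zero_of_binner_self {α : E →ₗ[ℝ] E →ₗ[ℝ] E} (h : binner α α = 0) : α = 0 := by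
  rw [binner, Finset.sum_eq_zero_iff_of_nonneg fun i _ => Finset.sum_nonneg fun _ _ =>
    real_inner_self_nonneg] at h
  refine (stdONB E).toBasis.ext fun i => (stdONB E).toBasis.ext fun j => ?_
  have h1 := h i (Finset.mem_univ i)
  rw [Finset.sum_eq_zero_iff_of_nonneg fun _ _ => real_inner_self_nonneg] at h1
  simpa using h1 j (Finset.mem_univ j)

omit [FiniteDimensional ℝ E] in
theorem sum_comp_linearMap {ι : Type*} (s : Finset ι) (f : ι → E →ₗ[ℝ] E) (G : E →ₗ[ℝ] E) :
    (∑ i ∈ s, f i) ∘ₗ G = ∑ i ∈ s, f i ∘ₗ G := by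
  ext x; simp

theorem trace_Rop_comp (hμ : IsLieBracket μ) (G : E →ₗ[ℝ] E) :
    LinearMap.trace ℝ E (Rop μ ∘ₗ G) = (1 / 4) * binner (piAct G μ) μ := by
  have h1 : ∀ i, LinearMap.trace ℝ E ((transp (μ (stdONB E i)) ∘ₗ μ (stdONB E i)) ∘ₗ G) =
      ∑ j, ⟪μ (stdONB E i) (G (stdONB E j)), μ (stdONB E i) (stdONB E j)⟫ := fun i => by
    rw [LinearMap.comp_assoc, ← sum_inner_eq_trace (stdONB E)]; rfl
  have h2 : ∀ i, LinearMap.trace ℝ E ((μ (stdONB E i) ∘ₗ transp (μ (stdONB E i))) ∘ₗ G) =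
      ∑ j, ⟪G (μ (stdONB E i) (stdONB E j)), μ (stdONB E i) (stdONB E j)⟫ := fun i => by
    rw [LinearMap.comp_assoc, LinearMap.trace_comp_comm', LinearMap.comp_assoc,
      ← sum_inner_eq_trace (stdONB E)]; rfl
  have h3 : ∑ i, ∑ j, ⟪μ (G (stdONB E i)) (stdONB E j), μ (stdONB E i) (stdONB E j)⟫ =
      ∑ i, ∑ j, ⟪μ (stdONB E i) (G (stdONB E j)), μ (stdONB E i) (stdONB E j)⟫ := by
    rw [Finset.sum_comm]
    refine Finset.sum_congr rfl fun i _ => Finset.sum_congr rfl fun j _ => ?_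
    rw [hμ.skew (G _), hμ.skew (stdONB E j), inner_neg_neg]
  rw [Rop, LinearMap.add_comp, LinearMap.smul_comp, LinearMap.smul_comp, sum_comp_linearMap,
    sum_comp_linearMap, map_add, map_smul, map_smul, map_sum, map_sum]
  simp only [h1, h2, binner, piAct_apply, inner_sub_left, Finset.sum_sub_distrib, h3, smul_eq_mul]
  ring

theorem trace_Rop_isDeriv (hμ : IsLieBracket μ) {G : E →ₗ[ℝ] E} (hG : IsDeriv μ G) :
    LinearMap.trace ℝ E (Rop μ ∘ₗ G) = 0 := by
  rw [trace_Rop_comp hμ, isDeriv_iff_piAct.1 hG]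
  simp [binner]

theorem trace_Rop_commutator (hμ : IsLieBracket μ) (G : E →ₗ[ℝ] E) :
    LinearMap.trace ℝ E (Rop μ ∘ₗ (G ∘ₗ transp G - transp G ∘ₗ G)) =
      (1 / 4) * (binner (piAct (transp G) μ) (piAct (transp G) μ) -
        binner (piAct G μ) (piAct G μ)) := by
  rw [trace_Rop_comp hμ, piAct_commutator]
  have h : ∀ α β γ : E →ₗ[ℝ] E →ₗ[ℝ] E, binner (α - β) γ = binner α γ - binner β γ := by
    intro α β γ
    simp [binner, inner_sub_left]
  have h' := binner_piAct_left (transp G) (piAct G μ) μ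
  rw [transp_transp] at h'
  rw [h, binner_piAct_left G, h']

/-! ### Killing form, mean curvature, Ricci operator -/

theorem Bop_apply (μ : E →ₗ[ℝ] E →ₗ[ℝ] E) (x : E) :
    Bop μ x = ∑ i, LinearMap.trace ℝ E (μ x ∘ₗ μ (stdONB E i)) • stdONB E i := by
  simp only [Bop, LinearMap.sum_apply, LinearMap.smulRight_apply, LinearMap.comp_apply,
    LinearMap.lcomp_apply']

theorem inner_Bop (μ : E →ₗ[ℝ] E →ₗ[ℝ] E) (x y : E) :
    ⟪Bop μ x, y⟫ = LinearMap.trace ℝ E (μ x ∘ₗ μ y) := by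
  have h : (LinearMap.trace ℝ E ∘ₗ LinearMap.llcomp ℝ E E E (μ x) ∘ₗ μ) =
      innerₛₗ ℝ (Bop μ x) := by
    refine (stdONB E).toBasis.ext fun i => ?_
    rw [OrthonormalBasis.coe_toBasis, innerₛₗ_apply_apply, Bop_apply, sum_inner,
      Finset.sum_eq_single i]
    · rw [inner_smul_left, (stdONB E).inner_eq_one]
      simp [LinearMap.llcomp_apply']
    · intro j _ hj
      rw [inner_smul_left, (stdONB E).inner_eq_zero hj, mul_zero]
    · simp
  exact (DFunLike.congr_fun h y).symm

theorem Bop_isSymmetric (μ : E →ₗ[ℝ] E →ₗ[ℝ] E) : (Bop μ).IsSymmetric := fun x y => by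
  rw [inner_Bop, real_inner_comm, inner_Bop, LinearMap.trace_comp_comm']

theorem inner_meanCurv (μ : E →ₗ[ℝ] E →ₗ[ℝ] E) (y : E) :
    ⟪meanCurv μ, y⟫ = LinearMap.trace ℝ E (μ y) := by
  have h : LinearMap.trace ℝ E ∘ₗ μ = innerₛₗ ℝ (meanCurv μ) := by
    refine (stdONB E).toBasis.ext fun i => ?_
    rw [OrthonormalBasis.coe_toBasis, innerₛₗ_apply_apply, meanCurv, sum_inner,
      Finset.sum_eq_single i]
    · rw [inner_smul_left, (stdONB E).inner_eq_one]
      simp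
    · intro j _ hj
      rw [inner_smul_left, (stdONB E).inner_eq_zero hj, mul_zero]
    · simp
  exact (DFunLike.congr_fun h y).symm

theorem Rop_isSymmetric (μ : E →ₗ[ℝ] E →ₗ[ℝ] E) : (Rop μ).IsSymmetric := by
  rw [← transp_eq_self_iff, Rop, transp_add, transp_smul, transp_smul]
  have h : ∀ f : Fin (Module.finrank ℝ E) → E →ₗ[ℝ] E, transp (∑ i, f i) = ∑ i, transp (f i) :=
    fun f => map_sum LinearMap.adjoint _ _
  simp only [h, transp_comp, transp_transp]

theorem Ric_isSymmetric (μ : E →ₗ[ℝ] E →ₗ[ℝ] E) : (Ric μ).IsSymmetric := by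
  rw [← transp_eq_self_iff, Ric, transp_sub, transp_sub, transp_smul, transp_symPart,
    transp_eq_self_iff.2 (Rop_isSymmetric μ), transp_eq_self_iff.2 (Bop_isSymmetric μ)]

theorem trace_Bop_isDeriv {G : E →ₗ[ℝ] E} (hG : IsDeriv μ G) :
    LinearMap.trace ℝ E (Bop μ ∘ₗ G) = 0 := by
  rw [LinearMap.trace_eq_sum_inner _ (stdONB E)]
  refine Finset.sum_eq_zero fun i _ => ?_
  have h := hG.comp_br (stdONB E i)
  rw [LinearMap.comp_apply, real_inner_comm, inner_Bop, ← sub_eq_iff_eq_add.2 h,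
    LinearMap.sub_comp, map_sub, LinearMap.trace_comp_comm' _ (G ∘ₗ μ _), ← LinearMap.comp_assoc,
    sub_self]

theorem Rop_eq_of_Ric {c : ℝ} {D : E →ₗ[ℝ] E} (h : Ric μ = c • LinearMap.id + D) :
    Rop μ = c • LinearMap.id + (symPart (μ (meanCurv μ)) + D) + (1 / 2 : ℝ) • Bop μ := by
  rw [Ric, sub_sub, sub_eq_iff_eq_add] at h
  rw [h]; abel

theorem isSymmetric_of_Ric {c : ℝ} {D : E →ₗ[ℝ] E} (h : Ric μ = c • LinearMap.id + D) :
    D.IsSymmetric := by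
  have h1 : D = Ric μ - c • LinearMap.id := by rw [h]; abel
  intro x y
  simp only [h1, LinearMap.sub_apply, LinearMap.smul_apply, LinearMap.id_apply, inner_sub_left,
    inner_sub_right, inner_smul_left, inner_smul_right, Ric_isSymmetric μ x y, RCLike.conj_to_real]

theorem isDeriv_symPart_add (hμ : IsLieBracket μ) {c : ℝ} (hc : c < 0) {D : E →ₗ[ℝ] E}
    (hD : IsDeriv μ D) (h : Ric μ = c • LinearMap.id + D) :
    IsDeriv μ (symPart (μ (meanCurv μ)) + D) := by
  have hDs := isSymmetric_of_Ric h
  have hδ : IsDeriv μ (μ (meanCurv μ) + D) := (hμ.isDeriv _).add hD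
  have hF : symPart (μ (meanCurv μ) + D) = symPart (μ (meanCurv μ)) + D := by
    rw [symPart_add, symPart_eq_self hDs]
  have hR := Rop_eq_of_Ric h
  rw [← hF] at hR ⊢
  set δ := μ (meanCurv μ) + D
  refine isDeriv_symPart_of_Rop hμ hδ hc hR ?_
  have h0 := trace_Rop_isDeriv hμ hδ
  rw [hR, LinearMap.add_comp, LinearMap.add_comp, map_add, map_add, LinearMap.smul_comp,
    LinearMap.smul_comp, map_smul, map_smul, trace_Bop_isDeriv hδ, LinearMap.id_comp, smul_zero,
    add_zero, smul_eq_mul] at h0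
  have h1 : LinearMap.trace ℝ E (symPart δ ∘ₗ symPart δ) =
      LinearMap.trace ℝ E (symPart δ ∘ₗ δ) := by
    have h2 : symPart δ ∘ₗ symPart δ =
        (1 / 2 : ℝ) • (symPart δ ∘ₗ δ + symPart δ ∘ₗ transp δ) := by
      rw [← LinearMap.comp_add, ← LinearMap.comp_smul]; rfl
    rw [h2, map_smul, map_add,
      ← trace_transp (symPart δ ∘ₗ transp δ), transp_comp, transp_transp, transp_symPart,
      LinearMap.trace_comp_comm' δ, smul_eq_mul]
    ring
  rw [h1, trace_symPart]
  linarith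

end Metric

section LieNilp
open LieModule LieAlgebra

theorem isNilpotent_toEnd_of_mem_derivedSeries_one (k : Type*) [Field k] [CharZero k]
    [IsAlgClosed k] (L : Type*) [LieRing L] [LieAlgebra k L] [FiniteDimensional k L]
    [IsSolvable L] (d : ℕ) : ∀ (V : Type*) [AddCommGroup V] [Module k V] [LieRingModule L V]
    [LieModule k L V] [FiniteDimensional k V], Module.finrank k V ≤ d →
    ∀ x ∈ derivedSeries k L 1, _root_.IsNilpotent (toEnd k L V x) := by
  induction d with
  | zero =>
    intro V _ _ _ _ _ hV x _
    have : Subsingleton V := Module.finrank_zero_iff.1 (Nat.le_zero.1 hV)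
    exact ⟨1, LinearMap.ext fun v => Subsingleton.elim _ _⟩
  | succ d ih =>
    intro V _ _ _ _ _ hV x hx
    rcases subsingleton_or_nontrivial V with hs | hs
    · exact ⟨1, LinearMap.ext fun v => Subsingleton.elim _ _⟩
    obtain ⟨χ, hχ⟩ := exists_nontrivial_weightSpace_of_isSolvable k L V
    obtain ⟨⟨v, hv⟩, hv0⟩ := exists_ne (0 : weightSpace V χ)
    have hlt : Module.finrank k (V ⧸ weightSpace V χ) ≤ d := by
      have h1 := Submodule.finrank_quotient_add_finrank (weightSpace V χ).toSubmodule
      have h2 : 0 < Module.finrank k (weightSpace V χ).toSubmodule :=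
        Module.finrank_pos_iff.2 hχ
      have h3 : Module.finrank k (V ⧸ weightSpace V χ) =
        Module.finrank k (V ⧸ (weightSpace V χ).toSubmodule) := rfl
      omega
    have hW : ∀ w ∈ weightSpace V χ, ⁅x, w⁆ = 0 := by
      intro w hw
      have hker : derivedSeries k L 1 ≤ LieModule.ker k L (weightSpace V χ) := by
        change ⁅(⊤ : LieIdeal k L), (⊤ : LieIdeal k L)⁆ ≤ _
        rw [LieSubmodule.lieIdeal_oper_eq_span, LieSubmodule.lieSpan_le]
        rintro _ ⟨a, b, rfl⟩
        rw [SetLike.mem_coe, LieModule.mem_ker]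
        rintro ⟨u, hu⟩
        rw [mem_weightSpace] at hu
        ext
        simp [lie_lie, hu, smul_smul, mul_comm]
      have := hker hx
      rw [LieModule.mem_ker] at this
      simpa using congrArg Subtype.val (this ⟨w, hw⟩)
    obtain ⟨m, hm⟩ := ih (V ⧸ weightSpace V χ) hlt x hx
    have hpow : ∀ j : ℕ, ∀ u : V, LieSubmodule.Quotient.mk (N := weightSpace V χ) ((toEnd k L V x ^ j) u) =
        (toEnd k L (V ⧸ weightSpace V χ) x ^ j) (LieSubmodule.Quotient.mk u) := by
      intro j
      induction j with
      | zero => intro u; rfl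
      | succ j ihj => 
        intro u
        rw [pow_succ', pow_succ', Module.End.mul_apply, Module.End.mul_apply, ← ihj]
        rfl
    refine ⟨m + 1, LinearMap.ext fun u => ?_⟩
    rw [pow_succ', Module.End.mul_apply]
    refine hW _ ?_
    rw [← LieSubmodule.Quotient.mk_eq_zero]
    exact (hpow m u).trans (by rw [hm]; rfl)

open TensorProduct in
theorem isNilpotent_ad_of_mem_derivedSeries_one (L : Type*) [LieRing L] [LieAlgebra ℝ L]
    [FiniteDimensional ℝ L] [IsSolvable L] (x : L) (hx : x ∈ derivedSeries ℝ L 1) :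
    _root_.IsNilpotent (ad ℝ L x) := by
  have hx_ext : (1 : ℂ) ⊗ₜ[ℝ] x ∈ derivedSeries ℂ (ℂ ⊗[ℝ] L) 1 := by
    rw [derivedSeries_baseChange]
    exact Submodule.tmul_mem_baseChange_of_mem 1 hx
  have hbc_inj : Function.Injective (Module.End.baseChangeHom ℝ ℂ L) :=
    LinearMap.baseChangeHom_injective ℝ L ℂ
  have aux : (toEnd ℝ L L x).baseChangeHom ℝ ℂ L = (toEnd ℝ L L x).baseChange ℂ := rfl
  change _root_.IsNilpotent (toEnd ℝ L L x)
  rw [← IsNilpotent.map_iff hbc_inj, aux, ← toEnd_baseChange]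
  exact isNilpotent_toEnd_of_mem_derivedSeries_one ℂ (ℂ ⊗[ℝ] L) _ (ℂ ⊗[ℝ] L) le_rfl _ hx_ext

end LieNilp

section Nilradical

variable {E : Type*} [AddCommGroup E] [Module ℝ E] {μ : E →ₗ[ℝ] E →ₗ[ℝ] E}

/-- The vector space `E` regarded as a Lie algebra with bracket `μ`. -/
def BracketLie (_hμ : IsLieBracket μ) : Type _ := E

instance (hμ : IsLieBracket μ) : AddCommGroup (BracketLie hμ) := inferInstanceAs (AddCommGroup E)

instance (hμ : IsLieBracket μ) : Module ℝ (BracketLie hμ) := inferInstanceAs (Module ℝ E)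

instance (hμ : IsLieBracket μ) [h : FiniteDimensional ℝ E] :
    FiniteDimensional ℝ (BracketLie hμ) := h

instance (hμ : IsLieBracket μ) : LieRing (BracketLie hμ) where
  bracket x y := μ x y
  add_lie x y z := by
    exact LinearMap.map_add₂ μ x y z
  lie_add x y z := map_add (μ x) y z
  lie_self x := hμ.1 x
  leibniz_lie x y z := hμ.2 x y z

instance (hμ : IsLieBracket μ) : LieAlgebra ℝ (BracketLie hμ) where
  lie_smul t x y := map_smul (μ x) t y

/-- The identity map from `E` to the Lie algebra `BracketLie hμ`. -/
def toBracketLie (hμ : IsLieBracket μ) : E ≃ₗ[ℝ] BracketLie hμ := LinearEquiv.refl ℝ E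

theorem mem_bracketSpan {p q : Submodule ℝ E} {x y : E} (hx : x ∈ p) (hy : y ∈ q) :
    μ x y ∈ bracketSpan μ p q := Submodule.subset_span ⟨x, hx, y, hy, rfl⟩

theorem bracketSpan_le {p q r : Submodule ℝ E} :
    bracketSpan μ p q ≤ r ↔ ∀ x ∈ p, ∀ y ∈ q, μ x y ∈ r := by
  refine ⟨fun h x hx y hy => h (mem_bracketSpan hx hy), fun h => Submodule.span_le.2 ?_⟩
  rintro _ ⟨x, hx, y, hy, rfl⟩
  exact h x hx y hy

theorem bracketSpan_mono {p p' q q' : Submodule ℝ E} (h : p ≤ p') (h' : q ≤ q') :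
    bracketSpan μ p q ≤ bracketSpan μ p' q' :=
  bracketSpan_le.2 fun _ hx _ hy => mem_bracketSpan (h hx) (h' hy)

theorem lcsOn_mono {p q : Submodule ℝ E} (h : p ≤ q) (k : ℕ) : lcsOn μ p k ≤ lcsOn μ q k := by
  induction k with
  | zero => exact h
  | succ k ih => exact bracketSpan_mono h ih

theorem IsIdeal.right (hμ : IsLieBracket μ) {p : Submodule ℝ E} (hp : IsIdeal μ p) {x : E}
    (hx : x ∈ p) (y : E) : μ x y ∈ p := by
  rw [hμ.skew]
  exact p.neg_mem (hp y x hx)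

theorem lcsOn_le {p : Submodule ℝ E} (hp : ∀ x ∈ p, ∀ y ∈ p, μ x y ∈ p) (k : ℕ) :
    lcsOn μ p k ≤ p := by
  induction k with
  | zero => exact le_rfl
  | succ k ih => exact bracketSpan_le.2 fun x hx y hy => hp x hx y (ih hy)

theorem IsDeriv.map_lcsOn {G : E →ₗ[ℝ] E} (hG : IsDeriv μ G) {p : Submodule ℝ E}
    (hp : ∀ x ∈ p, G x ∈ p) (k : ℕ) : ∀ x ∈ lcsOn μ p k, G x ∈ lcsOn μ p k := by
  induction k with
  | zero => exact hp
  | succ k ih =>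
    change lcsOn μ p (k + 1) ≤ (lcsOn μ p (k + 1)).comap G
    refine bracketSpan_le.2 fun x hx y hy => ?_
    rw [Submodule.mem_comap, hG]
    exact add_mem (mem_bracketSpan (hp x hx) hy) (mem_bracketSpan hx (ih y hy))

theorem IsIdeal.lcsOn (hμ : IsLieBracket μ) {p : Submodule ℝ E} (hp : IsIdeal μ p) (k : ℕ) :
    IsIdeal μ (lcsOn μ p k) := fun x => (hμ.isDeriv x).map_lcsOn (hp x) k

theorem derSeries_one_isIdeal : IsIdeal μ (derSeries μ 1) :=
  fun _ _ _ => mem_bracketSpan (Submodule.mem_top (R := ℝ)) Submodule.mem_top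

theorem derivedSeries_le_derSeries (hμ : IsLieBracket μ) (k : ℕ) :
    (LieAlgebra.derivedSeries ℝ (BracketLie hμ) k).toSubmodule ≤
      (derSeries μ k).map (toBracketLie hμ).toLinearMap := by
  induction k with
  | zero => exact fun x _ => ⟨(toBracketLie hμ).symm x, Submodule.mem_top, by simp⟩
  | succ k ih =>
    rw [LieAlgebra.derivedSeries_def, LieAlgebra.derivedSeriesOfIdeal_succ,
      LieSubmodule.lieIdeal_oper_eq_linear_span']
    refine Submodule.span_le.2 ?_
    rintro _ ⟨a, ha, b, hb, rfl⟩
    obtain ⟨x, hx, rfl⟩ := ih ha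
    obtain ⟨y, hy, rfl⟩ := ih hb
    exact ⟨μ x y, mem_bracketSpan hx hy, rfl⟩

theorem derSeries_one_le_derivedSeries (hμ : IsLieBracket μ) {x : E} (hx : x ∈ derSeries μ 1) :
    toBracketLie hμ x ∈ LieAlgebra.derivedSeries ℝ (BracketLie hμ) 1 := by
  have : derSeries μ 1 ≤ (LieAlgebra.derivedSeries ℝ (BracketLie hμ) 1).toSubmodule.comap
      (toBracketLie hμ).toLinearMap := by
    refine bracketSpan_le.2 fun a _ b _ => ?_
    exact LieSubmodule.lie_mem_lie (I := ⊤) (N := ⊤) (x := toBracketLie hμ a)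
      (m := toBracketLie hμ b) (LieSubmodule.mem_top _) (LieSubmodule.mem_top _)
  exact this hx

theorem IsSolvableB.isSolvable (hμ : IsLieBracket μ) (hs : IsSolvableB μ) :
    LieAlgebra.IsSolvable (BracketLie hμ) := by
  obtain ⟨k, hk⟩ := hs
  rw [LieAlgebra.isSolvable_iff ℝ]
  refine ⟨k, (LieSubmodule.eq_bot_iff _).2 fun x hx => ?_⟩
  obtain ⟨y, hy, rfl⟩ := derivedSeries_le_derSeries hμ k hx
  rw [hk] at hy
  rw [(Submodule.mem_bot ℝ).1 hy, map_zero]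

variable [FiniteDimensional ℝ E]

theorem isNilpotentOn_derSeries_one (hμ : IsLieBracket μ) (hs : IsSolvableB μ) :
    IsNilpotentOn μ (derSeries μ 1) := by
  have := hs.isSolvable hμ
  set I := LieAlgebra.derivedSeries ℝ (BracketLie hμ) 1 with hI
  have hnil : LieModule.IsNilpotent I (BracketLie hμ) := by
    rw [LieModule.isNilpotent_iff_forall' (R := ℝ)]
    exact fun x => isNilpotent_ad_of_mem_derivedSeries_one (BracketLie hμ) x.1 x.2
  obtain ⟨k, hk⟩ := (LieModule.isNilpotent_iff ℝ I (BracketLie hμ)).1 hnil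
  have key : ∀ j : ℕ, lcsOn μ (derSeries μ 1) j ≤
      (LieModule.lowerCentralSeries ℝ I (BracketLie hμ) j).toSubmodule.comap
        (toBracketLie hμ).toLinearMap := by
    intro j
    induction j with
    | zero =>
      intro x _
      rw [LieModule.lowerCentralSeries_zero]
      exact LieSubmodule.mem_top (R := ℝ) (L := I) (toBracketLie hμ x)
    | succ j ih =>
      refine bracketSpan_le.2 fun a ha b hb => ?_
      rw [Submodule.mem_comap, LieSubmodule.mem_toSubmodule, LieModule.lowerCentralSeries_succ]
      exact LieSubmodule.lie_mem_lie (I := (⊤ : LieIdeal ℝ I))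
        (N := LieModule.lowerCentralSeries ℝ I (BracketLie hμ) j)
        (x := ⟨toBracketLie hμ a, derSeries_one_le_derivedSeries hμ ha⟩)
        (LieSubmodule.mem_top _) (ih hb)
  refine ⟨k, (Submodule.eq_bot_iff _).2 fun x hx => ?_⟩
  have hx' : toBracketLie hμ x ∈ LieModule.lowerCentralSeries ℝ I (BracketLie hμ) k := key k hx
  rw [hk, LieSubmodule.mem_bot] at hx'
  exact (toBracketLie hμ).map_eq_zero_iff.1 hx'

theorem IsNilradical.br_mem {n : Submodule ℝ E} (hn : IsNilradical μ n) (hμ : IsLieBracket μ)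
    (hs : IsSolvableB μ) (x y : E) : μ x y ∈ n :=
  hn.2.2 _ derSeries_one_isIdeal (isNilpotentOn_derSeries_one hμ hs)
    (mem_bracketSpan (Submodule.mem_top (R := ℝ)) Submodule.mem_top)

omit [FiniteDimensional ℝ E] in
theorem isNilpotent_of_lcsOn {n : Submodule ℝ E} (hn : IsNilpotentOn μ n) {f : E →ₗ[ℝ] E}
    (h0 : ∀ x, f x ∈ n) (h1 : ∀ k, ∀ x ∈ lcsOn μ n k, f x ∈ lcsOn μ n (k + 1)) :
    IsNilpotent f := by
  obtain ⟨K, hK⟩ := hn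
  have : ∀ k x, (f ^ (k + 1)) x ∈ lcsOn μ n k := by
    intro k
    induction k with
    | zero => intro x; rw [zero_add, pow_one]; exact h0 x
    | succ k ih => intro x; rw [pow_succ', Module.End.mul_apply]; exact h1 k _ (ih x)
  refine ⟨K + 1, LinearMap.ext fun x => ?_⟩
  have := this K x
  rw [hK] at this
  exact (Submodule.mem_bot ℝ).1 this

omit [FiniteDimensional ℝ E] in
theorem isNilpotent_br_comp (hμ : IsLieBracket μ) {n : Submodule ℝ E} (hi : IsIdeal μ n)
    (hn : IsNilpotentOn μ n) {x : E} (hx : x ∈ n) {g : E →ₗ[ℝ] E}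
    (hg : ∀ k, ∀ y ∈ lcsOn μ n k, g y ∈ lcsOn μ n k) : IsNilpotent (μ x ∘ₗ g) :=
  isNilpotent_of_lcsOn hn (fun _ => hi.right hμ hx _)
    fun k y hy => mem_bracketSpan hx (hg k y hy)

omit [FiniteDimensional ℝ E] in
theorem isNilpotent_br (hμ : IsLieBracket μ) {n : Submodule ℝ E} (hi : IsIdeal μ n)
    (hn : IsNilpotentOn μ n) {x : E} (hx : x ∈ n) : IsNilpotent (μ x) :=
  isNilpotent_br_comp hμ hi hn hx (g := LinearMap.id) fun _ _ hy => hy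

omit [FiniteDimensional ℝ E] in
theorem trace_br_eq_zero (hμ : IsLieBracket μ) {n : Submodule ℝ E} (hi : IsIdeal μ n)
    (hn : IsNilpotentOn μ n) {x : E} (hx : x ∈ n) : LinearMap.trace ℝ E (μ x) = 0 :=
  (LinearMap.isNilpotent_trace_of_isNilpotent (isNilpotent_br hμ hi hn hx)).eq_zero

omit [FiniteDimensional ℝ E] in
theorem trace_br_comp_deriv_eq_zero (hμ : IsLieBracket μ) {n : Submodule ℝ E} (hi : IsIdeal μ n)
    (hn : IsNilpotentOn μ n) {x : E} (hx : x ∈ n) {g : E →ₗ[ℝ] E} (hg : IsDeriv μ g)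
    (hgn : ∀ y ∈ n, g y ∈ n) : LinearMap.trace ℝ E (μ x ∘ₗ g) = 0 :=
  (LinearMap.isNilpotent_trace_of_isNilpotent
    (isNilpotent_br_comp hμ hi hn hx (hg.map_lcsOn hgn))).eq_zero

omit [FiniteDimensional ℝ E] in
theorem isNilpotentOn_sup_span (hμ : IsLieBracket μ) {n : Submodule ℝ E} (hi : IsIdeal μ n)
    (hn : IsNilpotentOn μ n) {x : E} (hx : IsNilpotent (μ x)) :
    IsNilpotentOn μ (n ⊔ Submodule.span ℝ {x}) := by
  obtain ⟨K, hK⟩ := hn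
  obtain ⟨N, hN⟩ := hx
  set q := n ⊔ Submodule.span ℝ {x} with hq
  have hmem : ∀ z ∈ q, ∃ w ∈ n, ∃ t : ℝ, z = w + t • x := by
    intro z hz
    obtain ⟨w, hw, v, hv, rfl⟩ := Submodule.mem_sup.1 hz
    obtain ⟨t, rfl⟩ := Submodule.mem_span_singleton.1 hv
    exact ⟨w, hw, t, rfl⟩
  have hnn : ∀ a ∈ n, ∀ b ∈ n, μ a b ∈ n := fun a _ b hb => hi a b hb
  have hL := fun k => hi.lcsOn hμ k
  have step : ∀ k m, lcsOn μ q m ≤ lcsOn μ n k → ∀ j,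
      lcsOn μ q (m + j) ≤ lcsOn μ n (k + 1) ⊔ (lcsOn μ n k).map (μ x ^ j) := by
    intro k m hm j
    induction j with
    | zero => exact hm.trans (by simp [Module.End.one_eq_id])
    | succ j ih =>
      refine bracketSpan_le.2 fun z hz y hy => ?_
      obtain ⟨w, hw, t, rfl⟩ := hmem z hz
      obtain ⟨u, hu, v, hv, rfl⟩ := Submodule.mem_sup.1 (ih hy)
      obtain ⟨v', hv', rfl⟩ := hv
      have hpow : ∀ j, (μ x ^ j) v' ∈ lcsOn μ n k := by
        intro j
        induction j with
        | zero => exact hv'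
        | succ j ih => rw [pow_succ', Module.End.mul_apply]; exact hL k _ _ ih
      have e : μ (w + t • x) (u + (μ x ^ j) v') =
          (μ (w + t • x) u + μ w ((μ x ^ j) v')) + t • (μ x ^ (j + 1)) v' := by
        rw [pow_succ', Module.End.mul_apply]
        simp only [map_add, map_smul, LinearMap.add_apply, LinearMap.smul_apply]
        abel
      rw [e]
      exact Submodule.add_mem_sup
        (add_mem (hL (k + 1) _ _ hu) (mem_bracketSpan hw (hpow j)))
        (Submodule.smul_mem _ t ⟨v', hv', rfl⟩)
  have main : ∀ k, ∃ m, lcsOn μ q m ≤ lcsOn μ n k := by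
    intro k
    induction k with
    | zero =>
      refine ⟨1, bracketSpan_le.2 fun z hz y hy => ?_⟩
      obtain ⟨w, hw, t, rfl⟩ := hmem z hz
      obtain ⟨v, hv, s, rfl⟩ := hmem y hy
      have e : μ (w + t • x) (v + s • x) = μ (w + t • x) v + s • μ w x := by
        simp only [map_add, map_smul, LinearMap.add_apply, LinearMap.smul_apply, hμ.1]
        abel_nf
        simp
      rw [e]
      exact add_mem (hi _ _ hv) (n.smul_mem _ (hi.right hμ hw _))
    | succ k ih =>
      obtain ⟨m, hm⟩ := ih
      refine ⟨m + N, (step k m hm N).trans ?_⟩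
      rw [hN]
      simp
  obtain ⟨m, hm⟩ := main K
  exact ⟨m, by rwa [hK, le_bot_iff] at hm⟩

theorem IsNilradical.mem_of_isNilpotent {n : Submodule ℝ E} (hn : IsNilradical μ n)
    (hμ : IsLieBracket μ) (hs : IsSolvableB μ) {x : E} (hx : IsNilpotent (μ x)) : x ∈ n := by
  refine hn.2.2 (n ⊔ Submodule.span ℝ {x}) ?_ (isNilpotentOn_sup_span hμ hn.1 hn.2.1 hx)
    (Submodule.mem_sup_right (Submodule.mem_span_singleton_self x))
  exact fun y z _ => Submodule.mem_sup_left (hn.br_mem hμ hs y z)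

theorem IsDeriv.isNilpotent_br_of_eigenvector {G : E →ₗ[ℝ] E} (hG : IsDeriv μ G) {x : E} {t : ℝ}
    (ht : t ≠ 0) (hx : G x = t • x) : IsNilpotent (μ x) := by
  let Φ : Module.End ℝ (Module.End ℝ E) :=
    LinearMap.mulLeft ℝ (G : Module.End ℝ E) - LinearMap.mulRight ℝ (G : Module.End ℝ E)
  have hΦ : ∀ T S : Module.End ℝ E, Φ (T * S) = Φ T * S + T * Φ S := by
    intro T S
    simp only [Φ, LinearMap.sub_apply, LinearMap.mulLeft_apply, LinearMap.mulRight_apply]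
    noncomm_ring
  have h1 : Φ (μ x) = t • μ x := by
    have := hG.comp_br x
    rw [hx, map_smul] at this
    change G ∘ₗ μ x - μ x ∘ₗ G = _
    rw [this, add_sub_cancel_right]
  have hk : ∀ k : ℕ, Φ ((μ x : Module.End ℝ E) ^ k) = (k * t : ℝ) • (μ x : Module.End ℝ E) ^ k := by
    intro k
    induction k with
    | zero => simp [Φ]
    | succ k ih =>
      rw [pow_succ, hΦ, ih, h1, smul_mul_assoc, mul_smul_comm, ← add_smul]
      push_cast
      ring_nf
  by_contra hnil
  have hne : ∀ k, (μ x : Module.End ℝ E) ^ k ≠ 0 := fun k hk => hnil ⟨k, hk⟩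
  have hev : ∀ k : ℕ, Φ.HasEigenvalue (k * t) := fun k =>
    Module.End.hasEigenvalue_of_hasEigenvector
      (Module.End.hasEigenvector_iff.2 ⟨Module.End.mem_eigenspace_iff.2 (hk k), hne k⟩)
  have hfin := Module.End.finite_hasEigenvalue (f := Φ)
  refine Set.infinite_of_injective_forall_mem (f := fun k : ℕ => (k * t : ℝ)) ?_ hev hfin
  intro a b hab
  exact_mod_cast mul_right_cancel₀ ht hab

end Nilradical

section SymmetricDerivation

variable {E : Type*} [NormedAddCommGroup E] [InnerProductSpace ℝ E] [FiniteDimensional ℝ E]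
  {μ : E →ₗ[ℝ] E →ₗ[ℝ] E} {n : Submodule ℝ E}

theorem IsNilradical.deriv_apply_mem (hn : IsNilradical μ n) (hμ : IsLieBracket μ)
    (hs : IsSolvableB μ) {G : E →ₗ[ℝ] E} (hG : IsDeriv μ G) (hsym : G.IsSymmetric) (x : E) :
    G x ∈ n := by
  have h : ∀ i, G (hsym.eigenvectorBasis rfl i) ∈ n := by
    intro i
    have hi := hsym.apply_eigenvectorBasis rfl i
    by_cases h0 : hsym.eigenvalues rfl i = 0
    · rw [hi, h0]; simp
    · rw [hi]
      exact n.smul_mem _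
        (hn.mem_of_isNilpotent hμ hs (hG.isNilpotent_br_of_eigenvector h0 hi))
  rw [← (hsym.eigenvectorBasis rfl).sum_repr x, map_sum]
  exact sum_mem fun i _ => by rw [map_smul]; exact n.smul_mem _ (h i)

theorem IsNilradical.deriv_orthogonal (hn : IsNilradical μ n) (hμ : IsLieBracket μ)
    (hs : IsSolvableB μ) {G : E →ₗ[ℝ] E} (hG : IsDeriv μ G) (hsym : G.IsSymmetric) {A : E}
    (hA : A ∈ nᗮ) : G A = 0 := by
  refine ext_inner_right ℝ fun v => ?_
  rw [hsym, inner_zero_left, real_inner_comm]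
  exact hA _ (hn.deriv_apply_mem hμ hs hG hsym v)

end SymmetricDerivation

section Projections

variable {E : Type*} [NormedAddCommGroup E] [InnerProductSpace ℝ E] [FiniteDimensional ℝ E]
  {p : Submodule ℝ E}

theorem projL_mem (p : Submodule ℝ E) (x : E) : projL p x ∈ p := Subtype.property _

theorem projL_of_mem {x : E} (hx : x ∈ p) : projL p x = x :=
  Submodule.starProjection_eq_self_iff.2 hx

theorem projL_of_orthogonal {x : E} (hx : x ∈ pᗮ) : projL p x = 0 :=
  (Submodule.starProjection_apply_eq_zero_iff p).2 hx

theorem projL_add_orthogonal (p : Submodule ℝ E) (x : E) : projL p x + projL pᗮ x = x :=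
  p.starProjection_add_starProjection_orthogonal x

theorem projL_isSymmetric (p : Submodule ℝ E) : (projL p).IsSymmetric :=
  fun x y => Submodule.inner_starProjection_left_eq_right p x y

theorem transp_projL (p : Submodule ℝ E) : transp (projL p) = projL p :=
  transp_eq_self_iff.2 (projL_isSymmetric p)

theorem projL_comp_self (p : Submodule ℝ E) : projL p ∘ₗ projL p = projL p :=
  LinearMap.ext fun x => projL_of_mem (projL_mem p x)

theorem projL_comp {G : E →ₗ[ℝ] E} (hG : ∀ x, G x ∈ p) : projL p ∘ₗ G = G :=
  LinearMap.ext fun x => projL_of_mem (hG x)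

theorem comp_projL {G : E →ₗ[ℝ] E} (hG : ∀ x ∈ pᗮ, G x = 0) : G ∘ₗ projL p = G := by
  refine LinearMap.ext fun x => ?_
  conv_rhs => rw [← projL_add_orthogonal p x, map_add, hG _ (projL_mem _ x), add_zero]
  rfl

theorem transp_apply_orthogonal {G : E →ₗ[ℝ] E} (hG : ∀ x, G x ∈ p) {x : E} (hx : x ∈ pᗮ) :
    transp G x = 0 := by
  refine ext_inner_right ℝ fun v => ?_
  rw [transp_inner_left, inner_zero_left, real_inner_comm]
  exact hx _ (hG v)

theorem transp_apply_mem {G : E →ₗ[ℝ] E} (hG : ∀ x ∈ pᗮ, G x = 0) (x : E) : transp G x ∈ p := by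
  rw [← Submodule.orthogonal_orthogonal p]
  intro v hv
  rw [transp_inner_right, hG v hv, inner_zero_left]

/-- An orthonormal basis of `E` adapted to the decomposition `p ⊕ pᗮ`. -/
def adaptedONB (p : Submodule ℝ E) :
    OrthonormalBasis (Fin (Module.finrank ℝ p) ⊕ Fin (Module.finrank ℝ (pᗮ : Submodule ℝ E))) ℝ E :=
  ((stdOrthonormalBasis ℝ p).prod (stdOrthonormalBasis ℝ (pᗮ : Submodule ℝ E))).map
    p.orthogonalDecomposition.symm

theorem adaptedONB_inl (p : Submodule ℝ E) (i : Fin (Module.finrank ℝ p)) :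
    adaptedONB p (Sum.inl i) = onbOf p i := by
  rw [adaptedONB, OrthonormalBasis.map_apply, LinearIsometryEquiv.symm_apply_eq]
  have h : onbOf p i ∈ p := Subtype.property _
  rw [Submodule.orthogonalDecomposition_apply]
  simp only [OrthonormalBasis.prod_apply, Sum.elim_inl, Function.comp_apply]
  refine congrArg (WithLp.toLp 2) (Prod.ext (Subtype.ext ?_) (Subtype.ext ?_))
  · exact (projL_of_mem h).symm
  · exact (projL_of_orthogonal (p.le_orthogonal_orthogonal h)).symm

theorem adaptedONB_inr (p : Submodule ℝ E) (i : Fin (Module.finrank ℝ (pᗮ : Submodule ℝ E))) :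
    adaptedONB p (Sum.inr i) = onbOf pᗮ i := by
  rw [adaptedONB, OrthonormalBasis.map_apply, LinearIsometryEquiv.symm_apply_eq]
  have h : onbOf pᗮ i ∈ pᗮ := Subtype.property _
  rw [Submodule.orthogonalDecomposition_apply]
  simp only [OrthonormalBasis.prod_apply, Sum.elim_inr, Function.comp_apply]
  refine congrArg (WithLp.toLp 2) (Prod.ext (Subtype.ext ?_) (Subtype.ext ?_))
  · exact (projL_of_orthogonal h).symm
  · exact (projL_of_mem h).symm

theorem onbOf_mem (p : Submodule ℝ E) (i : Fin (Module.finrank ℝ p)) : onbOf p i ∈ p :=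
  Subtype.property _

theorem sum_adaptedONB {M : Type*} [AddCommMonoid M] (p : Submodule ℝ E) (f : E → M) :
    ∑ i, f (adaptedONB p i) = ∑ i, f (onbOf p i) + ∑ k, f (onbOf pᗮ k) := by
  simp only [Fintype.sum_sum_type, adaptedONB_inl, adaptedONB_inr]

/-- The trace form `⟨f, g⟩ = tr(gᵗ f)` on operators. -/
def hsInner (f g : E →ₗ[ℝ] E) : ℝ := LinearMap.trace ℝ E (transp g ∘ₗ f)

theorem hsInner_eq_sum {ι : Type*} [Fintype ι] (b : OrthonormalBasis ι ℝ E) (f g : E →ₗ[ℝ] E) :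
    hsInner f g = ∑ i, ⟪f (b i), g (b i)⟫ := (sum_inner_eq_trace b f g).symm

theorem hsInner_comm (f g : E →ₗ[ℝ] E) : hsInner f g = hsInner g f := by
  simp only [hsInner_eq_sum (stdONB E), real_inner_comm]

theorem hsInner_transp (f g : E →ₗ[ℝ] E) : hsInner (transp f) (transp g) = hsInner f g := by
  rw [hsInner_comm, hsInner, hsInner, transp_transp, LinearMap.trace_comp_comm']

theorem hsInner_self_nonneg (f : E →ₗ[ℝ] E) : 0 ≤ hsInner f f := trace_transp_comp_self_nonneg f

theorem eq_zero_of_hsInner_self {f : E →ₗ[ℝ] E} (h : hsInner f f = 0) : f = 0 :=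
  eq_zero_of_trace_transp_comp_self h

/-- The operators on `E` form a Euclidean space for the trace form. -/
abbrev hsCore : InnerProductSpace.Core ℝ (E →ₗ[ℝ] E) where
  inner f g := hsInner f g
  conj_inner_symm f g := by simp [hsInner_comm]
  re_inner_nonneg f := by simpa using hsInner_self_nonneg f
  add_left f g k := by simp [hsInner, LinearMap.comp_add]
  smul_left f g r := by simp [hsInner, LinearMap.comp_smul]
  definite f h := eq_zero_of_hsInner_self h

theorem exists_hs_orthonormal (V : Submodule ℝ (E →ₗ[ℝ] E)) :
    ∃ (m : ℕ) (G : Fin m → E →ₗ[ℝ] E), V = Submodule.span ℝ (Set.range G) ∧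
      (∀ T ∈ V, hsInner T T = ∑ i, hsInner (G i) T ^ 2) ∧
      ∀ T, ∑ i, hsInner (G i) T ^ 2 ≤ hsInner T T := by
  let _ : NormedAddCommGroup (E →ₗ[ℝ] E) := (hsCore (E := E)).toNormedAddCommGroup
  let _ : InnerProductSpace ℝ (E →ₗ[ℝ] E) := InnerProductSpace.ofCore (hsCore (E := E)).toCore
  have hin : ∀ f g : E →ₗ[ℝ] E, inner ℝ f g = hsInner f g := fun _ _ => rfl
  let b := stdOrthonormalBasis ℝ V
  refine ⟨_, fun i => (b i : E →ₗ[ℝ] E), ?_, ?_, ?_⟩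
  · have h := congrArg (Submodule.map V.subtype) b.toBasis.span_eq
    rw [Submodule.map_top, Submodule.range_subtype, Submodule.map_span, ← Set.range_comp] at h
    exact h.symm
  · intro T hT
    have h := b.sum_sq_norm_inner_right ⟨T, hT⟩
    rw [← real_inner_self_eq_norm_sq] at h
    simp only [Real.norm_eq_abs, sq_abs] at h
    exact h.symm
  · intro T
    have hb : Orthonormal ℝ fun i => (b i : E →ₗ[ℝ] E) :=
      b.orthonormal.comp_linearIsometry V.subtypeₗᵢ
    have h := hb.sum_inner_products_le T (s := Finset.univ)
    rw [← real_inner_self_eq_norm_sq] at h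
    simp only [Real.norm_eq_abs, sq_abs] at h
    exact h

end Projections

section Decomposition

variable {E : Type*} [NormedAddCommGroup E] [InnerProductSpace ℝ E] [FiniteDimensional ℝ E]
  {μ : E →ₗ[ℝ] E →ₗ[ℝ] E}

theorem binner_eq_sum {ι : Type*} [Fintype ι] (b : OrthonormalBasis ι ℝ E)
    (α β : E →ₗ[ℝ] E →ₗ[ℝ] E) : binner α β = ∑ i, ∑ j, ⟪α (b i) (b j), β (b i) (b j)⟫ := by
  have h1 : ∀ x, ∑ j, ⟪α x (stdONB E j), β x (stdONB E j)⟫ = ∑ j, ⟪α x (b j), β x (b j)⟫ :=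
    fun x => by rw [← hsInner_eq_sum, ← hsInner_eq_sum]
  have h2 : ∀ y, ∑ i, ⟪α (stdONB E i) y, β (stdONB E i) y⟫ = ∑ i, ⟪α (b i) y, β (b i) y⟫ :=
    fun y => by
      have := (hsInner_eq_sum (stdONB E) (α.flip y) (β.flip y)).symm.trans
        (hsInner_eq_sum b (α.flip y) (β.flip y))
      simpa only [LinearMap.flip_apply] using this
  simp only [binner, h1]
  rw [Finset.sum_comm]
  simp only [h2]
  rw [Finset.sum_comm]

theorem hsInner_comp_projL (p : Submodule ℝ E) (f g : E →ₗ[ℝ] E) :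
    hsInner (f ∘ₗ projL p) (g ∘ₗ projL p) = ∑ i, ⟪f (onbOf p i), g (onbOf p i)⟫ := by
  rw [hsInner_eq_sum (adaptedONB p),
    sum_adaptedONB p fun x => ⟪(f ∘ₗ projL p) x, (g ∘ₗ projL p) x⟫]
  simp only [LinearMap.comp_apply, projL_of_mem (onbOf_mem p _),
    projL_of_orthogonal (onbOf_mem pᗮ _), map_zero, inner_zero_left, Finset.sum_const_zero,
    add_zero]

theorem binner_self_split (p : Submodule ℝ E) {α : E →ₗ[ℝ] E →ₗ[ℝ] E}
    (hα : ∀ x y, α x y = - α y x) :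
    binner α α = ∑ i, hsInner (α (onbOf p i) ∘ₗ projL p) (α (onbOf p i) ∘ₗ projL p) +
      2 * ∑ k, hsInner (α (onbOf pᗮ k) ∘ₗ projL p) (α (onbOf pᗮ k) ∘ₗ projL p) +
      ∑ k, hsInner (α (onbOf pᗮ k) ∘ₗ projL pᗮ) (α (onbOf pᗮ k) ∘ₗ projL pᗮ) := by
  rw [binner_eq_sum (adaptedONB p),
    sum_adaptedONB p fun x => ∑ j, ⟪α x (adaptedONB p j), α x (adaptedONB p j)⟫]
  have h : ∀ x, ∑ j, ⟪α x (adaptedONB p j), α x (adaptedONB p j)⟫ =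
      ∑ j, ⟪α x (onbOf p j), α x (onbOf p j)⟫ + ∑ j, ⟪α x (onbOf pᗮ j), α x (onbOf pᗮ j)⟫ :=
    fun x => sum_adaptedONB p fun y => ⟪α x y, α x y⟫
  simp only [h, hsInner_comp_projL, Finset.sum_add_distrib]
  have h2 : ∑ i, ∑ j, ⟪α (onbOf p i) (onbOf pᗮ j), α (onbOf p i) (onbOf pᗮ j)⟫ =
      ∑ k, ∑ i, ⟪α (onbOf pᗮ k) (onbOf p i), α (onbOf pᗮ k) (onbOf p i)⟫ := by
    rw [Finset.sum_comm]
    refine Finset.sum_congr rfl fun k _ => Finset.sum_congr rfl fun i _ => ?_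
    rw [hα (onbOf p i), inner_neg_neg]
  rw [h2]
  ring

omit [FiniteDimensional ℝ E] in
theorem piAct_skew (hμ : IsLieBracket μ) (G : E →ₗ[ℝ] E) (x y : E) :
    piAct G μ x y = - piAct G μ y x := by
  simp only [piAct_apply]
  rw [hμ.skew x y, hμ.skew (G x) y, hμ.skew x (G y), map_neg]
  abel

variable {n : Submodule ℝ E}

theorem Bop_apply_eq_zero (hμ : IsLieBracket μ) (hi : IsIdeal μ n) (hn : IsNilpotentOn μ n)
    {x : E} (hx : x ∈ n) : Bop μ x = 0 := by
  refine ext_inner_right ℝ fun y => ?_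
  rw [inner_Bop, inner_zero_left]
  exact trace_br_comp_deriv_eq_zero hμ hi hn hx (hμ.isDeriv y) (hi y)

theorem Bop_mem_orthogonal (hμ : IsLieBracket μ) (hi : IsIdeal μ n) (hn : IsNilpotentOn μ n)
    (x : E) : Bop μ x ∈ nᗮ := by
  intro y hy
  rw [← Bop_isSymmetric μ y x, Bop_apply_eq_zero hμ hi hn hy, inner_zero_left]

theorem binner_piAct_transp_self (hμ : IsLieBracket μ) (hi : IsIdeal μ n)
    (hn : IsNilpotentOn μ n) {c : ℝ} {F G : E →ₗ[ℝ] E}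
    (hR : Rop μ = c • LinearMap.id + F + (1 / 2 : ℝ) • Bop μ) (hFG : F ∘ₗ G = G ∘ₗ F)
    (hG : ∀ x, G x ∈ n) (hG' : ∀ x ∈ nᗮ, G x = 0) :
    binner (piAct (transp G) μ) (piAct (transp G) μ) = binner (piAct G μ) (piAct G μ) := by
  have h := trace_Rop_commutator hμ G
  have h0 : LinearMap.trace ℝ E (Rop μ ∘ₗ (G ∘ₗ transp G - transp G ∘ₗ G)) = 0 := by
    have hB1 : Bop μ ∘ₗ G = 0 :=
      LinearMap.ext fun x => Bop_apply_eq_zero hμ hi hn (hG x)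
    have hB2 : G ∘ₗ Bop μ = 0 :=
      LinearMap.ext fun x => hG' _ (Bop_mem_orthogonal hμ hi hn x)
    have e1 : LinearMap.trace ℝ E (F ∘ₗ (G ∘ₗ transp G)) =
        LinearMap.trace ℝ E (F ∘ₗ (transp G ∘ₗ G)) := by
      rw [← LinearMap.comp_assoc, hFG, LinearMap.comp_assoc, LinearMap.trace_comp_comm',
        LinearMap.comp_assoc]
    have e2 : Bop μ ∘ₗ (G ∘ₗ transp G) = 0 := by
      rw [← LinearMap.comp_assoc, hB1, LinearMap.zero_comp]
    have e3 : LinearMap.trace ℝ E (Bop μ ∘ₗ (transp G ∘ₗ G)) = 0 := by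
      rw [← LinearMap.comp_assoc, LinearMap.trace_comp_comm', ← LinearMap.comp_assoc, hB2,
        LinearMap.zero_comp, map_zero]
    have e4 : LinearMap.trace ℝ E (G ∘ₗ transp G) = LinearMap.trace ℝ E (transp G ∘ₗ G) :=
      LinearMap.trace_comp_comm' _ _
    rw [hR, LinearMap.comp_sub]
    simp only [LinearMap.add_comp, LinearMap.smul_comp, LinearMap.id_comp, map_sub, map_add,
      map_smul, e1, e2, e3, e4, map_zero]
    ring
  linarith

end Decomposition

section Center

variable {E : Type*} [AddCommGroup E] [Module ℝ E] {μ : E →ₗ[ℝ] E →ₗ[ℝ] E}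

/-- The centralizer of the subspace `p` inside `p`. -/
def centerOn (μ : E →ₗ[ℝ] E →ₗ[ℝ] E) (p : Submodule ℝ E) : Submodule ℝ E where
  carrier := {x | x ∈ p ∧ ∀ y ∈ p, μ x y = 0}
  add_mem' ha hb := ⟨add_mem ha.1 hb.1, fun y hy => by
    rw [map_add, LinearMap.add_apply, ha.2 y hy, hb.2 y hy, add_zero]⟩
  zero_mem' := ⟨zero_mem _, fun y _ => by rw [map_zero, LinearMap.zero_apply]⟩
  smul_mem' c x hx := ⟨p.smul_mem c hx.1, fun y hy => by
    rw [map_smul, LinearMap.smul_apply, hx.2 y hy, smul_zero]⟩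

theorem centerOn_ne_bot (hμ : IsLieBracket μ) {p : Submodule ℝ E}
    (hp : ∀ x ∈ p, ∀ y ∈ p, μ x y ∈ p) (hn : IsNilpotentOn μ p) (h0 : p ≠ ⊥) :
    centerOn μ p ≠ ⊥ := by
  classical
  intro hc
  have hk := Nat.find_spec hn
  rcases hK : Nat.find hn with _ | k
  · rw [hK] at hk
    exact h0 hk
  · rw [hK] at hk
    have hk' : lcsOn μ p k ≠ ⊥ := Nat.find_min hn (by omega)
    refine hk' ((Submodule.eq_bot_iff _).2 fun x hx => ?_)
    have : x ∈ centerOn μ p := ⟨lcsOn_le hp k hx, fun y hy => by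
      have h := mem_bracketSpan (μ := μ) hy hx
      change μ y x ∈ lcsOn μ p (k + 1) at h
      rw [hk, Submodule.mem_bot] at h
      rw [hμ.skew, h, neg_zero]⟩
    rwa [hc, Submodule.mem_bot] at this

end Center

section NormalNilpotent

variable {E : Type*} [NormedAddCommGroup E] [InnerProductSpace ℝ E] [FiniteDimensional ℝ E]

theorem eq_zero_of_isSymmetric_of_isNilpotent {M : E →ₗ[ℝ] E} (hM : M.IsSymmetric)
    (hn : IsNilpotent M) : M = 0 := by
  apply eq_zero_of_trace_transp_comp_self
  rw [transp_eq_self_iff.2 hM]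
  exact (LinearMap.isNilpotent_trace_of_isNilpotent
    ((Commute.refl M).isNilpotent_mul_right hn)).eq_zero

theorem eq_zero_of_normal_of_isNilpotent {G : E →ₗ[ℝ] E}
    (hG : transp G ∘ₗ G = G ∘ₗ transp G) (hn : IsNilpotent G) : G = 0 := by
  apply eq_zero_of_trace_transp_comp_self
  have hc : Commute (transp G : Module.End ℝ E) G := hG
  exact (LinearMap.isNilpotent_trace_of_isNilpotent (hc.isNilpotent_mul_left hn)).eq_zero

end NormalNilpotent

section Abelian

variable {E : Type*} [NormedAddCommGroup E] [InnerProductSpace ℝ E] [FiniteDimensional ℝ E]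
  {μ : E →ₗ[ℝ] E →ₗ[ℝ] E} {n : Submodule ℝ E}

/-- A central ideal of `n` on which the derivation `F` vanishes is trivial. -/
theorem eq_bot_of_central (hμ : IsLieBracket μ) (hi : IsIdeal μ n) (hn : IsNilpotentOn μ n)
    {c : ℝ} (hc : c < 0) {F : E →ₗ[ℝ] E}
    (hR : Rop μ = c • LinearMap.id + F + (1 / 2 : ℝ) • Bop μ) {Z : Submodule ℝ E} (hZn : Z ≤ n)
    (hF : ∀ x ∈ Z, F x = 0) (hZi : IsIdeal μ Z) (hZ : ∀ x ∈ Z, ∀ y ∈ n, μ x y = 0) : Z = ⊥ := by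
  have h1 := trace_Rop_comp hμ (projL Z)
  have e : Rop μ ∘ₗ projL Z = c • projL Z := by
    refine LinearMap.ext fun x => ?_
    have hx := projL_mem Z x
    rw [hR]
    simp [hF _ hx, Bop_apply_eq_zero hμ hi hn (hZn hx)]
  have h2 : 0 ≤ binner (piAct (projL Z) μ) μ := by
    rw [binner_eq_sum (adaptedONB Z)]
    refine Finset.sum_nonneg fun i _ => Finset.sum_nonneg fun j _ => ?_
    rw [piAct_apply]
    rcases i with i | i <;> rcases j with j | j <;>
      simp only [adaptedONB_inl, adaptedONB_inr, projL_of_mem (onbOf_mem Z _),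
        projL_of_orthogonal (onbOf_mem Zᗮ _), map_zero, LinearMap.zero_apply, sub_zero]
    · rw [hZ _ (onbOf_mem Z _) _ (hZn (onbOf_mem Z _))]
      simp
    · rw [projL_of_mem (hZi.right hμ (onbOf_mem Z _) _), sub_self, inner_zero_left]
    · rw [projL_of_mem (hZi _ _ (onbOf_mem Z _)), sub_self, inner_zero_left]
    · rw [← projL_comp_self, LinearMap.comp_apply, projL_isSymmetric]
      exact real_inner_self_nonneg
  have h3 := trace_transp_comp_self_nonneg (projL Z)
  have h4 : transp (projL Z) ∘ₗ projL Z = projL Z := by rw [transp_projL, projL_comp_self]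
  rw [h4] at h3
  rw [e, map_smul, smul_eq_mul] at h1
  have h5 : LinearMap.trace ℝ E (projL Z) = 0 := by nlinarith
  have h6 : projL Z = 0 := by
    apply eq_zero_of_trace_transp_comp_self
    rw [h4, h5]
  refine (Submodule.eq_bot_iff _).2 fun x hx => ?_
  rw [← projL_of_mem hx, h6, LinearMap.zero_apply]

/-- If `ad X|ₙ` for `X ∈ Z` has the properties below, then its transpose is a derivation
of `n`. -/
theorem piAct_transp_eq_zero (hμ : IsLieBracket μ) (hi : IsIdeal μ n) (hn : IsNilpotentOn μ n)
    {c : ℝ} {F : E →ₗ[ℝ] E} (hR : Rop μ = c • LinearMap.id + F + (1 / 2 : ℝ) • Bop μ)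
    (hs : ∀ x y, μ x y ∈ n) (hF : IsDeriv μ F) (hFn : ∀ x, F x ∈ n) (hFa : ∀ x ∈ nᗮ, F x = 0)
    {Z : Submodule ℝ E} (hFZ : ∀ x ∈ Z, F x = 0) (hZa : ∀ A ∈ nᗮ, ∀ x ∈ Z, μ A x ∈ Z)
    (hZaa : ∀ x ∈ Z, ∀ A ∈ nᗮ, ∀ A' ∈ nᗮ, μ x (μ A A') = 0) :
    ∀ X ∈ Z, ∀ x ∈ n, ∀ y ∈ n, piAct (transp (adOn μ n X)) μ x y = 0 := by
  let L : E →ₗ[ℝ] (E →ₗ[ℝ] E) := (LinearMap.lcomp ℝ E (projL n)) ∘ₗ μ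
  have hL : ∀ X, L X = adOn μ n X := fun X => rfl
  have had : ∀ X x, adOn μ n X x = μ X (projL n x) := fun X x => rfl
  have hFP : ∀ x, projL n (F x) = F (projL n x) := fun x => by
    have h1 := LinearMap.congr_fun (comp_projL hFa) x
    rw [projL_of_mem (hFn x)]
    exact h1.symm
  have gmem : ∀ X x, adOn μ n X x ∈ n := fun X x => hi _ _ (projL_mem n x)
  have gorth : ∀ X, ∀ x ∈ nᗮ, adOn μ n X x = 0 := fun X x hx => by
    rw [had, projL_of_orthogonal hx, map_zero]
  have gF : ∀ X ∈ Z, F ∘ₗ adOn μ n X = adOn μ n X ∘ₗ F := fun X hX => LinearMap.ext fun x => by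
    rw [LinearMap.comp_apply, LinearMap.comp_apply, had, had, hF, hFZ X hX, hFP, map_zero,
      LinearMap.zero_apply, zero_add]
  have gaa : ∀ X ∈ Z, ∀ A ∈ nᗮ, ∀ x, μ X (μ A x) = μ X (μ A (projL n x)) := fun X hX A hA x => by
    conv_lhs => rw [← projL_add_orthogonal n x, map_add, map_add,
      hZaa X hX A hA _ (projL_mem nᗮ x), add_zero]
  have comm : ∀ X ∈ Z, ∀ A ∈ nᗮ,
      μ A ∘ₗ adOn μ n X - adOn μ n X ∘ₗ μ A = adOn μ n (μ A X) := fun X hX A hA =>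
    LinearMap.ext fun x => by
      simp only [LinearMap.sub_apply, LinearMap.comp_apply, had]
      rw [projL_of_mem (hs _ _), gaa X hX A hA, hμ.2 A X]
      abel
  have α_nn : ∀ X, ∀ x ∈ n, ∀ y ∈ n, piAct (adOn μ n X) μ x y = 0 := fun X x hx y hy => by
    rw [piAct_apply]
    simp only [had]
    rw [projL_of_mem hx, projL_of_mem hy, projL_of_mem (hs _ _), hμ.2 X x y]
    abel
  have α_aa : ∀ X ∈ Z, ∀ x ∈ nᗮ, ∀ y ∈ nᗮ, piAct (adOn μ n X) μ x y = 0 := fun X hX x hx y hy => by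
    rw [piAct_apply]
    simp only [had]
    rw [projL_of_orthogonal hx, projL_of_orthogonal hy, projL_of_mem (hs _ _), hZaa X hX x hx y hy]
    simp
  have α_an : ∀ X ∈ Z, ∀ A ∈ nᗮ, piAct (adOn μ n X) μ A ∘ₗ projL n =
      - (μ A ∘ₗ adOn μ n X - adOn μ n X ∘ₗ μ A) := fun X hX A hA => LinearMap.ext fun x => by
    simp only [LinearMap.sub_apply, LinearMap.comp_apply, LinearMap.neg_apply, piAct_apply, had]
    rw [projL_of_orthogonal hA, projL_of_mem (hs _ _), projL_of_mem (hs _ _),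
      projL_of_mem (projL_mem n x), gaa X hX A hA x]
    simp
  have β_an : ∀ X, ∀ A ∈ nᗮ, piAct (transp (adOn μ n X)) μ A ∘ₗ projL n =
      - ((μ A ∘ₗ transp (adOn μ n X) - transp (adOn μ n X) ∘ₗ μ A) ∘ₗ projL n) :=
    fun X A hA => LinearMap.ext fun x => by
      simp only [LinearMap.sub_apply, LinearMap.comp_apply, LinearMap.neg_apply, piAct_apply]
      rw [transp_apply_orthogonal (gmem X) hA]
      simp
  have hsneg : ∀ f : E →ₗ[ℝ] E, hsInner (-f) (-f) = hsInner f f := fun f => by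
    simp [hsInner_eq_sum (stdONB E)]
  obtain ⟨m, G, hVG, hV, hB⟩ := exists_hs_orthonormal (Z.map L)
  have hG : ∀ i, ∃ X ∈ Z, adOn μ n X = G i := fun i => by
    have : G i ∈ Z.map L := hVG ▸ Submodule.subset_span ⟨i, rfl⟩
    exact this
  choose X hXZ hXG using hG
  let C : Fin (Module.finrank ℝ (nᗮ : Submodule ℝ E)) → (E →ₗ[ℝ] E) → (E →ₗ[ℝ] E) :=
    fun k T => μ (onbOf nᗮ k) ∘ₗ T - T ∘ₗ μ (onbOf nᗮ k)
  have hα : ∀ i, binner (piAct (G i) μ) (piAct (G i) μ) =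
      2 * ∑ k, hsInner (C k (G i)) (C k (G i)) := by
    intro i
    rw [binner_self_split n (piAct_skew hμ _), ← hXG i]
    have h1 : ∀ l, piAct (adOn μ n (X i)) μ (onbOf n l) ∘ₗ projL n = 0 := fun l =>
      LinearMap.ext fun x => α_nn _ _ (onbOf_mem n l) _ (projL_mem n x)
    have h2 : ∀ l, piAct (adOn μ n (X i)) μ (onbOf nᗮ l) ∘ₗ projL nᗮ = 0 := fun l =>
      LinearMap.ext fun x => α_aa _ (hXZ i) _ (onbOf_mem nᗮ l) _ (projL_mem nᗮ x)
    simp only [h1, h2, α_an _ (hXZ i) _ (onbOf_mem nᗮ _), hsneg]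
    simp [hsInner, C]
  have hβ : ∀ i, ∑ l, hsInner (piAct (transp (G i)) μ (onbOf n l) ∘ₗ projL n)
        (piAct (transp (G i)) μ (onbOf n l) ∘ₗ projL n) +
      2 * ∑ k, ∑ j, hsInner (G i) (C k (G j)) ^ 2 ≤
      binner (piAct (transp (G i)) μ) (piAct (transp (G i)) μ) := by
    intro i
    rw [binner_self_split n (piAct_skew hμ _)]
    have h1 : ∀ k, ∑ j, hsInner (G i) (C k (G j)) ^ 2 ≤
        hsInner (piAct (transp (G i)) μ (onbOf nᗮ k) ∘ₗ projL n)
          (piAct (transp (G i)) μ (onbOf nᗮ k) ∘ₗ projL n) := by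
      intro k
      rw [← hXG i, β_an _ _ (onbOf_mem nᗮ k), hsneg, ← hsInner_transp]
      refine le_trans (le_of_eq ?_) (hB _)
      refine Finset.sum_congr rfl fun j _ => ?_
      have hPG : projL n ∘ₗ G j = G j := projL_comp fun x => by rw [← hXG j]; exact gmem _ x
      rw [hsInner_comm, hsInner, hsInner, transp_transp, LinearMap.comp_assoc, hPG]
      simp only [C, LinearMap.comp_sub, LinearMap.sub_comp, map_sub, hXG]
      have e := LinearMap.trace_comp_comm' (transp (G i) ∘ₗ G j) (μ (onbOf nᗮ k))
      simp only [LinearMap.comp_assoc] at e ⊢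
      rw [← e]
      ring
    have h2 : 0 ≤ ∑ k, hsInner (piAct (transp (G i)) μ (onbOf nᗮ k) ∘ₗ projL nᗮ)
        (piAct (transp (G i)) μ (onbOf nᗮ k) ∘ₗ projL nᗮ) :=
      Finset.sum_nonneg fun k _ => hsInner_self_nonneg _
    have h3 := Finset.sum_le_sum fun k (_ : k ∈ Finset.univ) => h1 k
    linarith
  have hαβ : ∀ i, binner (piAct (transp (G i)) μ) (piAct (transp (G i)) μ) =
      binner (piAct (G i) μ) (piAct (G i) μ) := fun i => by
    rw [← hXG i]
    exact binner_piAct_transp_self hμ hi hn hR (gF _ (hXZ i)) (gmem _) (gorth _)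
  have hCG : ∀ k j, hsInner (C k (G j)) (C k (G j)) = ∑ i, hsInner (G i) (C k (G j)) ^ 2 := by
    intro k j
    refine hV _ ⟨μ (onbOf nᗮ k) (X j), hZa _ (onbOf_mem nᗮ k) _ (hXZ j), ?_⟩
    simp only [C, ← hXG j]
    rw [comm _ (hXZ j) _ (onbOf_mem nᗮ k), hL]
  have hnn : ∀ i, 0 ≤ ∑ l, hsInner (piAct (transp (G i)) μ (onbOf n l) ∘ₗ projL n)
      (piAct (transp (G i)) μ (onbOf n l) ∘ₗ projL n) :=
    fun i => Finset.sum_nonneg fun l _ => hsInner_self_nonneg _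
  have hsum : ∑ i, ∑ l, hsInner (piAct (transp (G i)) μ (onbOf n l) ∘ₗ projL n)
      (piAct (transp (G i)) μ (onbOf n l) ∘ₗ projL n) = 0 := by
    have h1 := Finset.sum_le_sum fun i (_ : i ∈ Finset.univ) => hβ i
    simp only [hαβ, hα, hCG, Finset.sum_add_distrib, ← Finset.mul_sum] at h1
    have h2 : ∑ i, ∑ k, ∑ j, hsInner (G i) (C k (G j)) ^ 2 =
        ∑ j, ∑ k, ∑ i, hsInner (G i) (C k (G j)) ^ 2 := by
      rw [Finset.sum_comm, Finset.sum_comm (γ := Fin m)]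
      exact Finset.sum_congr rfl fun k _ => Finset.sum_comm
    have h3 := Finset.sum_nonneg fun i (_ : i ∈ Finset.univ) => hnn i
    linarith
  have hGi : ∀ i, ∀ x ∈ n, ∀ y ∈ n, piAct (transp (G i)) μ x y = 0 := by
    intro i x hx y hy
    have h1 := (Finset.sum_eq_zero_iff_of_nonneg fun i _ => hnn i).1 hsum i (Finset.mem_univ i)
    have h2 : (piAct (transp (G i)) μ).flip y ∘ₗ projL n = 0 := by
      refine (adaptedONB n).toBasis.ext fun l => ?_
      rw [OrthonormalBasis.coe_toBasis]
      rcases l with l | l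
      · have h3 := eq_zero_of_hsInner_self
          ((Finset.sum_eq_zero_iff_of_nonneg fun l _ => hsInner_self_nonneg _).1 h1 l
            (Finset.mem_univ l))
        have h4 := LinearMap.congr_fun h3 y
        rw [LinearMap.comp_apply, projL_of_mem hy] at h4
        rw [adaptedONB_inl, LinearMap.comp_apply, projL_of_mem (onbOf_mem n l)]
        exact h4
      · rw [adaptedONB_inr, LinearMap.comp_apply, projL_of_orthogonal (onbOf_mem nᗮ l), map_zero,
          LinearMap.zero_apply]
    have h3 := LinearMap.congr_fun h2 x
    rw [LinearMap.comp_apply, projL_of_mem hx] at h3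
    exact h3
  intro Y hY x hx y hy
  have hYV : adOn μ n Y ∈ Submodule.span ℝ (Set.range G) := hVG ▸ ⟨Y, hY, rfl⟩
  clear hY
  generalize adOn μ n Y = T at hYV ⊢
  induction hYV using Submodule.span_induction with
  | mem T hT =>
    obtain ⟨i, rfl⟩ := hT
    exact hGi i x hx y hy
  | zero => simp [piAct_apply, transp]
  | add T S _ _ hT hS =>
    rw [piAct_apply] at hT hS ⊢
    rw [transp_add]
    simp only [LinearMap.add_apply, map_add]
    have h := congrArg₂ (· + ·) hT hS
    simp only [add_zero] at h
    rw [← h]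
    abel
  | smul r T _ hT =>
    rw [piAct_apply] at hT ⊢
    rw [transp_smul]
    simp only [LinearMap.smul_apply, map_smul, ← smul_sub, hT, smul_zero]

end Abelian

section AbelianConclusion

variable {E : Type*} [NormedAddCommGroup E] [InnerProductSpace ℝ E] [FiniteDimensional ℝ E]
  {μ : E →ₗ[ℝ] E →ₗ[ℝ] E} {n : Submodule ℝ E}

/-- If `ad X|ₙ` has the property that its transpose is a derivation of `n`, then it vanishes. -/
theorem adOn_eq_zero_of_piAct_transp (hμ : IsLieBracket μ) (hi : IsIdeal μ n)
    (hn : IsNilpotentOn μ n) {X : E} (hX : X ∈ n)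
    (h : ∀ x ∈ n, ∀ y ∈ n, piAct (transp (adOn μ n X)) μ x y = 0) : adOn μ n X = 0 := by
  have gmem : ∀ Y x, adOn μ n Y x ∈ n := fun Y x => hi _ _ (projL_mem n x)
  have gorth : ∀ Y, ∀ x ∈ nᗮ, adOn μ n Y x = 0 := fun Y x hx => by
    rw [adOn, LinearMap.comp_apply, projL_of_orthogonal hx, map_zero]
  have hnil : ∀ Y ∈ n, IsNilpotent (adOn μ n Y) := fun Y hY =>
    isNilpotent_br_comp hμ hi hn hY fun k y hy => by
      rwa [projL_of_mem (lcsOn_le (fun x _ => hi x) k hy)]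
  have tmem := transp_apply_mem (gorth X)
  have key : transp (adOn μ n X) ∘ₗ adOn μ n X - adOn μ n X ∘ₗ transp (adOn μ n X) =
      adOn μ n (transp (adOn μ n X) X) := by
    refine LinearMap.ext fun x => ?_
    have e1 := h X hX _ (projL_mem n x)
    rw [piAct_apply] at e1
    have e2 : transp (adOn μ n X) (projL n x) = transp (adOn μ n X) x := by
      conv_rhs => rw [← projL_add_orthogonal n x, map_add,
        transp_apply_orthogonal (gmem X) (projL_mem nᗮ x), add_zero]
    rw [e2, sub_sub, sub_eq_zero] at e1
    simp only [LinearMap.sub_apply, LinearMap.comp_apply]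
    have e3 : ∀ Y y, adOn μ n Y y = μ Y (projL n y) := fun _ _ => rfl
    rw [e3 X x, e1, e3 X (transp _ x), projL_of_mem (tmem x), e3]
    abel
  have hsymm : (adOn μ n (transp (adOn μ n X) X)).IsSymmetric := by
    rw [← key, ← transp_eq_self_iff, transp_sub, transp_comp, transp_comp, transp_transp]
  have h0 := eq_zero_of_isSymmetric_of_isNilpotent hsymm (hnil _ (tmem X))
  rw [h0, sub_eq_zero] at key
  exact eq_zero_of_normal_of_isNilpotent key (hnil X hX)

/-- The orthogonal complement of the nilradical of a solsoliton is abelian. -/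
theorem br_orthogonal_eq_zero (hμ : IsLieBracket μ) (hs : IsSolvableB μ) (hn : IsNilradical μ n)
    {c : ℝ} (hc : c < 0) {F : E →ₗ[ℝ] E} (hF : IsDeriv μ F) (hsym : F.IsSymmetric)
    (hR : Rop μ = c • LinearMap.id + F + (1 / 2 : ℝ) • Bop μ) :
    ∀ A ∈ nᗮ, ∀ A' ∈ nᗮ, μ A A' = 0 := by
  have hFn := hn.deriv_apply_mem hμ hs hF hsym
  have hFa : ∀ A ∈ nᗮ, F A = 0 := fun A hA => hn.deriv_orthogonal hμ hs hF hsym hA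
  have hbr := hn.br_mem hμ hs
  let n₀ : Submodule ℝ E := n ⊓ LinearMap.ker F
  have hn₀ : ∀ x ∈ n₀, ∀ y ∈ n₀, μ x y ∈ n₀ := fun x hx y hy => ⟨hbr x y, by
    have h1 : F x = 0 := hx.2
    have h2 : F y = 0 := hy.2
    rw [SetLike.mem_coe, LinearMap.mem_ker, hF, h1, h2]
    simp⟩
  have ha₀ : ∀ A ∈ nᗮ, ∀ x ∈ n₀, μ A x ∈ n₀ := fun A hA x hx => ⟨hbr A x, by
    have h2 : F x = 0 := hx.2
    rw [SetLike.mem_coe, LinearMap.mem_ker, hF, hFa A hA, h2]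
    simp⟩
  have haa : ∀ A ∈ nᗮ, ∀ A' ∈ nᗮ, μ A A' ∈ n₀ := fun A hA A' hA' => ⟨hbr A A', by
    rw [SetLike.mem_coe, LinearMap.mem_ker, hF, hFa A hA, hFa A' hA']
    simp⟩
  have hnil₀ : IsNilpotentOn μ n₀ := by
    obtain ⟨k, hk⟩ := hn.2.1
    exact ⟨k, le_bot_iff.1 (hk ▸ lcsOn_mono inf_le_left k)⟩
  have hZa : ∀ A ∈ nᗮ, ∀ x ∈ centerOn μ n₀, μ A x ∈ centerOn μ n₀ := fun A hA x hx =>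
    ⟨ha₀ A hA x hx.1, fun y hy => by
      have h := hμ.2 A x y
      rw [hx.2 y hy, hx.2 _ (ha₀ A hA y hy), map_zero, add_zero] at h
      exact h.symm⟩
  have hd := piAct_transp_eq_zero hμ hn.1 hn.2.1 hR hbr hF hFn hFa (Z := centerOn μ n₀)
    (fun x hx => hx.1.2) hZa (fun x hx A hA A' hA' => hx.2 _ (haa A hA A' hA'))
  have hZ : ∀ x ∈ centerOn μ n₀, ∀ y ∈ n, μ x y = 0 := fun x hx y hy => by
    have h := adOn_eq_zero_of_piAct_transp hμ hn.1 hn.2.1 hx.1.1 (hd x hx)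
    have h' := LinearMap.congr_fun h y
    rwa [adOn, LinearMap.comp_apply, projL_of_mem hy] at h'
  have hZi : IsIdeal μ (centerOn μ n₀) := fun y x hx => by
    rw [← projL_add_orthogonal n y, map_add, LinearMap.add_apply, hμ.skew (projL n y) x,
      hZ x hx _ (projL_mem n y), neg_zero, zero_add]
    exact hZa _ (projL_mem nᗮ y) x hx
  have hbot := eq_bot_of_central hμ hn.1 hn.2.1 hc hR (Z := centerOn μ n₀)
    (fun x hx => hx.1.1) (fun x hx => hx.1.2) hZi hZ
  have h0 : n₀ = ⊥ := by
    by_contra h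
    exact centerOn_ne_bot hμ hn₀ hnil₀ h hbot
  intro A hA A' hA'
  have h := haa A hA A' hA'
  rwa [h0, Submodule.mem_bot] at h

end AbelianConclusion

section RicciBlocks

variable {E : Type*} [NormedAddCommGroup E] [InnerProductSpace ℝ E] [FiniteDimensional ℝ E]

theorem inner_Rop {ι : Type*} [Fintype ι] (μ : E →ₗ[ℝ] E →ₗ[ℝ] E) (b : OrthonormalBasis ι ℝ E)
    (x y : E) : ⟪Rop μ x, y⟫ = -(1 / 2 : ℝ) * ∑ i, ⟪μ (b i) x, μ (b i) y⟫ +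
      (1 / 4 : ℝ) * ∑ i, ⟪transp (μ (b i)) x, transp (μ (b i)) y⟫ := by
  have h1 := (hsInner_eq_sum b (μ.flip x) (μ.flip y)).symm.trans
    (hsInner_eq_sum (stdONB E) (μ.flip x) (μ.flip y))
  have h2 := (hsInner_eq_sum b ((adjL ∘ₗ μ).flip x) ((adjL ∘ₗ μ).flip y)).symm.trans
    (hsInner_eq_sum (stdONB E) ((adjL ∘ₗ μ).flip x) ((adjL ∘ₗ μ).flip y))
  simp only [LinearMap.flip_apply] at h1
  change ∑ i, ⟪transp (μ (b i)) x, transp (μ (b i)) y⟫ =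
    ∑ i, ⟪transp (μ (stdONB E i)) x, transp (μ (stdONB E i)) y⟫ at h2
  rw [h1, h2, Rop]
  simp only [LinearMap.add_apply, LinearMap.smul_apply, LinearMap.sum_apply, inner_add_left,
    real_inner_smul_left, sum_inner, LinearMap.comp_apply, transp_inner_left]
  congr 2
  exact Finset.sum_congr rfl fun i _ => by rw [← transp_inner_right, transp_inner_left]

theorem inner_projL_projL (p : Submodule ℝ E) (u v : E) :
    ⟪projL p u, projL p v⟫ = ∑ i, ⟪u, onbOf p i⟫ * ⟪v, onbOf p i⟫ := by
  rw [← OrthonormalBasis.sum_inner_mul_inner (adaptedONB p),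
    sum_adaptedONB p fun x => ⟪projL p u, x⟫ * ⟪x, projL p v⟫]
  have h : ∀ (w x : E), ⟪projL p w, x⟫ = ⟪w, projL p x⟫ := fun w x => projL_isSymmetric p w x
  simp only [h, projL_of_mem (onbOf_mem p _), projL_of_orthogonal (onbOf_mem pᗮ _),
    inner_zero_right, zero_mul, Finset.sum_const_zero, add_zero]
  refine Finset.sum_congr rfl fun i _ => ?_
  rw [real_inner_comm _ (onbOf p i), h, projL_of_mem (onbOf_mem p _)]

theorem inner_eq_projL_add (p : Submodule ℝ E) (u v : E) :
    ⟪u, v⟫ = ⟪projL p u, projL p v⟫ + ⟪projL pᗮ u, projL pᗮ v⟫ := by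
  have h1 : ⟪projL p u, projL pᗮ v⟫ = 0 := projL_mem pᗮ v _ (projL_mem p u)
  have h2 : ⟪projL pᗮ u, projL p v⟫ = 0 := by
    rw [real_inner_comm]
    exact projL_mem pᗮ u _ (projL_mem p v)
  conv_lhs => rw [← projL_add_orthogonal p u, ← projL_add_orthogonal p v]
  rw [inner_add_left, inner_add_right, inner_add_right, h1, h2]
  ring

/-- A Lie bracket together with a nilpotent ideal `n` containing all brackets such that `nᗮ` is
abelian and acts by normal operators whose transposes are derivations. -/
structure NormalSplitting (μ : E →ₗ[ℝ] E →ₗ[ℝ] E) (n : Submodule ℝ E) : Prop where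
  lie : IsLieBracket μ
  nilpotent : IsNilpotentOn μ n
  br_mem : ∀ x y, μ x y ∈ n
  abelian : ∀ A ∈ nᗮ, ∀ A' ∈ nᗮ, μ A A' = 0
  deriv : ∀ A ∈ nᗮ, IsDeriv μ (transp (μ A))

namespace NormalSplitting

variable {μ : E →ₗ[ℝ] E →ₗ[ℝ] E} {n : Submodule ℝ E}

theorem ideal (h : NormalSplitting μ n) : IsIdeal μ n := fun x y _ => h.br_mem x y

theorem transp_mem (h : NormalSplitting μ n) {A : E} (hA : A ∈ nᗮ) (x : E) :
    transp (μ A) x ∈ n :=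
  transp_apply_mem (h.abelian A hA) x

theorem transp_orthogonal (h : NormalSplitting μ n) (x : E) {A : E} (hA : A ∈ nᗮ) :
    transp (μ x) A = 0 :=
  transp_apply_orthogonal (h.br_mem x) hA

theorem br_comp_br (h : NormalSplitting μ n) {A A' : E} (hA : A ∈ nᗮ) (hA' : A' ∈ nᗮ) :
    μ A ∘ₗ μ A' = μ A' ∘ₗ μ A := by
  rw [(h.lie.isDeriv A).comp_br, h.abelian A hA A' hA', map_zero, zero_add]

theorem transp_comp_br (h : NormalSplitting μ n) {A A' : E} (hA : A ∈ nᗮ) (hA' : A' ∈ nᗮ) :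
    transp (μ A) ∘ₗ μ A' = μ A' ∘ₗ transp (μ A) := by
  rw [(h.deriv A hA).comp_br, h.transp_orthogonal A hA', map_zero, zero_add]

theorem inner_transp_transp (h : NormalSplitting μ n) {A : E} (hA : A ∈ nᗮ) (x y : E) :
    ⟪transp (μ A) x, transp (μ A) y⟫ = ⟪μ A x, μ A y⟫ := by
  have e := LinearMap.congr_fun (h.transp_comp_br hA hA) y
  simp only [LinearMap.comp_apply] at e
  rw [transp_inner_left, ← e, transp_inner_right]

theorem symPart_deriv (h : NormalSplitting μ n) {A : E} (hA : A ∈ nᗮ) :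
    IsDeriv μ (symPart (μ A)) :=
  ((h.lie.isDeriv A).add (h.deriv A hA)).smul _

theorem symPart_apply_mem (h : NormalSplitting μ n) {A : E} (hA : A ∈ nᗮ) (x : E) :
    symPart (μ A) x ∈ n :=
  n.smul_mem _ (n.add_mem (h.br_mem A x) (h.transp_mem hA x))

theorem symPart_orthogonal (h : NormalSplitting μ n) {A A' : E} (hA : A ∈ nᗮ) (hA' : A' ∈ nᗮ) :
    symPart (μ A) A' = 0 := by
  rw [symPart, LinearMap.smul_apply, LinearMap.add_apply, h.abelian A hA A' hA',
    h.transp_orthogonal A hA', add_zero, smul_zero]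

theorem symPart_comp_br (h : NormalSplitting μ n) {A A' : E} (hA : A ∈ nᗮ) (hA' : A' ∈ nᗮ) :
    symPart (μ A) ∘ₗ μ A' = μ A' ∘ₗ symPart (μ A) := by
  rw [(h.symPart_deriv hA).comp_br, h.symPart_orthogonal hA hA', map_zero, zero_add]

theorem symPart_comp_symPart (h : NormalSplitting μ n) {A A' : E} (hA : A ∈ nᗮ)
    (hA' : A' ∈ nᗮ) :
    symPart (μ A) ∘ₗ symPart (μ A') = symPart (μ A') ∘ₗ symPart (μ A) := by
  have e1 := h.symPart_comp_br hA hA'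
  have e2 := congrArg transp e1
  rw [transp_comp, transp_comp, transp_symPart] at e2
  conv_lhs => rw [symPart.eq_1 (μ A')]
  conv_rhs => rw [symPart.eq_1 (μ A')]
  rw [LinearMap.comp_smul, LinearMap.smul_comp, LinearMap.comp_add, LinearMap.add_comp, e1, e2]

theorem meanCurv_mem (h : NormalSplitting μ n) : meanCurv μ ∈ nᗮ := fun x hx => by
  rw [real_inner_comm, inner_meanCurv]
  exact trace_br_eq_zero h.lie h.ideal h.nilpotent hx

theorem Ric_inner_mem (h : NormalSplitting μ n) {Y Z : E} (hY : Y ∈ n) (hZ : Z ∈ n) :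
    ⟪Ric μ Y, Z⟫ = ⟪RopOn μ n Y, Z⟫ - ⟪symPart (μ (meanCurv μ)) Y, Z⟫ := by
  have hB := Bop_apply_eq_zero h.lie h.ideal h.nilpotent hY
  have e0 : ∀ i, ⟪transp (μ (onbOf n i)) Y, transp (μ (onbOf n i)) Z⟫ =
      ⟪projL n (transp (μ (onbOf n i)) Y), projL n (transp (μ (onbOf n i)) Z)⟫ +
      ∑ k, ⟪transp (μ (onbOf nᗮ k)) Y, onbOf n i⟫ * ⟪transp (μ (onbOf nᗮ k)) Z, onbOf n i⟫ := by
    intro i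
    rw [inner_eq_projL_add n, inner_projL_projL nᗮ]
    congr 1
    refine Finset.sum_congr rfl fun k _ => ?_
    simp only [transp_inner_left]
    rw [h.lie.skew, inner_neg_right, inner_neg_right, neg_mul_neg]
  have e1 : ∑ i, ⟪transp (μ (onbOf n i)) Y, transp (μ (onbOf n i)) Z⟫ =
      ∑ i, ⟪projL n (transp (μ (onbOf n i)) Y), projL n (transp (μ (onbOf n i)) Z)⟫ +
      ∑ k, ⟪μ (onbOf nᗮ k) Y, μ (onbOf nᗮ k) Z⟫ := by
    simp only [e0, Finset.sum_add_distrib]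
    congr 1
    rw [Finset.sum_comm]
    refine Finset.sum_congr rfl fun k _ => ?_
    rw [← inner_projL_projL, projL_of_mem (h.transp_mem (onbOf_mem nᗮ k) _),
      projL_of_mem (h.transp_mem (onbOf_mem nᗮ k) _), h.inner_transp_transp (onbOf_mem nᗮ k)]
  have e2 : ⟪RopOn μ n Y, Z⟫ = -(1 / 2 : ℝ) * ∑ i, ⟪μ (onbOf n i) Y, μ (onbOf n i) Z⟫ +
      (1 / 4 : ℝ) *
      ∑ i, ⟪projL n (transp (μ (onbOf n i)) Y), projL n (transp (μ (onbOf n i)) Z)⟫ := by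
    rw [RopOn]
    simp only [LinearMap.add_apply, LinearMap.smul_apply, LinearMap.sum_apply, inner_add_left,
      real_inner_smul_left, sum_inner, LinearMap.comp_apply, adOn, transp_comp,
      transp_projL, projL_of_mem hY]
    congr 2
    · refine Finset.sum_congr rfl fun i _ => ?_
      rw [projL_isSymmetric, projL_of_mem hZ, transp_inner_left]
    · refine Finset.sum_congr rfl fun i _ => ?_
      rw [← transp_inner_right, projL_isSymmetric]
  rw [Ric, LinearMap.sub_apply, LinearMap.sub_apply, LinearMap.smul_apply, hB, smul_zero, sub_zero,
    inner_sub_left, inner_Rop μ (adaptedONB n),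
    sum_adaptedONB n fun x => ⟪μ x Y, μ x Z⟫,
    sum_adaptedONB n fun x => ⟪transp (μ x) Y, transp (μ x) Z⟫, e1, e2]
  have e3 : ∑ k, ⟪transp (μ (onbOf nᗮ k)) Y, transp (μ (onbOf nᗮ k)) Z⟫ =
      ∑ k, ⟪μ (onbOf nᗮ k) Y, μ (onbOf nᗮ k) Z⟫ :=
    Finset.sum_congr rfl fun k _ => h.inner_transp_transp (onbOf_mem nᗮ k) Y Z
  rw [e3]
  ring

theorem inner_Rop_orthogonal (h : NormalSplitting μ n) {A : E} (hA : A ∈ nᗮ) (y : E) :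
    ⟪Rop μ A, y⟫ = -(1 / 2 : ℝ) * ∑ i, ⟪μ (onbOf n i) A, μ (onbOf n i) y⟫ := by
  rw [inner_Rop μ (adaptedONB n), sum_adaptedONB n fun x => ⟪μ x A, μ x y⟫]
  simp only [h.transp_orthogonal _ hA, h.abelian _ (onbOf_mem nᗮ _) A hA, inner_zero_left,
    Finset.sum_const_zero, add_zero, mul_zero]

theorem br_comp_projL (h : NormalSplitting μ n) {A : E} (hA : A ∈ nᗮ) :
    μ A ∘ₗ projL n = μ A := comp_projL (h.abelian A hA)

theorem Ric_inner_orthogonal (h : NormalSplitting μ n) {A A' : E} (hA : A ∈ nᗮ) (hA' : A' ∈ nᗮ) :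
    ⟪Ric μ A, A'⟫ = - LinearMap.trace ℝ E (symPart (μ A) ∘ₗ symPart (μ A')) := by
  have e1 : ∑ i, ⟪μ (onbOf n i) A, μ (onbOf n i) A'⟫ =
      LinearMap.trace ℝ E (transp (μ A') ∘ₗ μ A) := by
    have e := hsInner_comp_projL n (μ A) (μ A')
    rw [h.br_comp_projL hA, h.br_comp_projL hA', hsInner] at e
    rw [e]
    refine Finset.sum_congr rfl fun i _ => ?_
    rw [h.lie.skew _ A, h.lie.skew _ A', inner_neg_neg]
  have e2 : LinearMap.trace ℝ E (transp (μ A) ∘ₗ μ A') =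
      LinearMap.trace ℝ E (transp (μ A') ∘ₗ μ A) := by
    rw [← trace_transp, transp_comp, transp_transp]
  have e3 : LinearMap.trace ℝ E (μ A ∘ₗ transp (μ A')) =
      LinearMap.trace ℝ E (transp (μ A') ∘ₗ μ A) := LinearMap.trace_comp_comm' _ _
  have e4 : LinearMap.trace ℝ E (transp (μ A) ∘ₗ transp (μ A')) =
      LinearMap.trace ℝ E (μ A ∘ₗ μ A') := by
    rw [← transp_comp, trace_transp, h.br_comp_br hA hA']
  rw [Ric, LinearMap.sub_apply, LinearMap.sub_apply, LinearMap.smul_apply,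
    h.symPart_orthogonal h.meanCurv_mem hA, sub_zero, inner_sub_left, real_inner_smul_left,
    inner_Bop, h.inner_Rop_orthogonal hA, e1, symPart, symPart]
  simp only [LinearMap.smul_comp, LinearMap.comp_smul, LinearMap.add_comp, LinearMap.comp_add,
    map_smul, map_add, smul_eq_mul, e2, e3, e4]
  ring

theorem Ric_inner_orthogonal_mem (h : NormalSplitting μ n) {A Y : E} (hA : A ∈ nᗮ) (hY : Y ∈ n) :
    ⟪Ric μ A, Y⟫ = 0 := by
  have e1 : ∑ i, ⟪μ (onbOf n i) A, μ (onbOf n i) Y⟫ = 0 := by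
    have e := hsInner_comp_projL n (μ A) (μ Y)
    rw [hsInner_comm, h.br_comp_projL hA, hsInner, LinearMap.trace_comp_comm',
      LinearMap.comp_assoc, projL_comp (h.transp_mem hA),
      trace_br_comp_deriv_eq_zero h.lie h.ideal h.nilpotent hY (h.deriv A hA)
        fun y _ => h.transp_mem hA y] at e
    rw [e]
    refine Finset.sum_congr rfl fun i _ => ?_
    rw [h.lie.skew _ A, h.lie.skew _ Y, inner_neg_neg]
  have hB : ⟪Bop μ A, Y⟫ = 0 := by
    rw [Bop_isSymmetric, Bop_apply_eq_zero h.lie h.ideal h.nilpotent hY, inner_zero_right]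
  rw [Ric, LinearMap.sub_apply, LinearMap.sub_apply, LinearMap.smul_apply,
    h.symPart_orthogonal h.meanCurv_mem hA, sub_zero, inner_sub_left, real_inner_smul_left,
    hB, h.inner_Rop_orthogonal hA, e1]
  ring

end NormalSplitting

end RicciBlocks

section ModBracket

variable {E : Type*} [NormedAddCommGroup E] [InnerProductSpace ℝ E] [FiniteDimensional ℝ E]
  {μ : E →ₗ[ℝ] E →ₗ[ℝ] E} {n : Submodule ℝ E}

theorem normalSplitting_of_Ric (hμ : IsLieBracket μ) (hs : IsSolvableB μ) (hn : IsNilradical μ n)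
    {c : ℝ} (hc : c < 0) {F : E →ₗ[ℝ] E} (hF : IsDeriv μ F) (hsym : F.IsSymmetric)
    (hR : Rop μ = c • LinearMap.id + F + (1 / 2 : ℝ) • Bop μ) : NormalSplitting μ n where
  lie := hμ
  nilpotent := hn.2.1
  br_mem := hn.br_mem hμ hs
  abelian := br_orthogonal_eq_zero hμ hs hn hc hF hsym hR
  deriv A hA := by
    have hFA : F ∘ₗ μ A = μ A ∘ₗ F := by
      rw [hF.comp_br, hn.deriv_orthogonal hμ hs hF hsym hA, map_zero, zero_add]
    have h := binner_piAct_transp_self hμ hn.1 hn.2.1 hR hFA (hn.br_mem hμ hs A)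
      (br_orthogonal_eq_zero hμ hs hn hc hF hsym hR A hA)
    rw [isDeriv_iff_piAct.1 (hμ.isDeriv A)] at h
    refine isDeriv_iff_piAct.2 (eq_zero_of_binner_self (h.trans ?_))
    simp [binner]

theorem symAct_apply (x : E) : symAct μ n x = symPart (μ (projL nᗮ x)) := rfl

theorem modBracket_apply (x y : E) : modBracket μ n x y =
    μ (projL n x) (projL n y) + symAct μ n x (projL n y) - symAct μ n y (projL n x) := rfl

theorem modBracket_of_mem {x y : E} (hx : x ∈ n) (hy : y ∈ n) : modBracket μ n x y = μ x y := by
  have h : ∀ z ∈ n, projL nᗮ z = 0 := fun z hz =>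
    projL_of_orthogonal (n.le_orthogonal_orthogonal hz)
  rw [modBracket_apply, symAct_apply, symAct_apply, h x hx, h y hy, projL_of_mem hx,
    projL_of_mem hy]
  simp [symPart, transp]

theorem symAct_of_mem {x : E} (hx : x ∈ n) : symAct μ n x = 0 := by
  rw [symAct_apply, projL_of_orthogonal (n.le_orthogonal_orthogonal hx)]
  simp [symPart, transp]

theorem RopOn_modBracket : RopOn (modBracket μ n) n = RopOn μ n := by
  have e : ∀ i, adOn (modBracket μ n) n (onbOf n i) = adOn μ n (onbOf n i) := fun i =>
    LinearMap.ext fun x => by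
      rw [adOn, adOn, LinearMap.comp_apply, LinearMap.comp_apply,
        modBracket_of_mem (onbOf_mem n i) (projL_mem n x)]
  simp only [RopOn, e]

namespace NormalSplitting

theorem symAct_isDeriv (h : NormalSplitting μ n) (x : E) : IsDeriv μ (symAct μ n x) :=
  h.symPart_deriv (projL_mem nᗮ x)

theorem symAct_mem (h : NormalSplitting μ n) (x y : E) : symAct μ n x y ∈ n :=
  h.symPart_apply_mem (projL_mem nᗮ x) y

theorem symAct_projL (h : NormalSplitting μ n) (x y : E) :
    symAct μ n x (projL n y) = symAct μ n x y :=
  LinearMap.congr_fun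
    (comp_projL fun _ hA => h.symPart_orthogonal (projL_mem nᗮ x) hA) y

theorem modBracket_apply (h : NormalSplitting μ n) (x y : E) : modBracket μ n x y =
    μ (projL n x) (projL n y) + symAct μ n x y - symAct μ n y x := by
  rw [_root_.modBracket_apply, h.symAct_projL, h.symAct_projL]

theorem modBracket_mem (h : NormalSplitting μ n) (x y : E) : modBracket μ n x y ∈ n := by
  rw [h.modBracket_apply]
  exact n.sub_mem (n.add_mem (h.br_mem _ _) (h.symAct_mem _ _)) (h.symAct_mem _ _)

theorem modBracket_orthogonal (h : NormalSplitting μ n) {A : E} (hA : A ∈ nᗮ) :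
    modBracket μ n A = symPart (μ A) := by
  refine LinearMap.ext fun y => ?_
  rw [h.modBracket_apply, projL_of_orthogonal hA, map_zero, LinearMap.zero_apply, zero_add,
    symAct_apply, projL_of_mem hA, symAct_apply, h.symPart_orthogonal (projL_mem nᗮ y) hA,
    sub_zero]

theorem modBracket_lie (h : NormalSplitting μ n) : IsLieBracket (modBracket μ n) := by
  refine ⟨fun x => ?_, fun x y z => ?_⟩
  · rw [h.modBracket_apply, h.lie.1, zero_add, sub_self]
  · have hm := h.modBracket_mem
    have e1 : ∀ x y z, modBracket μ n x (modBracket μ n y z) =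
        μ (projL n x) (modBracket μ n y z) + symAct μ n x (modBracket μ n y z) := fun x y z => by
      rw [h.modBracket_apply x, symAct_of_mem (hm y z), projL_of_mem (hm y z),
        LinearMap.zero_apply, sub_zero]
    have e2 : modBracket μ n (modBracket μ n x y) z =
        μ (modBracket μ n x y) (projL n z) - symAct μ n z (modBracket μ n x y) := by
      rw [h.modBracket_apply _ z, symAct_of_mem (hm x y), projL_of_mem (hm x y),
        LinearMap.zero_apply, add_zero]
    have e3 : ∀ x y z, symAct μ n x (μ (projL n y) (projL n z)) =
        μ (symAct μ n x y) (projL n z) + μ (projL n y) (symAct μ n x z) := fun x y z => by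
      rw [h.symAct_isDeriv x, h.symAct_projL, h.symAct_projL]
    have e4 : ∀ x y w, symAct μ n x (symAct μ n y w) = symAct μ n y (symAct μ n x w) :=
      fun x y w => LinearMap.congr_fun
        (h.symPart_comp_symPart (projL_mem nᗮ x) (projL_mem nᗮ y)) w
    rw [e1, e1, e2]
    simp only [h.modBracket_apply, map_add, map_sub, LinearMap.add_apply, LinearMap.sub_apply, e3]
    rw [h.lie.2 (projL n x) (projL n y) (projL n z), h.lie.skew (symAct μ n z x),
      e4 x y z, e4 x z y, e4 y z x]
    abel

theorem modBracket_isSymmetric (h : NormalSplitting μ n) {A : E} (hA : A ∈ nᗮ) :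
    (modBracket μ n A).IsSymmetric := by
  rw [h.modBracket_orthogonal hA]
  exact symPart_isSymmetric _

theorem lcsOn_modBracket (h : NormalSplitting μ n) (k : ℕ) :
    lcsOn (modBracket μ n) n k = lcsOn μ n k := by
  induction k with
  | zero => rfl
  | succ k ih =>
    have hle : lcsOn μ n k ≤ n := lcsOn_le (fun x _ y _ => h.br_mem x y) k
    change bracketSpan _ n (lcsOn (modBracket μ n) n k) = bracketSpan μ n (lcsOn μ n k)
    rw [ih]
    refine le_antisymm (bracketSpan_le.2 fun x hx y hy => ?_)
      (bracketSpan_le.2 fun x hx y hy => ?_)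
    · rw [modBracket_of_mem hx (hle hy)]
      exact mem_bracketSpan hx hy
    · rw [← modBracket_of_mem hx (hle hy)]
      exact mem_bracketSpan hx hy

protected theorem modBracket (h : NormalSplitting μ n) : NormalSplitting (modBracket μ n) n where
  lie := h.modBracket_lie
  nilpotent := by
    obtain ⟨k, hk⟩ := h.nilpotent
    exact ⟨k, (h.lcsOn_modBracket k).trans hk⟩
  br_mem := h.modBracket_mem
  abelian A hA A' hA' := by rw [h.modBracket_orthogonal hA, h.symPart_orthogonal hA hA']
  deriv A hA := by
    rw [transp_eq_self_iff.2 (h.modBracket_isSymmetric hA)]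
    exact h.modBracket_lie.isDeriv A

theorem modBracket_isNilradical (h : NormalSplitting μ n)
    (h0 : ∀ A ∈ nᗮ, LinearMap.trace ℝ E (symPart (μ A) ∘ₗ symPart (μ A)) = 0 → A = 0) :
    IsNilradical (modBracket μ n) n := by
  refine ⟨h.modBracket.ideal, h.modBracket.nilpotent, fun q hq hqn x hx => ?_⟩
  have e1 := Bop_apply_eq_zero h.modBracket_lie hq hqn hx
  rw [← projL_add_orthogonal n x, map_add, Bop_apply_eq_zero h.modBracket_lie h.modBracket.ideal
    h.modBracket.nilpotent (projL_mem n x), zero_add] at e1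
  have hQ := projL_mem nᗮ x
  have e2 := inner_Bop (modBracket μ n) (projL nᗮ x) (projL nᗮ x)
  rw [e1, inner_zero_left, h.modBracket_orthogonal hQ] at e2
  rw [← projL_add_orthogonal n x, h0 _ hQ e2.symm, add_zero]
  exact projL_mem n x

theorem meanCurv_modBracket (h : NormalSplitting μ n) :
    meanCurv (modBracket μ n) = meanCurv μ := by
  refine ext_inner_right ℝ fun y => ?_
  rw [inner_meanCurv, inner_meanCurv, ← projL_add_orthogonal n y, map_add, map_add, map_add,
    map_add, h.modBracket_orthogonal (projL_mem nᗮ y), trace_symPart,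
    trace_br_eq_zero h.lie h.ideal h.nilpotent (projL_mem n y),
    trace_br_eq_zero h.modBracket_lie h.modBracket.ideal h.modBracket.nilpotent (projL_mem n y)]

theorem Ric_modBracket (h : NormalSplitting μ n) : Ric (modBracket μ n) = Ric μ := by
  have hH := h.meanCurv_mem
  have hS : symPart (modBracket μ n (meanCurv μ)) = symPart (μ (meanCurv μ)) := by
    rw [h.modBracket_orthogonal hH, symPart_eq_self (symPart_isSymmetric _)]
  have enn : ∀ x ∈ n, ∀ y ∈ n, ⟪Ric (modBracket μ n) x, y⟫ = ⟪Ric μ x, y⟫ := fun x hx y hy => by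
    rw [h.Ric_inner_mem hx hy, h.modBracket.Ric_inner_mem hx hy, RopOn_modBracket,
      h.meanCurv_modBracket, hS]
  have eaa : ∀ x ∈ nᗮ, ∀ y ∈ nᗮ, ⟪Ric (modBracket μ n) x, y⟫ = ⟪Ric μ x, y⟫ :=
    fun x hx y hy => by
      rw [h.Ric_inner_orthogonal hx hy, h.modBracket.Ric_inner_orthogonal hx hy,
        h.modBracket_orthogonal hx, h.modBracket_orthogonal hy,
        symPart_eq_self (symPart_isSymmetric _), symPart_eq_self (symPart_isSymmetric _)]
  have ean : ∀ x ∈ nᗮ, ∀ y ∈ n, ⟪Ric (modBracket μ n) x, y⟫ = ⟪Ric μ x, y⟫ := fun x hx y hy => by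
    rw [h.Ric_inner_orthogonal_mem hx hy, h.modBracket.Ric_inner_orthogonal_mem hx hy]
  have ena : ∀ x ∈ n, ∀ y ∈ nᗮ, ⟪Ric (modBracket μ n) x, y⟫ = ⟪Ric μ x, y⟫ := fun x hx y hy => by
    rw [Ric_isSymmetric, Ric_isSymmetric, real_inner_comm, real_inner_comm (Ric μ y)]
    exact ean y hy x hx
  refine LinearMap.ext fun x => ext_inner_right ℝ fun y => ?_
  have hx := projL_mem n x
  have hy := projL_mem n y
  have hx' := projL_mem nᗮ x
  have hy' := projL_mem nᗮ y
  rw [← projL_add_orthogonal n x, ← projL_add_orthogonal n y]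
  simp only [map_add, inner_add_left, inner_add_right]
  rw [enn _ hx _ hy, eaa _ hx' _ hy', ean _ hx' _ hy, ena _ hx _ hy']

/-- A symmetric derivation of `μ` that kills `nᗮ` is a derivation of the modified bracket. -/
theorem isDeriv_modBracket (h : NormalSplitting μ n) {D : E →ₗ[ℝ] E} (hD : IsDeriv μ D)
    (hsym : D.IsSymmetric) (hDn : ∀ x, D x ∈ n) (hDa : ∀ A ∈ nᗮ, D A = 0) :
    IsDeriv (modBracket μ n) D := by
  have hP : ∀ x, projL n (D x) = D (projL n x) := fun x => by
    rw [projL_of_mem (hDn x)]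
    exact (LinearMap.congr_fun (comp_projL hDa) x).symm
  have hS : ∀ x y, D (symAct μ n x y) = symAct μ n x (D y) := fun x y => by
    have e1 : D ∘ₗ μ (projL nᗮ x) = μ (projL nᗮ x) ∘ₗ D := by
      rw [hD.comp_br, hDa _ (projL_mem nᗮ x), map_zero, zero_add]
    have e2 := congrArg transp e1
    rw [transp_comp, transp_comp, transp_eq_self_iff.2 hsym] at e2
    have e1' := LinearMap.congr_fun e1 y
    have e2' := LinearMap.congr_fun e2 y
    simp only [LinearMap.comp_apply] at e1' e2'
    simp only [symAct_apply, symPart, LinearMap.smul_apply, LinearMap.add_apply, map_smul, map_add,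
      e1', e2']
  intro x y
  simp only [h.modBracket_apply, map_add, map_sub, hS, hP, symAct_of_mem (hDn _),
    LinearMap.zero_apply, hD (projL n x) (projL n y)]
  abel

end NormalSplitting

end ModBracket

/-- for a solsoliton `(s, [⬝,⬝], ⟨⬝,⬝⟩)` with `Ric = c I + D`, `c < 0`, nilradical
`n` and `a = nᗮ`, the modified bracket `[⬝,⬝]'` (with `[A,A']' = 0`, `[A,X]' = S(ad A) X`,
`[X,Y]' = [X,Y]`) is a Lie bracket; `(n, ⟨⬝,⬝⟩|ₙ)` is a nilsoliton with `Ric₁ = c I + D₁`; the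
operators `S(ad A)|ₙ`, `A ∈ a`, form an abelian Lie algebra of symmetric derivations of `n`;
`⟨A, A⟩ = -(1/c) tr((S(ad A)|ₙ)²)`; and `(s, [⬝,⬝]', ⟨⬝,⬝⟩)` coincides with the standard
construction applied to this nilsoliton and this abelian algebra, hence is again a solsoliton
with the same constant `c`. -/
theorem solsoliton_modified_bracket
    {E : Type*} [NormedAddCommGroup E] [InnerProductSpace ℝ E] [FiniteDimensional ℝ E]
    (μ : E →ₗ[ℝ] E →ₗ[ℝ] E) (hLie : IsLieBracket μ) (hsolv : IsSolvableB μ)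
    (n : Submodule ℝ E) (hn : IsNilradical μ n)
    (c : ℝ) (hc : c < 0) (D : E →ₗ[ℝ] E) (hD : IsDeriv μ D)
    (hRic : Ric μ = c • LinearMap.id + D)
    (ν : E →ₗ[ℝ] E →ₗ[ℝ] E) (hν : ν = modBracket μ n) :
    -- `[⬝,⬝]'` is a Lie bracket on `s`:
    IsLieBracket ν ∧
      -- `(n, ⟨⬝,⟩|ₙ)` is a nilsoliton with `Ric₁ = c I + D₁`:
      (∃ D₁ : E →ₗ[ℝ] E, IsNilsolitonOn μ n c D₁) ∧
      -- the `S(ad A)|ₙ`, `A ∈ a`, form an abelian Lie algebra of symmetric derivations of `n`: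
      (∀ A ∈ nᗮ, (∀ X ∈ n, symPart (μ A) X ∈ n) ∧ (symPart (μ A)).IsSymmetric ∧
        (∀ X ∈ n, ∀ Y ∈ n,
          symPart (μ A) (μ X Y) = μ (symPart (μ A) X) Y + μ X (symPart (μ A) Y)) ∧
        ∀ A' ∈ nᗮ, ∀ X ∈ n,
          symPart (μ A) (symPart (μ A') X) = symPart (μ A') (symPart (μ A) X)) ∧
      -- `⟨A, A⟩ = -(1/c)·tr((S(ad A)|ₙ)²)`:
      (∀ A ∈ nᗮ, ⟪A, A⟫ = -(1 / c) * LinearMap.trace ℝ E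
        ((symPart (μ A) ∘ₗ projL n) ∘ₗ (symPart (μ A) ∘ₗ projL n))) ∧
      -- `(s, [⬝,⬝]', ⟨⬝,⬝⟩)` is exactly the standard construction from the nilsoliton
      -- `(n, ⟨⬝,⬝⟩|ₙ)` and the abelian algebra `{S(ad A)|ₙ : A ∈ a}`:
      (IsNilradical ν n ∧ (∀ A ∈ nᗮ, ∀ A' ∈ nᗮ, ν A A' = 0) ∧
        (∀ A ∈ nᗮ, (ν A).IsSymmetric) ∧
        (∀ A ∈ nᗮ, ∀ A' ∈ nᗮ,
          ⟪A, A'⟫ = -(1 / c) * LinearMap.trace ℝ E ((ν A) ∘ₗ (ν A'))) ∧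
        (∀ A ∈ nᗮ, ∀ X ∈ n, ν A X = symPart (μ A) X) ∧
        ∀ X ∈ n, ∀ Y ∈ n, ν X Y = μ X Y) ∧
      -- hence it is again a solsoliton with the same constant `c`:
      ∃ D' : E →ₗ[ℝ] E, IsDeriv ν D' ∧ Ric ν = c • LinearMap.id + D' := by
  subst hν
  have hF := isDeriv_symPart_add hLie hc hD hRic
  have hDsym := isSymmetric_of_Ric hRic
  have hFsym : (symPart (μ (meanCurv μ)) + D).IsSymmetric :=
    (symPart_isSymmetric _).add hDsym
  have h := normalSplitting_of_Ric hLie hsolv hn hc hF hFsym (Rop_eq_of_Ric hRic)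
  have hFa : ∀ A ∈ nᗮ, (symPart (μ (meanCurv μ)) + D) A = 0 := fun A hA =>
    hn.deriv_orthogonal hLie hsolv hF hFsym hA
  have hFn := hn.deriv_apply_mem hLie hsolv hF hFsym
  have hDa : ∀ A ∈ nᗮ, D A = 0 := fun A hA => by
    have e := hFa A hA
    rwa [LinearMap.add_apply, h.symPart_orthogonal h.meanCurv_mem hA, zero_add] at e
  have hDn : ∀ x, D x ∈ n := fun x => by
    have e := n.sub_mem (hFn x) (h.symPart_apply_mem h.meanCurv_mem x)
    rwa [LinearMap.add_apply, add_sub_cancel_left] at e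
  have hinner : ∀ A ∈ nᗮ, ∀ A' ∈ nᗮ, ⟪A, A'⟫ =
      -(1 / c) * LinearMap.trace ℝ E (symPart (μ A) ∘ₗ symPart (μ A')) := fun A hA A' hA' => by
    have e := h.Ric_inner_orthogonal hA hA'
    rw [hRic, LinearMap.add_apply, hDa A hA, add_zero, LinearMap.smul_apply, LinearMap.id_apply,
      real_inner_smul_left] at e
    have hc' := hc.ne
    field_simp
    linarith
  refine ⟨h.modBracket_lie, ⟨symPart (μ (meanCurv μ)) + D, fun X _ => hFn X, fun X _ Y _ => hF X Y,
    fun X hX => ?_⟩, fun A hA => ⟨fun X _ => h.symPart_apply_mem hA X, symPart_isSymmetric _,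
    fun X _ Y _ => h.symPart_deriv hA X Y, fun A' hA' X _ =>
      LinearMap.congr_fun (h.symPart_comp_symPart hA hA') X⟩, fun A hA => ?_,
    ⟨h.modBracket_isNilradical fun A hA e => ?_, h.modBracket.abelian,
      fun A hA => h.modBracket_isSymmetric hA, fun A hA A' hA' => ?_,
      fun A hA X _ => by rw [h.modBracket_orthogonal hA], fun X hX Y hY => modBracket_of_mem hX hY⟩,
    D, h.isDeriv_modBracket hD hDsym hDn hDa, h.Ric_modBracket.trans hRic⟩
  · have hmem : RopOn μ n X ∈ n := by
      have gorth : ∀ Y, ∀ x ∈ nᗮ, adOn μ n Y x = 0 := fun Y x hx => by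
        rw [adOn, LinearMap.comp_apply, projL_of_orthogonal hx, map_zero]
      simp only [RopOn, LinearMap.add_apply, LinearMap.smul_apply, LinearMap.sum_apply]
      exact n.add_mem
        (n.smul_mem _ (n.sum_mem fun i _ => transp_apply_mem (gorth _) _))
        (n.smul_mem _ (n.sum_mem fun i _ => h.br_mem _ _))
    have hw : RopOn μ n X - (c • X + (symPart (μ (meanCurv μ)) + D) X) ∈ n :=
      n.sub_mem hmem (n.add_mem (n.smul_mem c hX) (hFn X))
    have e := h.Ric_inner_mem hX hw
    rw [hRic] at e
    rw [← sub_eq_zero, ← inner_self_eq_zero (𝕜 := ℝ)]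
    nth_rewrite 1 [inner_sub_left]
    simp only [LinearMap.add_apply, LinearMap.smul_apply, LinearMap.id_apply, inner_add_left]
      at e ⊢
    linarith
  · rw [comp_projL fun A' hA' => h.symPart_orthogonal hA hA']
    exact hinner A hA A hA
  · have e' := hinner A hA A hA
    rwa [e, mul_zero, inner_self_eq_zero] at e'
  · rw [h.modBracket_orthogonal hA, h.modBracket_orthogonal hA']
    exact hinner A hA A' hA'
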